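/- arXiv:math/9904151 — 3 statements merged into one kernel-verified Lean document; each statement's English description precedes it below -/
import Mathlib

section
/- Let n ≥ 2 and k ≥ 1. Let v = (G, F) be a holomorphic vector field on a neighborhood of 0 in ℂ^{n−1} × ℂ such that G(y,t) = B·y + R(y,t) with ‖R(y,t)‖ ≤ C(‖y‖² + ‖y‖·|t| + |t|^{k+1}) near 0, and F(y,t) = t^{k+1} + R₀(y,t) with |R₀(y,t)| ≤ C‖y‖² near 0, where B is an invertible complex (n−1)×(n−1) matrix. Let S be a good sector for (B,k). Then there exist r > 0 and a holomorphic function q : S^r → ℂ^{n−1} such that: (i) q extends continuously to 0 with q(0) = 0 and q′ is bounded on S^r; (ii) the graph of q is tangent to v, i.e. q′(t)·F(q(t), t) = G(q(t), t) for all t ∈ S^r; (iii) q is unique: any holomorphic q̃ : S^{r̃} → ℂ^{n−1} (r̃ > 0) satisfying (i) and (ii) coincides with q on S^{min(r,r̃)}; (iv) there is a sequence of vectors (c_m)_{m≥2} in ℂ^{n−1}, the same for every choice of good sector, such that for every M ≥ 2, q(t) − Σ_{m=2}^{M} c_m t^m = o(|t|^M) as t → 0 in S^r (q has an asymptotic Taylor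 series at 0, independent of the sector). -/
noncomputable section

open Complex Set Filter Metric Asymptotics Finset

/-- The open radial sector of directions strictly between `a` and `b`. -/
def Sector (a b : ℝ) : Set ℂ :=
  {z | ∃ ρ φ : ℝ, 0 < ρ ∧ a < φ ∧ φ < b ∧ z = ρ * Complex.exp (φ * Complex.I)}

/-- The sector truncated at radius `r`. -/
def SectorR (a b r : ℝ) : Set ℂ := Sector a b ∩ Metric.ball 0 r

/-- A good sector for `(B, k)`: for every eigenvalue `bv` of `B`, the sector
contains exactly one imaginary dividing ray corresponding to `bv` (a ray of
direction `φ` with `Re (bv · e^{-i k φ}) = 0`), and its closure contains no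
additional imaginary dividing rays. -/
def IsGoodSectorFor {m : ℕ} (k : ℕ) (B : Matrix (Fin m) (Fin m) ℂ) (a b : ℝ) : Prop :=
  a < b ∧ b - a ≤ 2 * Real.pi ∧
  ∀ bv ∈ spectrum ℂ B,
    (∃! φ : ℝ, φ ∈ Set.Icc a b ∧ (bv * Complex.exp (-(k : ℂ) * (φ : ℂ) * Complex.I)).re = 0) ∧
    (∀ φ ∈ Set.Icc a b,
      (bv * Complex.exp (-(k : ℂ) * (φ : ℂ) * Complex.I)).re = 0 → a < φ ∧ φ < b)

/-- The open cone of complex numbers `ζ` with `cos (arg ζ) > c`. -/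
def Cone (c : ℝ) : Set ℂ := {ζ | c * ‖ζ‖ < ζ.re}

lemma isOpen_cone (c : ℝ) : IsOpen (Cone c) :=
  isOpen_lt (by fun_prop) Complex.continuous_re

lemma cone_add_mem {c τ : ℝ} {ζ v : ℂ} (hζ : ζ ∈ Cone c) (hτ : 0 ≤ τ) (hv : ‖v‖ = 1)
    (hcv : |c| ≤ v.re) : ζ + τ * v ∈ Cone c := by
  simp only [Cone, mem_ofPred_eq] at hζ ⊢
  have h1 : |‖ζ + τ * v‖ - ‖ζ‖| ≤ τ := by
    refine (abs_norm_sub_norm_le _ _).trans ?_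
    simp [hv, abs_of_nonneg hτ]
  have h2 : c * (‖ζ + τ * v‖ - ‖ζ‖) ≤ |c| * τ := by
    refine (le_abs_self _).trans ?_
    rw [abs_mul]
    gcongr
  have h3 : |c| * τ ≤ τ * v.re := by nlinarith
  have h4 : (ζ + τ * v).re = ζ.re + τ * v.re := by simp
  rw [h4]
  linarith

section LinearEquation

variable {E : Type*} [NormedAddCommGroup E] [NormedSpace ℂ E] [CompleteSpace E]

lemma norm_le_of_scalar_equation {c Λ W : ℝ} {b v : ℂ} (hv : ‖v‖ = 1) (hcv : |c| ≤ v.re)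
    (hbv : (b * v).re < 0) {w f : ℂ → E} (hf : ContinuousOn f (Cone c))
    (hfΛ : ∀ ζ ∈ Cone c, ‖f ζ‖ ≤ Λ) (hW : ∀ ζ ∈ Cone c, ‖w ζ‖ ≤ W)
    (hw : ∀ ζ ∈ Cone c, HasDerivAt w (-(b • w ζ) - f ζ) ζ) :
    ∀ ζ ∈ Cone c, ‖w ζ‖ ≤ (-(b * v).re)⁻¹ * Λ := by
  intro ζ hζ
  set e : ℝ → ℂ := fun τ => Complex.exp (b * v * τ) with he
  have hmem : ∀ τ : ℝ, 0 ≤ τ → ζ + τ * v ∈ Cone c := fun τ hτ => cone_add_mem hζ hτ hv hcv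
  have hline : ∀ τ : ℝ, HasDerivAt (fun τ : ℝ => ζ + τ * v) v τ := by
    intro τ
    simpa using ((Complex.ofRealCLM.hasDerivAt (x := τ)).mul_const v).const_add ζ
  have hed : ∀ τ : ℝ, HasDerivAt e (b * v * e τ) τ := by
    intro τ
    have := ((Complex.ofRealCLM.hasDerivAt (x := τ)).const_mul (b * v)).cexp
    simpa [he, mul_comm] using this
  have hnorm : ∀ τ : ℝ, ‖e τ‖ = Real.exp ((b * v).re * τ) := by
    intro τ
    simp only [he, Complex.norm_exp]
    congr 1
    simp
  have hderiv : ∀ τ ∈ Ici (0 : ℝ), HasDerivAt (fun τ : ℝ => e τ • w (ζ + τ * v))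
      (-(e τ • v • f (ζ + τ * v))) τ := by
    intro τ hτ
    have h1 := (hw _ (hmem τ hτ)).scomp τ (hline τ)
    have h2 := (hed τ).smul h1
    convert! h2 using 1
    simp only [Function.comp_apply, smul_sub, smul_neg, smul_smul]
    rw [show b * v * e τ = e τ * (v * b) by ring]
    abel
  have hInt : MeasureTheory.IntegrableOn (fun τ : ℝ => Real.exp ((b * v).re * τ) * Λ) (Ioi 0) :=
    (integrableOn_exp_mul_Ioi hbv 0).mul_const Λ
  have hbound : ∀ τ ∈ Ioi (0 : ℝ), ‖-(e τ • v • f (ζ + τ * v))‖ ≤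
      Real.exp ((b * v).re * τ) * Λ := by
    intro τ hτ
    rw [norm_neg, norm_smul, norm_smul, hv, hnorm, one_mul]
    gcongr
    exact hfΛ _ (hmem τ (le_of_lt hτ))
  have hcontf : ContinuousOn (fun τ : ℝ => -(e τ • v • f (ζ + τ * v))) (Ioi 0) := by
    have h1 : ContinuousOn (fun τ : ℝ => f (ζ + τ * v)) (Ioi 0) :=
      hf.comp (by fun_prop) fun τ hτ => hmem τ (le_of_lt hτ)
    have h2 : Continuous e := by fun_prop
    exact (h2.continuousOn.smul (h1.const_smul v)).neg
  have hfint : MeasureTheory.IntegrableOn (fun τ : ℝ => -(e τ • v • f (ζ + τ * v))) (Ioi 0) := by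
    refine MeasureTheory.Integrable.mono' hInt
      (hcontf.aestronglyMeasurable measurableSet_Ioi) ?_
    exact (MeasureTheory.ae_restrict_mem measurableSet_Ioi).mono hbound
  have hlim : Tendsto (fun τ : ℝ => e τ • w (ζ + τ * v)) atTop (nhds 0) := by
    have h0 : Tendsto (fun τ : ℝ => Real.exp ((b * v).re * τ) * W) atTop (nhds 0) := by
      have h5 : Tendsto (fun τ : ℝ => (b * v).re * τ) atTop atBot :=
        tendsto_id.const_mul_atTop_of_neg hbv
      simpa using (Real.tendsto_exp_atBot.comp h5).mul_const W
    refine squeeze_zero_norm' ?_ h0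
    filter_upwards [eventually_ge_atTop (0 : ℝ)] with τ hτ
    rw [norm_smul, hnorm]
    gcongr
    exact hW _ (hmem τ hτ)
  have key := MeasureTheory.integral_Ioi_of_hasDerivAt_of_tendsto' hderiv hfint hlim
  have h6 : ‖w ζ‖ = ‖∫ τ in Ioi (0 : ℝ), -(e τ • v • f (ζ + τ * v))‖ := by
    rw [key]; simp [he]
  rw [h6]
  refine (MeasureTheory.norm_integral_le_of_norm_le hInt
    ((MeasureTheory.ae_restrict_mem measurableSet_Ioi).mono hbound)).trans ?_
  rw [MeasureTheory.integral_mul_const, integral_exp_mul_Ioi hbv]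
  rw [mul_zero, Real.exp_zero, inv_neg, neg_div, one_div]

lemma exists_scalar_equation {c Λ : ℝ} {b v : ℂ} (hv : ‖v‖ = 1) (hcv : |c| ≤ v.re)
    (hbv : (b * v).re < 0) {f : ℂ → E} (hf : DifferentiableOn ℂ f (Cone c))
    (hfΛ : ∀ ζ ∈ Cone c, ‖f ζ‖ ≤ Λ) :
    ∃ w : ℂ → E, (∀ ζ ∈ Cone c, ‖w ζ‖ ≤ (-(b * v).re)⁻¹ * Λ) ∧
      ∀ ζ ∈ Cone c, HasDerivAt w (-(b • w ζ) - f ζ) ζ := by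
  set e : ℝ → ℂ := fun τ => Complex.exp (b * v * τ) with he
  have hline : ∀ (ζ : ℂ) (τ : ℝ), HasDerivAt (fun τ : ℝ => ζ + τ * v) v τ := by
    intro ζ τ
    simpa using ((Complex.ofRealCLM.hasDerivAt (x := τ)).mul_const v).const_add ζ
  have hed : ∀ τ : ℝ, HasDerivAt e (b * v * e τ) τ := by
    intro τ
    have := ((Complex.ofRealCLM.hasDerivAt (x := τ)).const_mul (b * v)).cexp
    simpa [he, mul_comm] using this
  have hecont : Continuous e := by fun_prop
  have hnorm : ∀ τ : ℝ, ‖e τ‖ = Real.exp ((b * v).re * τ) := by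
    intro τ
    simp only [he, Complex.norm_exp]
    congr 1
    simp
  have hmem : ∀ ζ ∈ Cone c, ∀ τ : ℝ, 0 ≤ τ → ζ + τ * v ∈ Cone c :=
    fun ζ hζ τ hτ => cone_add_mem hζ hτ hv hcv
  have hInt : ∀ L : ℝ, MeasureTheory.IntegrableOn
      (fun τ : ℝ => Real.exp ((b * v).re * τ) * L) (Ioi 0) := fun L =>
    (integrableOn_exp_mul_Ioi hbv 0).mul_const L
  have hbound : ∀ ζ ∈ Cone c, ∀ τ ∈ Ioi (0 : ℝ), ‖e τ • v • f (ζ + τ * v)‖ ≤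
      Real.exp ((b * v).re * τ) * Λ := by
    intro ζ hζ τ hτ
    rw [norm_smul, norm_smul, hv, hnorm, one_mul]
    gcongr
    exact hfΛ _ (hmem ζ hζ τ (le_of_lt hτ))
  have hmeas : ∀ g : ℂ → E, ContinuousOn g (Cone c) → ∀ ζ ∈ Cone c,
      MeasureTheory.AEStronglyMeasurable (fun τ : ℝ => e τ • v • g (ζ + τ * v))
        (MeasureTheory.volume.restrict (Ioi 0)) := by
    intro g hg ζ hζ
    have h1 : ContinuousOn (fun τ : ℝ => g (ζ + τ * v)) (Ioi 0) :=
      hg.comp (by fun_prop) fun τ hτ => hmem ζ hζ τ (le_of_lt hτ)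
    exact (hecont.continuousOn.smul (h1.const_smul v)).aestronglyMeasurable measurableSet_Ioi
  have hfint : ∀ ζ ∈ Cone c, MeasureTheory.IntegrableOn
      (fun τ : ℝ => e τ • v • f (ζ + τ * v)) (Ioi 0) := fun ζ hζ =>
    MeasureTheory.Integrable.mono' (hInt Λ) (hmeas f hf.continuousOn ζ hζ)
      ((MeasureTheory.ae_restrict_mem measurableSet_Ioi).mono (hbound ζ hζ))
  have hf' : DifferentiableOn ℂ (deriv f) (Cone c) := hf.deriv (isOpen_cone c)
  have hfd : ∀ ζ ∈ Cone c, HasDerivAt f (deriv f ζ) ζ := fun ζ hζ =>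
    (hf.differentiableAt ((isOpen_cone c).mem_nhds hζ)).hasDerivAt
  refine ⟨fun ζ => ∫ τ in Ioi (0 : ℝ), e τ • v • f (ζ + τ * v), ?_, ?_⟩
  · intro ζ hζ
    refine (MeasureTheory.norm_integral_le_of_norm_le (hInt Λ)
      ((MeasureTheory.ae_restrict_mem measurableSet_Ioi).mono (hbound ζ hζ))).trans ?_
    rw [MeasureTheory.integral_mul_const, integral_exp_mul_Ioi hbv]
    rw [mul_zero, Real.exp_zero, inv_neg, neg_div, one_div]
  · intro ζ hζ
    obtain ⟨δ, hδ, hball⟩ := Metric.isOpen_iff.1 (isOpen_cone c) ζ hζ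
    have hderivbound : ∀ x ∈ ball ζ (δ / 2), ∀ τ : ℝ, 0 ≤ τ →
        ‖deriv f (x + τ * v)‖ ≤ Λ / (δ / 4) := by
      intro x hx τ hτ
      have hsub : closedBall (x + τ * v) (δ / 4) ⊆ Cone c := by
        intro y hy
        have h1 : y - τ * v ∈ ball ζ δ := by
          rw [mem_closedBall, dist_eq_norm] at hy
          rw [mem_ball, dist_eq_norm] at hx ⊢
          calc ‖y - τ * v - ζ‖ = ‖(y - (x + τ * v)) + (x - ζ)‖ := by congr 1; ring
            _ ≤ _ := norm_add_le _ _
            _ < δ := by linarith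
        simpa using hmem _ (hball h1) τ hτ
      refine Complex.norm_deriv_le_of_forall_mem_sphere_norm_le (by positivity) ?_ ?_
      · exact (hf.mono hsub).diffContOnCl_ball subset_rfl
      · exact fun y hy => hfΛ y (hsub (sphere_subset_closedBall hy))
    have hbound' : ∀ᵐ τ ∂(MeasureTheory.volume.restrict (Ioi (0 : ℝ))), ∀ x ∈ ball ζ (δ / 2),
        ‖e τ • v • deriv f (x + τ * v)‖ ≤ Real.exp ((b * v).re * τ) * (Λ / (δ / 4)) := by
      refine (MeasureTheory.ae_restrict_mem measurableSet_Ioi).mono fun τ hτ x hx => ?_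
      rw [norm_smul, norm_smul, hv, hnorm, one_mul]
      gcongr
      exact hderivbound x hx τ (le_of_lt hτ)
    have hhalf : ball ζ (δ / 2) ⊆ Cone c := (ball_subset_ball (by linarith)).trans hball
    have hdiff : ∀ᵐ τ ∂(MeasureTheory.volume.restrict (Ioi (0 : ℝ))), ∀ x ∈ ball ζ (δ / 2),
        HasDerivAt (fun x => e τ • v • f (x + τ * v)) (e τ • v • deriv f (x + τ * v)) x := by
      refine (MeasureTheory.ae_restrict_mem measurableSet_Ioi).mono fun τ hτ x hx => ?_
      have := (hfd _ (hmem x (hhalf hx) τ (le_of_lt hτ))).comp_add_const x (τ * v)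
      exact (this.const_smul v).const_smul (e τ)
    have hmain := hasDerivAt_integral_of_dominated_loc_of_deriv_le
      (μ := MeasureTheory.volume.restrict (Ioi (0 : ℝ)))
      (F := fun x τ => e τ • v • f (x + τ * v))
      (F' := fun x τ => e τ • v • deriv f (x + τ * v))
      (ball_mem_nhds ζ (by positivity : 0 < δ / 2))
      (by
        filter_upwards [(isOpen_cone c).mem_nhds hζ] with x hx
        exact hmeas f hf.continuousOn x hx)
      (hfint ζ hζ) (hmeas _ hf'.continuousOn ζ hζ) hbound' (hInt _) hdiff
    convert hmain.2 using 1
    have hderiv : ∀ τ ∈ Ici (0 : ℝ), HasDerivAt (fun τ : ℝ => e τ • f (ζ + τ * v))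
        (b • (e τ • v • f (ζ + τ * v)) + e τ • v • deriv f (ζ + τ * v)) τ := by
      intro τ hτ
      have h1 := (hfd _ (hmem ζ hζ τ hτ)).scomp τ (hline ζ τ)
      have h2 := (hed τ).smul h1
      convert! h2 using 1
      simp only [Function.comp_apply, smul_smul]
      rw [show b * v * e τ = b * (e τ * v) by ring]
      abel
    have hlim : Tendsto (fun τ : ℝ => e τ • f (ζ + τ * v)) atTop (nhds 0) := by
      have h0 : Tendsto (fun τ : ℝ => Real.exp ((b * v).re * τ) * Λ) atTop (nhds 0) := by
        have h5 : Tendsto (fun τ : ℝ => (b * v).re * τ) atTop atBot :=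
          tendsto_id.const_mul_atTop_of_neg hbv
        simpa using (Real.tendsto_exp_atBot.comp h5).mul_const Λ
      refine squeeze_zero_norm' ?_ h0
      filter_upwards [eventually_ge_atTop (0 : ℝ)] with τ hτ
      rw [norm_smul, hnorm]
      gcongr
      exact hfΛ _ (hmem ζ hζ τ hτ)
    have hfi : MeasureTheory.Integrable (fun τ : ℝ => b • (e τ • v • f (ζ + τ * v)))
        (MeasureTheory.volume.restrict (Ioi (0 : ℝ))) := (hfint ζ hζ).smul b
    have key := MeasureTheory.integral_Ioi_of_hasDerivAt_of_tendsto' hderiv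
      (hfi.add hmain.1) hlim
    rw [MeasureTheory.integral_add hfi hmain.1, MeasureTheory.integral_smul] at key
    have h7 : e 0 • f (ζ + (0 : ℝ) * v) = f ζ := by simp [he]
    rw [h7] at key
    rw [eq_sub_iff_add_eq'] at key
    rw [← sub_eq_zero, ← neg_eq_zero, ← key]
    abel

end LinearEquation

/-- There is a direction `v`, along which the cone of opening `c` is stable, such that
`exp (b * v * τ)` decays as `τ → +∞`. -/
def HasDecayDirection (c : ℝ) (b : ℂ) : Prop :=
  ∃ v : ℂ, ‖v‖ = 1 ∧ |c| < v.re ∧ (b * v).re < 0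

section LinearSystem

variable {E : Type*} [NormedAddCommGroup E] [NormedSpace ℂ E]

/-- The product of the operators `A - b` for `b` in a list. -/
def shiftProd (A : E →L[ℂ] E) (l : List ℂ) : E →L[ℂ] E :=
  (l.map fun b => A - b • (1 : E →L[ℂ] E)).prod

lemma shiftProd_cons (A : E →L[ℂ] E) (b : ℂ) (l : List ℂ) (x : E) :
    shiftProd A (b :: l) x = A (shiftProd A l x) - b • shiftProd A l x := by
  simp [shiftProd]

variable [CompleteSpace E]

lemma exists_linear_equation_of_shiftProd {c : ℝ} (A : E →L[ℂ] E) (l : List ℂ)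
    (hl : ∀ b ∈ l, HasDecayDirection c b) :
    ∃ K : ℝ, 0 ≤ K ∧ ∀ (f : ℂ → E) (Λ : ℝ), 0 ≤ Λ → DifferentiableOn ℂ f (Cone c) →
      (∀ ζ ∈ Cone c, ‖f ζ‖ ≤ Λ) → ∃ w h : ℂ → E, (∀ ζ ∈ Cone c, ‖w ζ‖ ≤ K * Λ) ∧
        (∀ ζ ∈ Cone c, ‖h ζ‖ ≤ K * Λ) ∧ DifferentiableOn ℂ h (Cone c) ∧
        ∀ ζ ∈ Cone c, HasDerivAt w (-(A (w ζ)) - f ζ + shiftProd A l (h ζ)) ζ := by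
  induction l with
  | nil =>
    refine ⟨1, zero_le_one, fun f Λ hΛ hf hfΛ => ⟨0, f, ?_, ?_, hf, ?_⟩⟩
    · intro ζ _; simpa using hΛ
    · intro ζ hζ; simpa using hfΛ ζ hζ
    · intro ζ _
      simp [shiftProd]
  | cons b l ih =>
    obtain ⟨K, hK, H⟩ := ih fun b' hb' => hl b' (List.mem_cons_of_mem _ hb')
    obtain ⟨v, hv, hcv, hbv⟩ := hl b List.mem_cons_self
    set κ : ℝ := (-(b * v).re)⁻¹ with hκ
    have hκ0 : 0 ≤ κ := inv_nonneg.2 (by linarith)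
    refine ⟨K + ‖shiftProd A l‖ * (κ * K) + κ * K, by positivity, fun f Λ hΛ hf hfΛ => ?_⟩
    obtain ⟨w, h, hw, hh, hhd, hwd⟩ := H f Λ hΛ hf hfΛ
    obtain ⟨g, hg, hgd⟩ := exists_scalar_equation hv hcv.le hbv hhd hh
    refine ⟨fun ζ => w ζ + shiftProd A l (g ζ), g, ?_, ?_, ?_, ?_⟩
    · intro ζ hζ
      calc ‖w ζ + shiftProd A l (g ζ)‖ ≤ ‖w ζ‖ + ‖shiftProd A l (g ζ)‖ := norm_add_le _ _
        _ ≤ K * Λ + ‖shiftProd A l‖ * (κ * (K * Λ)) := by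
          gcongr
          · exact hw ζ hζ
          · exact ContinuousLinearMap.le_opNorm_of_le _ (hg ζ hζ)
        _ ≤ _ := by
          have : 0 ≤ κ * K * Λ := by positivity
          linarith
    · intro ζ hζ
      refine (hg ζ hζ).trans ?_
      have h1 : 0 ≤ K * Λ := by positivity
      have h2 : 0 ≤ ‖shiftProd A l‖ * (κ * K) * Λ := by positivity
      linarith
    · exact fun ζ hζ => (hgd ζ hζ).differentiableAt.differentiableWithinAt
    · intro ζ hζ
      have h1 := (shiftProd A l).hasFDerivAt.comp_hasDerivAt ζ (hgd ζ hζ)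
      have h2 := (hwd ζ hζ).add h1
      convert! h2 using 1
      rw [shiftProd_cons]
      simp only [map_add, map_sub, map_neg, map_smul]
      abel

lemma norm_le_of_norm_shiftProd_le {c : ℝ} (A : E →L[ℂ] E) (l : List ℂ)
    (hl : ∀ b ∈ l, HasDecayDirection c b) :
    ∃ K : ℝ, 0 ≤ K ∧ ∀ (w f : ℂ → E) (Λ W : ℝ), 0 ≤ Λ → ContinuousOn f (Cone c) →
      (∀ ζ ∈ Cone c, ‖f ζ‖ ≤ Λ) → (∀ ζ ∈ Cone c, ‖w ζ‖ ≤ W) →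
      (∀ ζ ∈ Cone c, ‖shiftProd A l (w ζ)‖ ≤ Λ) →
      (∀ ζ ∈ Cone c, HasDerivAt w (-(A (w ζ)) - f ζ) ζ) →
      ∀ ζ ∈ Cone c, ‖w ζ‖ ≤ K * Λ := by
  induction l with
  | nil =>
    refine ⟨1, zero_le_one, fun w f Λ W _ _ _ _ h _ ζ hζ => ?_⟩
    simpa [shiftProd] using h ζ hζ
  | cons b l ih =>
    obtain ⟨K, hK, H⟩ := ih fun b' hb' => hl b' (List.mem_cons_of_mem _ hb')
    obtain ⟨v, hv, hcv, hbv⟩ := hl b List.mem_cons_self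
    set κ : ℝ := (-(b * v).re)⁻¹ with hκ
    have hκ0 : 0 ≤ κ := inv_nonneg.2 (by linarith)
    refine ⟨K * (1 + κ * (‖shiftProd A l‖ + 1)), by positivity,
      fun w f Λ W hΛ hf hfΛ hW hwΛ hw ζ hζ => ?_⟩
    have hcomm : ∀ x, shiftProd A l (A x) = A (shiftProd A l x) := by
      intro x
      have : Commute A (shiftProd A l) := by
        refine Commute.list_prod_right _ _ fun y hy => ?_
        obtain ⟨b', -, rfl⟩ := List.mem_map.1 hy
        exact (Commute.refl A).sub_right ((Commute.one_right A).smul_right b')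
      exact (DFunLike.congr_fun this.eq x).symm
    have hwc : ContinuousOn w (Cone c) := fun ζ hζ =>
      (hw ζ hζ).continuousAt.continuousWithinAt
    have hbound : ∀ ζ ∈ Cone c, ‖shiftProd A l (w ζ)‖ ≤ κ * ((‖shiftProd A l‖ + 1) * Λ) := by
      refine norm_le_of_scalar_equation (W := ‖shiftProd A l‖ * W) hv hcv.le hbv
        (f := fun ζ => shiftProd A l (f ζ) + shiftProd A (b :: l) (w ζ)) ?_ ?_ ?_ ?_
      · exact ((shiftProd A l).continuous.comp_continuousOn hf).add
          ((shiftProd A (b :: l)).continuous.comp_continuousOn hwc)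
      · intro ζ hζ
        refine (norm_add_le _ _).trans ?_
        rw [add_mul, one_mul]
        exact add_le_add (ContinuousLinearMap.le_opNorm_of_le _ (hfΛ ζ hζ)) (hwΛ ζ hζ)
      · exact fun ζ hζ => ContinuousLinearMap.le_opNorm_of_le _ (hW ζ hζ)
      · intro ζ hζ
        convert! (shiftProd A l).hasFDerivAt.comp_hasDerivAt ζ (hw ζ hζ) using 1
        rw [shiftProd_cons, map_sub, map_neg, hcomm]
        abel
    rw [mul_assoc]
    have hp : 0 ≤ κ * (‖shiftProd A l‖ + 1) * Λ := by positivity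
    refine H w f ((1 + κ * (‖shiftProd A l‖ + 1)) * Λ) W (by positivity) hf ?_ hW ?_ hw ζ hζ
    · intro ζ hζ
      exact (hfΛ ζ hζ).trans (by linarith)
    · intro ζ hζ
      exact (hbound ζ hζ).trans (by linarith)

/-- The linear equation `w' = -A w - f` on the cone is uniquely solvable in bounded functions,
with a bound. -/
structure IsBoundedlySolvable (c : ℝ) (A : E →L[ℂ] E) (K : ℝ) : Prop where
  nonneg : 0 ≤ K
  exists_solution : ∀ (f : ℂ → E) (Λ : ℝ), 0 ≤ Λ → DifferentiableOn ℂ f (Cone c) →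
    (∀ ζ ∈ Cone c, ‖f ζ‖ ≤ Λ) → ∃ w : ℂ → E, (∀ ζ ∈ Cone c, ‖w ζ‖ ≤ K * Λ) ∧
      ∀ ζ ∈ Cone c, HasDerivAt w (-(A (w ζ)) - f ζ) ζ
  norm_le : ∀ (w f : ℂ → E) (Λ W : ℝ), 0 ≤ Λ → ContinuousOn f (Cone c) →
    (∀ ζ ∈ Cone c, ‖f ζ‖ ≤ Λ) → (∀ ζ ∈ Cone c, ‖w ζ‖ ≤ W) →
    (∀ ζ ∈ Cone c, HasDerivAt w (-(A (w ζ)) - f ζ) ζ) →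
    ∀ ζ ∈ Cone c, ‖w ζ‖ ≤ K * Λ

lemma exists_isBoundedlySolvable {c : ℝ} (A : E →L[ℂ] E) (l : List ℂ)
    (hl : ∀ b ∈ l, HasDecayDirection c b) (hA : shiftProd A l = 0) :
    ∃ K : ℝ, IsBoundedlySolvable c A K := by
  obtain ⟨K₁, hK₁, H₁⟩ := exists_linear_equation_of_shiftProd A l hl
  obtain ⟨K₂, hK₂, H₂⟩ := norm_le_of_norm_shiftProd_le A l hl
  refine ⟨K₁ + K₂, by positivity, ?_, ?_⟩
  · intro f Λ hΛ hf hfΛ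
    obtain ⟨w, h, hw, -, -, hwd⟩ := H₁ f Λ hΛ hf hfΛ
    refine ⟨w, fun ζ hζ => (hw ζ hζ).trans ?_, fun ζ hζ => ?_⟩
    · gcongr; linarith
    · simpa [hA] using hwd ζ hζ
  · intro w f Λ W hΛ hf hfΛ hW hw ζ hζ
    refine (H₂ w f Λ W hΛ hf hfΛ hW (fun ζ hζ => ?_) hw ζ hζ).trans ?_
    · simpa [hA] using hΛ
    · gcongr; linarith

/-- A semilinear equation with small nonlinearity has a small bounded solution on the cone. -/
lemma IsBoundedlySolvable.exists_semilinear {c K ε : ℝ} {A : E →L[ℂ] E}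
    (hA : IsBoundedlySolvable c A K) (hε : 0 ≤ ε) (hKε : K * ε ≤ 1 / 4) {N : E → ℂ → E}
    (hNd : ∀ z : ℂ → E, DifferentiableOn ℂ z (Cone c) → (∀ ζ ∈ Cone c, ‖z ζ‖ ≤ 1) →
      DifferentiableOn ℂ (fun ζ => N (z ζ) ζ) (Cone c))
    (hN0 : ∀ ζ ∈ Cone c, ‖N 0 ζ‖ ≤ ε)
    (hN : ∀ ζ ∈ Cone c, ∀ x y : E, ‖x‖ ≤ 1 → ‖y‖ ≤ 1 → ‖N x ζ - N y ζ‖ ≤ ε * ‖x - y‖) :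
    ∃ z : ℂ → E, (∀ ζ ∈ Cone c, ‖z ζ‖ ≤ 1) ∧
      ∀ ζ ∈ Cone c, HasDerivAt z (-(A (z ζ)) - N (z ζ) ζ) ζ := by
  have hK := hA.nonneg
  have hN2 : ∀ ζ ∈ Cone c, ∀ x : E, ‖x‖ ≤ 1 → ‖N x ζ‖ ≤ 2 * ε := by
    intro ζ hζ x hx
    have h1 := hN ζ hζ x 0 hx (by simp)
    have h2 := norm_le_norm_add_norm_sub' (N x ζ) (N 0 ζ)
    rw [sub_zero] at h1
    have := hN0 ζ hζ
    nlinarith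
  have hstep : ∀ z : {z : ℂ → E // DifferentiableOn ℂ z (Cone c) ∧ ∀ ζ ∈ Cone c, ‖z ζ‖ ≤ 1},
      ∃ w : {z : ℂ → E // DifferentiableOn ℂ z (Cone c) ∧ ∀ ζ ∈ Cone c, ‖z ζ‖ ≤ 1},
        ∀ ζ ∈ Cone c, HasDerivAt w.1 (-(A (w.1 ζ)) - N (z.1 ζ) ζ) ζ := by
    rintro ⟨z, hzd, hz⟩
    obtain ⟨w, hw, hwd⟩ := hA.exists_solution (fun ζ => N (z ζ) ζ) (2 * ε) (by positivity)
      (hNd z hzd hz) fun ζ hζ => hN2 ζ hζ _ (hz ζ hζ)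
    exact ⟨⟨w, fun ζ hζ => (hwd ζ hζ).differentiableAt.differentiableWithinAt,
      fun ζ hζ => (hw ζ hζ).trans (by linarith)⟩, hwd⟩
  choose T hT using hstep
  have hcontr : ∀ z z' δ, 0 ≤ δ → (∀ ζ ∈ Cone c, ‖z.1 ζ - z'.1 ζ‖ ≤ δ) →
      ∀ ζ ∈ Cone c, ‖(T z).1 ζ - (T z').1 ζ‖ ≤ δ / 2 := by
    intro z z' δ hδ h ζ hζ
    have h1 := hA.norm_le (fun ζ => (T z).1 ζ - (T z').1 ζ)
      (fun ζ => N (z.1 ζ) ζ - N (z'.1 ζ) ζ) (ε * δ) 2 (by positivity)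
      ((hNd _ z.2.1 z.2.2).sub (hNd _ z'.2.1 z'.2.2)).continuousOn
      (fun ζ hζ => (hN ζ hζ _ _ (z.2.2 ζ hζ) (z'.2.2 ζ hζ)).trans
        (mul_le_mul_of_nonneg_left (h ζ hζ) hε))
      (fun ζ hζ => (norm_sub_le _ _).trans
        (by linarith [(T z).2.2 ζ hζ, (T z').2.2 ζ hζ]))
      (fun ζ hζ => by
        convert! (hT z ζ hζ).sub (hT z' ζ hζ) using 1
        simp only [map_sub]
        abel) ζ hζ
    refine h1.trans ?_
    nlinarith
  let z₀ : {z : ℂ → E // DifferentiableOn ℂ z (Cone c) ∧ ∀ ζ ∈ Cone c, ‖z ζ‖ ≤ 1} :=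
    ⟨fun _ => 0, differentiableOn_const 0, fun ζ _ => by simp⟩
  let u := fun n : ℕ => T^[n] z₀
  have hu : ∀ n, u (n + 1) = T (u n) := fun n => Function.iterate_succ_apply' T n z₀
  have hdist : ∀ n, ∀ ζ ∈ Cone c, ‖(u (n + 1)).1 ζ - (u n).1 ζ‖ ≤ 2 / 2 ^ n := by
    intro n
    induction n with
    | zero =>
      intro ζ hζ
      refine (norm_sub_le _ _).trans ?_
      have := (u 0).2.2 ζ hζ
      have := (u 1).2.2 ζ hζ
      simp only [zero_add, pow_zero, div_one]
      linarith
    | succ n ih =>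
      intro ζ hζ
      have := hcontr (u (n + 1)) (u n) _ (by positivity) ih ζ hζ
      rw [hu (n + 1), hu n]
      rw [hu n] at this
      refine this.trans (le_of_eq ?_)
      rw [pow_succ]
      field_simp
  have hdist' : ∀ n, ∀ ζ ∈ Cone c, dist ((u n).1 ζ) ((u (n + 1)).1 ζ) ≤ 4 / 2 / 2 ^ n := by
    intro n ζ hζ
    rw [dist_comm, dist_eq_norm]
    refine (hdist n ζ hζ).trans (le_of_eq (by norm_num))
  have hlim : ∀ ζ, ∃ z : E, ζ ∈ Cone c → Tendsto (fun n => (u n).1 ζ) atTop (nhds z) := by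
    intro ζ
    by_cases hζ : ζ ∈ Cone c
    · obtain ⟨z, hz⟩ := cauchySeq_tendsto_of_complete
        (cauchySeq_of_le_geometric_two (C := 4) fun n => hdist' n ζ hζ)
      exact ⟨z, fun _ => hz⟩
    · exact ⟨0, fun h => absurd h hζ⟩
  choose z hz using hlim
  have hzn : ∀ n, ∀ ζ ∈ Cone c, ‖z ζ - (u n).1 ζ‖ ≤ 4 / 2 ^ n := by
    intro n ζ hζ
    rw [← dist_eq_norm, dist_comm]
    exact dist_le_of_le_geometric_two_of_tendsto (fun n => hdist' n ζ hζ) (hz ζ hζ) n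
  have h4 : Tendsto (fun n : ℕ => (4 : ℝ) / 2 ^ n) atTop (nhds 0) := by
    have := tendsto_pow_atTop_nhds_zero_of_lt_one (r := (1 / 2 : ℝ)) (by norm_num) (by norm_num)
    simpa [div_eq_mul_inv] using this.const_mul 4
  have hunif : TendstoUniformlyOn (fun n => (u n).1) z atTop (Cone c) := by
    rw [Metric.tendstoUniformlyOn_iff]
    intro δ hδ
    filter_upwards [h4.eventually (gt_mem_nhds hδ)] with n hn ζ hζ
    rw [dist_eq_norm]
    exact (hzn n ζ hζ).trans_lt hn
  have hzd : DifferentiableOn ℂ z (Cone c) :=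
    hunif.tendstoLocallyUniformlyOn.differentiableOn
      (Eventually.of_forall fun n => (u n).2.1) (isOpen_cone c)
  have hz1 : ∀ ζ ∈ Cone c, ‖z ζ‖ ≤ 1 := fun ζ hζ =>
    le_of_tendsto (hz ζ hζ).norm (Eventually.of_forall fun n => (u n).2.2 ζ hζ)
  let Z : {z : ℂ → E // DifferentiableOn ℂ z (Cone c) ∧ ∀ ζ ∈ Cone c, ‖z ζ‖ ≤ 1} := ⟨z, hzd, hz1⟩
  have hfix : ∀ ζ ∈ Cone c, (T Z).1 ζ = z ζ := by
    intro ζ hζ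
    have h1 : Tendsto (fun n => (u (n + 1)).1 ζ) atTop (nhds ((T Z).1 ζ)) := by
      rw [tendsto_iff_norm_sub_tendsto_zero]
      refine squeeze_zero (fun _ => norm_nonneg _) (fun n => ?_) (by simpa using h4.div_const 2)
      rw [norm_sub_rev, hu]
      exact hcontr Z (u n) _ (by positivity) (hzn n) ζ hζ
    exact tendsto_nhds_unique h1 ((hz ζ hζ).comp (tendsto_add_atTop_nat 1))
  refine ⟨z, hz1, fun ζ hζ => ?_⟩
  have h1 := hT Z ζ hζ
  rw [hfix ζ hζ] at h1
  refine h1.congr_of_eventuallyEq ?_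
  filter_upwards [(isOpen_cone c).mem_nhds hζ] with x hx
  exact (hfix x hx).symm

end LinearSystem

lemma HasDecayDirection.eventually {c : ℝ} {b : ℂ} (h : HasDecayDirection c b) :
    ∀ᶠ c' in nhds c, HasDecayDirection c' b := by
  obtain ⟨v, hv, hcv, hbv⟩ := h
  filter_upwards [(continuous_abs.tendsto c).eventually (gt_mem_nhds hcv)] with c' hc'
  exact ⟨v, hv, hc', hbv⟩

section Matrix

variable {m : ℕ}

/-- Matrices as continuous linear operators. -/
def matrixCLM : Matrix (Fin m) (Fin m) ℂ →ₐ[ℂ] ((Fin m → ℂ) →L[ℂ] (Fin m → ℂ)) :=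
  ((Matrix.toLinAlgEquiv' (R := ℂ) (n := Fin m)).trans
    (Module.End.toContinuousLinearMap (Fin m → ℂ))).toAlgHom

lemma shiftProd_matrixCLM (B : Matrix (Fin m) (Fin m) ℂ) :
    shiftProd (matrixCLM B) B.charpoly.roots.toList = 0 := by
  have h1 : (B.charpoly.roots.toList.map fun b => Polynomial.X - Polynomial.C b).prod
      = B.charpoly := by
    rw [← Multiset.prod_coe, ← Multiset.map_coe, Multiset.coe_toList]
    exact ((IsAlgClosed.splits B.charpoly).eq_prod_roots_of_monic B.charpoly_monic).symm
  have h2 : shiftProd (matrixCLM B) B.charpoly.roots.toList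
      = matrixCLM (Polynomial.aeval B B.charpoly) := by
    conv_rhs => rw [← h1]
    rw [map_list_prod, map_list_prod, List.map_map, List.map_map, shiftProd]
    congr 2
    funext b
    simp [Algebra.algebraMap_eq_smul_one]
  rw [h2, Matrix.aeval_self_charpoly, map_zero]

lemma exists_isBoundedlySolvable_matrix {c : ℝ} (B : Matrix (Fin m) (Fin m) ℂ)
    (hB : ∀ b ∈ spectrum ℂ B, HasDecayDirection c b) :
    ∃ K : ℝ, IsBoundedlySolvable c (matrixCLM B) K := by
  refine exists_isBoundedlySolvable _ B.charpoly.roots.toList (fun b hb => hB b ?_)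
    (shiftProd_matrixCLM B)
  rw [Multiset.mem_toList, Polynomial.mem_roots B.charpoly_monic.ne_zero] at hb
  exact Matrix.mem_spectrum_iff_isRoot_charpoly.2 hb

lemma eventually_forall_spectrum_hasDecayDirection {c : ℝ} (B : Matrix (Fin m) (Fin m) ℂ)
    (hB : ∀ b ∈ spectrum ℂ B, HasDecayDirection c b) :
    ∀ᶠ c' in nhds c, ∀ b ∈ spectrum ℂ B, HasDecayDirection c' b :=
  (Filter.eventually_all_finite (Matrix.finite_spectrum B)).2 fun b hb => (hB b hb).eventually

end Matrix

section Chart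

/-- The coordinate `t` on a sector bisected by the direction `ω`, as a function of
`ζ = (ω / t) ^ k - R`. -/
def chart (k : ℕ) (ω : ℂ) (R : ℝ) (ζ : ℂ) : ℂ := ω * Complex.exp (-Complex.log (R + ζ) / k)

lemma add_mem_cone {c R : ℝ} {ζ : ℂ} (hc : |c| ≤ 1) (hR : 0 ≤ R) (hζ : ζ ∈ Cone c) :
    (R : ℂ) + ζ ∈ Cone c := by
  have := cone_add_mem (v := 1) hζ hR (by simp) (by simpa using hc)
  rwa [mul_one, add_comm] at this

lemma cone_subset_slitPlane {c : ℝ} (hc : -1 < c) : Cone c ⊆ Complex.slitPlane := by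
  intro u hu
  rw [Complex.mem_slitPlane_iff]
  by_contra! h
  obtain ⟨h1, h2⟩ := h
  have h3 : ‖u‖ = -u.re := by
    rw [← abs_of_nonpos h1, ← Complex.abs_re_eq_norm.2 h2]
  simp only [Cone, mem_ofPred_eq, h3] at hu
  nlinarith

lemma le_norm_add_of_mem_cone {c R : ℝ} {ζ : ℂ} (hR : 0 ≤ R) (hζ : ζ ∈ Cone c) :
    R * (1 - |c|) ≤ (1 + |c|) * ‖(R : ℂ) + ζ‖ := by
  have h1 : R + ζ.re ≤ ‖(R : ℂ) + ζ‖ := by simpa using Complex.re_le_norm ((R : ℂ) + ζ)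
  have h2 : ‖ζ‖ ≤ ‖(R : ℂ) + ζ‖ + R := by
    have := norm_sub_le ((R : ℂ) + ζ) R
    simpa [abs_of_nonneg hR] using this
  have h3 : -(|c| * ‖ζ‖) ≤ c * ‖ζ‖ := by nlinarith [neg_abs_le c, norm_nonneg ζ]
  have h4 : c * ‖ζ‖ < ζ.re := hζ
  nlinarith [abs_nonneg c]

lemma sub_mem_cone {c c₁ R : ℝ} {u : ℂ} (hc₁ : |c₁| ≤ 1) (hR : 0 ≤ R)
    (hu : u ∈ Cone c) (h : 2 * R ≤ ‖u‖ * (c - c₁)) : u - R ∈ Cone c₁ := by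
  simp only [Cone, mem_ofPred_eq] at hu ⊢
  have h1 : |‖u - R‖ - ‖u‖| ≤ R := by
    refine (abs_norm_sub_norm_le _ _).trans ?_
    simp [abs_of_nonneg hR]
  have h2 : c₁ * (‖u - R‖ - ‖u‖) ≤ 1 * R := by
    refine (le_abs_self _).trans ?_
    rw [abs_mul]
    gcongr
  simp only [Complex.sub_re, Complex.ofReal_re]
  linarith

variable {k : ℕ} {ω : ℂ} {R c : ℝ} {ζ : ℂ}

lemma chart_ne_zero (hω : ‖ω‖ = 1) : chart k ω R ζ ≠ 0 := by
  have : ω ≠ 0 := by rintro rfl; simp at hω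
  exact mul_ne_zero this (Complex.exp_ne_zero _)

lemma chart_pow (hk : k ≠ 0) (h : (R : ℂ) + ζ ≠ 0) : chart k ω R ζ ^ k = ω ^ k / (R + ζ) := by
  have hk' : (k : ℂ) ≠ 0 := Nat.cast_ne_zero.2 hk
  rw [chart, mul_pow, ← Complex.exp_nat_mul, mul_div_cancel₀ _ hk', Complex.exp_neg,
    Complex.exp_log h, div_eq_mul_inv]

lemma hasDerivAt_chart (hk : k ≠ 0) (hω : ‖ω‖ = 1) (h : (R : ℂ) + ζ ∈ Complex.slitPlane) :
    HasDerivAt (chart k ω R) (-(k * ω ^ k)⁻¹ * chart k ω R ζ ^ (k + 1)) ζ := by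
  have hω0 : ω ≠ 0 := by rintro rfl; simp at hω
  have h0 := Complex.slitPlane_ne_zero h
  have hk' : (k : ℂ) ≠ 0 := Nat.cast_ne_zero.2 hk
  have h1 : HasDerivAt (fun ζ : ℂ => (R : ℂ) + ζ) 1 ζ := (hasDerivAt_id ζ).const_add _
  have h2 := (((h1.clog h).neg.div_const (k : ℂ)).cexp).const_mul ω
  convert! h2 using 1
  rw [pow_succ, chart_pow hk h0, chart]
  simp only [Pi.neg_apply]
  field_simp

lemma exists_norm_chart_lt (hk : k ≠ 0) (hω : ‖ω‖ = 1) (hc : |c| < 1) {ε : ℝ} (hε : 0 < ε) :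
    ∃ R : ℝ, 0 < R ∧ ∀ ζ ∈ Cone c, ‖chart k ω R ζ‖ < ε := by
  have hc' : 0 < 1 - |c| := by linarith
  refine ⟨2 * (1 + |c|) / (ε ^ k * (1 - |c|)), by positivity, fun ζ hζ => ?_⟩
  set R := 2 * (1 + |c|) / (ε ^ k * (1 - |c|)) with hR
  have hRpos : 0 < R := by positivity
  have h1 := le_norm_add_of_mem_cone hRpos.le hζ
  have h2 : 2 * (1 + |c|) = R * (1 - |c|) * ε ^ k := by
    rw [hR]; field_simp
  have hε' : 0 < ε ^ k := by positivity
  have h3 : 2 ≤ ‖(R : ℂ) + ζ‖ * ε ^ k := by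
    have : 2 * (1 + |c|) ≤ (1 + |c|) * (‖(R : ℂ) + ζ‖ * ε ^ k) := by
      rw [h2, ← mul_assoc]
      gcongr
    nlinarith [abs_nonneg c]
  have h0 : (R : ℂ) + ζ ≠ 0 := by
    intro h
    rw [h] at h3
    norm_num at h3
  have h4 : ‖chart k ω R ζ‖ ^ k < ε ^ k := by
    rw [← norm_pow, chart_pow hk h0, norm_div, norm_pow, hω, one_pow,
      div_lt_iff₀ (norm_pos_iff.2 h0)]
    linarith
  exact lt_of_pow_lt_pow_left₀ k hε.le h4

end Chart

section Sector

variable {k : ℕ} {a b : ℝ}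

/-- The direction bisecting the sector. -/
def bisector (a b : ℝ) : ℂ := Complex.exp (((a + b) / 2 : ℝ) * Complex.I)

lemma norm_bisector (a b : ℝ) : ‖bisector a b‖ = 1 := Complex.norm_exp_ofReal_mul_I _

/-- The opening parameter of the image of the sector under `t ↦ (ω / t) ^ k`. -/
def opening (k : ℕ) (a b : ℝ) : ℝ := Real.cos (k * (b - a) / 2)

lemma ne_zero_of_mem_sector {t : ℂ} (ht : t ∈ Sector a b) : t ≠ 0 := by
  obtain ⟨ρ, φ, hρ, -, -, rfl⟩ := ht
  exact mul_ne_zero (by exact_mod_cast hρ.ne') (Complex.exp_ne_zero _)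

lemma smul_mem_sector {t : ℂ} (ht : t ∈ Sector a b) {s : ℝ} (hs : 0 < s) :
    (s : ℂ) * t ∈ Sector a b := by
  obtain ⟨ρ, φ, hρ, h1, h2, rfl⟩ := ht
  exact ⟨s * ρ, φ, by positivity, h1, h2, by push_cast; ring⟩

lemma abs_opening_lt_one (hk : 1 ≤ k) (hab : a < b) (hkab : k * (b - a) < 2 * Real.pi) :
    |opening k a b| < 1 := by
  have hk' : (1 : ℝ) ≤ k := by exact_mod_cast hk
  have hpos : 0 < k * (b - a) / 2 := by
    have : 0 < b - a := by linarith
    positivity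
  rw [abs_lt]
  constructor
  · rw [← Real.cos_pi]
    exact Real.cos_lt_cos_of_nonneg_of_le_pi hpos.le le_rfl (by linarith)
  · rw [← Real.cos_zero]
    exact Real.cos_lt_cos_of_nonneg_of_le_pi le_rfl (by linarith) hpos

lemma exists_exp_of_mem_sector (hk : 1 ≤ k) {t : ℂ}
    (ht : t ∈ Sector a b) : ∃ w : ℂ, (bisector a b / t) ^ k = Complex.exp w ∧
      |w.im| < k * (b - a) / 2 ∧ bisector a b * Complex.exp (-w / k) = t := by
  obtain ⟨ρ, φ, hρ, h1, h2, rfl⟩ := ht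
  have hk' : (0 : ℝ) < k := by exact_mod_cast hk
  have hk0 : (k : ℂ) ≠ 0 := by exact_mod_cast hk'.ne'
  have hρ' : (ρ : ℂ) = Complex.exp (Real.log ρ : ℝ) := by
    rw [← Complex.ofReal_exp, Real.exp_log hρ]
  refine ⟨k * (((a + b) / 2 : ℝ) * I - ((Real.log ρ : ℝ) + φ * I)), ?_, ?_, ?_⟩
  · rw [hρ', bisector, ← Complex.exp_add, ← Complex.exp_sub, ← Complex.exp_nat_mul]
  · have : (k * (((a + b) / 2 : ℝ) * I - ((Real.log ρ : ℝ) + φ * I)) : ℂ).im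
        = k * ((a + b) / 2 - φ) := by simp
    rw [this, abs_mul, abs_of_pos hk', mul_div_assoc]
    gcongr
    rw [abs_lt]
    constructor <;> linarith
  · rw [neg_div, mul_div_cancel_left₀ _ hk0, bisector, ← Complex.exp_add, hρ', ← Complex.exp_add]
    congr 1
    ring

lemma div_pow_mem_cone (hk : 1 ≤ k) (hkab : k * (b - a) < 2 * Real.pi) {t : ℂ}
    (ht : t ∈ Sector a b) : (bisector a b / t) ^ k ∈ Cone (opening k a b) := by
  obtain ⟨w, hw, him, -⟩ := exists_exp_of_mem_sector hk ht
  rw [hw, Cone, mem_ofPred_eq, Complex.norm_exp, Complex.exp_re, mul_comm, ← Real.cos_abs w.im]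
  gcongr
  exact Real.cos_lt_cos_of_nonneg_of_le_pi (abs_nonneg _) (by linarith) him

lemma chart_div_pow (hk : 1 ≤ k) (hkab : k * (b - a) < 2 * Real.pi) {t : ℂ}
    (ht : t ∈ Sector a b) (R : ℝ) :
    chart k (bisector a b) R ((bisector a b / t) ^ k - R) = t := by
  obtain ⟨w, hw, him, h⟩ := exists_exp_of_mem_sector hk ht
  rw [abs_lt] at him
  rw [chart, add_sub_cancel, hw, Complex.log_exp (by linarith) (by linarith), h]

lemma chart_mem_sector (hk : 1 ≤ k) (hab : a < b) (hkab : k * (b - a) < 2 * Real.pi) {R : ℝ}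
    (hR : 0 ≤ R) {ζ : ℂ} (hζ : ζ ∈ Cone (opening k a b)) :
    chart k (bisector a b) R ζ ∈ Sector a b := by
  have hk' : (0 : ℝ) < k := by exact_mod_cast hk
  have hk0 : (k : ℂ) ≠ 0 := by exact_mod_cast hk'.ne'
  have hc := abs_opening_lt_one hk hab hkab
  have hu := add_mem_cone hc.le hR hζ
  set u := (R : ℂ) + ζ with hu'
  have hu0 : u ≠ 0 := Complex.slitPlane_ne_zero (cone_subset_slitPlane (abs_lt.1 hc).1 hu)
  have hcos : opening k a b < Real.cos |u.arg| := by
    rw [Real.cos_abs, Complex.cos_arg hu0, lt_div_iff₀ (norm_pos_iff.2 hu0)]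
    exact hu
  have harg : |u.arg| < k * (b - a) / 2 := by
    by_contra! h
    have h0 : 0 ≤ k * (b - a) / 2 := by
      have : 0 < b - a := by linarith
      positivity
    exact absurd (Real.cos_le_cos_of_nonneg_of_le_pi h0 (Complex.abs_arg_le_pi u) h)
      (not_le.2 hcos)
  rw [abs_lt] at harg
  have h1 : u.arg / k < (b - a) / 2 := by rw [div_lt_iff₀ hk']; linarith
  have h2 : -((b - a) / 2) < u.arg / k := by rw [lt_div_iff₀ hk']; linarith
  refine ⟨Real.exp (-Real.log ‖u‖ / k), (a + b) / 2 - u.arg / k, Real.exp_pos _, by linarith,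
    by linarith, ?_⟩
  rw [chart, ← hu', bisector, Complex.ofReal_exp, ← Complex.exp_add, ← Complex.exp_add]
  congr 1
  rw [Complex.log]
  push_cast
  field_simp
  ring

lemma isOpen_sector (hk : 1 ≤ k) (hab : a < b) (hkab : k * (b - a) < 2 * Real.pi) :
    IsOpen (Sector a b) := by
  have hω : bisector a b ≠ 0 := Complex.exp_ne_zero _
  rw [isOpen_iff_mem_nhds]
  intro t ht
  have ht0 := ne_zero_of_mem_sector ht
  have h1 : ContinuousAt (fun s : ℂ => (bisector a b / s) ^ 1) t :=
    (continuousAt_const.div continuousAt_id ht0).pow 1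
  have hab' : ((1 : ℕ) : ℝ) * (b - a) < 2 * Real.pi := by
    have : (1 : ℝ) ≤ k := by exact_mod_cast hk
    push_cast
    nlinarith
  have h2 := h1.eventually ((isOpen_cone (opening 1 a b)).mem_nhds
    (div_pow_mem_cone le_rfl hab' ht))
  filter_upwards [h2, isOpen_ne.mem_nhds ht0] with s hs hs0
  have h3 := chart_mem_sector le_rfl hab hab' le_rfl hs
  rw [chart] at h3
  simp only [pow_one, Complex.ofReal_zero, zero_add, Nat.cast_one, div_one, Complex.exp_neg] at h3
  rwa [Complex.exp_log (div_ne_zero hω hs0), inv_div, mul_div_cancel₀ _ hω] at h3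

lemma isPreconnected_sectorR (a b r : ℝ) : IsPreconnected (SectorR a b r) := by
  have : SectorR a b r = (fun p : ℝ × ℝ => (p.1 : ℂ) * Complex.exp (p.2 * Complex.I)) ''
      (Ioo 0 r ×ˢ Ioo a b) := by
    ext z
    simp only [SectorR, Sector, mem_inter_iff, mem_ofPred_eq, mem_image, mem_prod, Set.mem_Ioo,
      Prod.exists, mem_ball, dist_zero_right]
    constructor
    · rintro ⟨⟨ρ, φ, hρ, h1, h2, rfl⟩, h⟩
      refine ⟨ρ, φ, ⟨⟨hρ, ?_⟩, h1, h2⟩, rfl⟩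
      simpa [Complex.norm_exp_ofReal_mul_I, abs_of_pos hρ] using h
    · rintro ⟨ρ, φ, ⟨⟨hρ, hr⟩, h1, h2⟩, rfl⟩
      refine ⟨⟨ρ, φ, hρ, h1, h2, rfl⟩, ?_⟩
      simpa [Complex.norm_exp_ofReal_mul_I, abs_of_pos hρ] using hr
  rw [this]
  exact (isPreconnected_Ioo.prod isPreconnected_Ioo).image _ (by fun_prop)

lemma re_mul_exp_add_pi (hk : 1 ≤ k) (β : ℂ) (φ s : ℝ) (hs : s = 1 ∨ s = -1) :
    (β * Complex.exp (-(k : ℂ) * ((φ + s * Real.pi / k : ℝ) : ℂ) * I)).re =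
      -(β * Complex.exp (-(k : ℂ) * (φ : ℂ) * I)).re := by
  have hk0 : (k : ℂ) ≠ 0 := by
    have : (0 : ℝ) < k := by exact_mod_cast hk
    exact_mod_cast this.ne'
  have h1 : -(k : ℂ) * ((φ + s * Real.pi / k : ℝ) : ℂ) * I
      = -(k : ℂ) * (φ : ℂ) * I - s * (Real.pi * I) := by
    push_cast
    field_simp
    ring
  have h2 : Complex.exp (s * (Real.pi * I)) = -1 := by
    rcases hs with rfl | rfl
    · simp
    · rw [Complex.ofReal_neg, Complex.ofReal_one, neg_one_mul, Complex.exp_neg, Complex.exp_pi_mul_I]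
      norm_num
  rw [h1, Complex.exp_sub, h2, div_neg, div_one, mul_neg, Complex.neg_re]

/-- On a good sector each eigenvalue has a decay direction in the cone coordinate. -/
lemma hasDecayDirection_of_unique_ray (hk : 1 ≤ k) {β : ℂ} (hβ : β ≠ 0)
    (h : ∃! φ : ℝ, φ ∈ Set.Icc a b ∧ (β * Complex.exp (-(k : ℂ) * (φ : ℂ) * I)).re = 0)
    (h' : ∀ φ ∈ Set.Icc a b, (β * Complex.exp (-(k : ℂ) * (φ : ℂ) * I)).re = 0 →
      a < φ ∧ φ < b) :
    k * (b - a) < 2 * Real.pi ∧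
      HasDecayDirection (opening k a b) ((k * bisector a b ^ k)⁻¹ * β) := by
  have hk' : (0 : ℝ) < k := by exact_mod_cast hk
  have hk0 : (k : ℂ) ≠ 0 := by exact_mod_cast hk'.ne'
  obtain ⟨φ, ⟨hφ, hre⟩, huniq⟩ := h
  obtain ⟨haφ, hφb⟩ := h' φ hφ hre
  have hpik : 0 < Real.pi / k := div_pos Real.pi_pos hk'
  have hup : b < φ + Real.pi / k := by
    by_contra! hle
    have := huniq (φ + 1 * Real.pi / k) ⟨⟨by rw [one_mul]; linarith, by rwa [one_mul]⟩, by
      rw [re_mul_exp_add_pi hk β φ 1 (Or.inl rfl), hre, neg_zero]⟩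
    rw [one_mul] at this
    linarith
  have hlow : φ - Real.pi / k < a := by
    by_contra! hle
    have e1 : φ + (-1) * Real.pi / k = φ - Real.pi / k := by ring
    have := huniq (φ + (-1) * Real.pi / k) ⟨⟨by rwa [e1], by rw [e1]; linarith⟩, by
      rw [re_mul_exp_add_pi hk β φ (-1) (Or.inr rfl), hre, neg_zero]⟩
    linarith
  have hup' : k * (b - φ) < Real.pi := by
    rw [← sub_lt_iff_lt_add', lt_div_iff₀ hk'] at hup
    linarith
  have hlow' : k * (φ - a) < Real.pi := by
    rw [sub_lt_comm, lt_div_iff₀ hk'] at hlow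
    linarith
  have hkab : k * (b - a) < 2 * Real.pi := by linarith
  refine ⟨hkab, ?_⟩
  set θ : ℝ := k * ((a + b) / 2 - φ) with hθ
  have hθ1 : |θ| < k * (b - a) / 2 := by
    have h1 : 0 < k * (φ - a) := mul_pos hk' (by linarith)
    have h2 : 0 < k * (b - φ) := mul_pos hk' (by linarith)
    rw [abs_lt]
    constructor <;> linarith
  have hθ2 : |θ| < Real.pi - k * (b - a) / 2 := by
    rw [abs_lt]
    constructor <;> linarith
  have hcos : |opening k a b| < Real.cos θ := by
    rw [← Real.cos_abs θ, abs_lt]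
    constructor
    · rw [opening, neg_lt, ← Real.cos_pi_sub]
      exact Real.cos_lt_cos_of_nonneg_of_le_pi (by linarith [abs_nonneg θ])
        (by linarith [abs_nonneg θ]) (by linarith)
    · exact Real.cos_lt_cos_of_nonneg_of_le_pi (abs_nonneg _) (by linarith) hθ1
  set y : ℝ := (β * Complex.exp (-(k : ℂ) * (φ : ℂ) * I)).im with hy
  have hβy : β * Complex.exp (-(k : ℂ) * (φ : ℂ) * I) = y * I := by
    apply Complex.ext
    · rw [hre]; simp
    · rw [← hy]; simp
  have hy0 : y ≠ 0 := by
    intro h0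
    rw [h0, Complex.ofReal_zero, zero_mul] at hβy
    exact mul_ne_zero hβ (Complex.exp_ne_zero _) hβy
  obtain ⟨δ, hδ, hyδ⟩ : ∃ δ : ℝ, |opening k a b| < Real.cos (θ + δ) ∧ 0 < y * Real.sin δ := by
    have hev : ∀ᶠ δ in nhds (0 : ℝ), |opening k a b| < Real.cos (θ + δ) := by
      have : ContinuousAt (fun δ : ℝ => Real.cos (θ + δ)) 0 := by fun_prop
      exact this.eventually (lt_mem_nhds (by simpa using hcos))
    rcases lt_or_gt_of_ne hy0 with hneg | hpos
    · have hev2 : ∀ᶠ δ in nhdsWithin (0 : ℝ) (Set.Iio 0), -Real.pi < δ ∧ δ < 0 := by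
        filter_upwards [Ioo_mem_nhdsLT (show -Real.pi < 0 by linarith [Real.pi_pos])] with δ hδ
        exact hδ
      obtain ⟨δ, h1, h2, h3⟩ := ((hev.filter_mono nhdsWithin_le_nhds).and hev2).exists
      exact ⟨δ, h1, mul_pos_of_neg_of_neg hneg (Real.sin_neg_of_neg_of_neg_pi_lt h3 h2)⟩
    · have hev2 : ∀ᶠ δ in nhdsWithin (0 : ℝ) (Set.Ioi 0), 0 < δ ∧ δ < Real.pi := by
        filter_upwards [Ioo_mem_nhdsGT Real.pi_pos] with δ hδ
        exact hδ
      obtain ⟨δ, h1, h2, h3⟩ := ((hev.filter_mono nhdsWithin_le_nhds).and hev2).exists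
      exact ⟨δ, h1, mul_pos hpos (Real.sin_pos_of_pos_of_lt_pi h2 h3)⟩
  refine ⟨Complex.exp ((θ + δ : ℝ) * I), Complex.norm_exp_ofReal_mul_I _, ?_, ?_⟩
  · rwa [Complex.exp_ofReal_mul_I_re]
  · have h1 : (k * bisector a b ^ k)⁻¹ * β * Complex.exp ((θ + δ : ℝ) * I) =
        ((k : ℝ)⁻¹ * y : ℝ) * (I * Complex.exp (δ * I)) := by
      have h2 : (k * bisector a b ^ k)⁻¹ * β * Complex.exp ((θ + δ : ℝ) * I) =
          (k : ℂ)⁻¹ * (β * Complex.exp (-(k : ℂ) * (φ : ℂ) * I)) * Complex.exp (δ * I) := by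
        rw [mul_inv, bisector, ← Complex.exp_nat_mul, ← Complex.exp_neg]
        have h3 : Complex.exp (-((k : ℂ) * (((a + b) / 2 : ℝ) * I))) * Complex.exp ((θ + δ : ℝ) * I)
            = Complex.exp (-(k : ℂ) * (φ : ℂ) * I) * Complex.exp (δ * I) := by
          rw [← Complex.exp_add, ← Complex.exp_add, hθ]
          congr 1
          push_cast
          ring
        linear_combination (k : ℂ)⁻¹ * β * h3
      rw [h2, hβy]
      push_cast
      ring
    rw [h1, Complex.re_ofReal_mul, Complex.I_mul_re, Complex.exp_ofReal_mul_I_im]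
    have : 0 < (k : ℝ)⁻¹ := inv_pos.2 hk'
    nlinarith

end Sector

section LocalEstimates

variable {E : Type*} [NormedAddCommGroup E] [NormedSpace ℂ E]

lemma norm_sub_le_of_bounded_on_ball {E' : Type*} [NormedAddCommGroup E'] [NormedSpace ℂ E']
    {f : E → E'} {ρ Λ : ℝ} (hρ : 0 < ρ) (hd : DifferentiableOn ℂ f (ball 0 (2 * ρ)))
    (hΛ : ∀ y ∈ ball (0 : E) (2 * ρ), ‖f y‖ ≤ Λ) {x y : E} (hx : x ∈ ball (0 : E) ρ)
    (hy : y ∈ ball (0 : E) ρ) : ‖f x - f y‖ ≤ 2 * Λ / ρ * ‖x - y‖ := by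
  have hx2 : x ∈ ball (0 : E) (2 * ρ) := ball_subset_ball (by linarith) hx
  have hy2 : y ∈ ball (0 : E) (2 * ρ) := ball_subset_ball (by linarith) hy
  have hdiff : ∀ z ∈ ball (0 : E) (2 * ρ), ‖f z - f y‖ ≤ 2 * Λ := fun z hz =>
    (norm_sub_le _ _).trans (by linarith [hΛ z hz, hΛ y hy2])
  rcases lt_or_ge ‖x - y‖ ρ with h | h
  · have hsub : ball y ρ ⊆ ball (0 : E) (2 * ρ) := by
      intro z hz
      rw [mem_ball_zero_iff] at hy ⊢
      rw [mem_ball_iff_norm] at hz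
      linarith [norm_le_norm_add_norm_sub' z y]
    have := Complex.dist_le_div_mul_dist_of_mapsTo_ball (R₂ := 2 * Λ) (hd.mono hsub)
      (fun z hz => by
        rw [mem_closedBall, dist_eq_norm]
        exact hdiff z (hsub hz)) (z := x) (by rwa [mem_ball_iff_norm])
    simpa [dist_eq_norm] using this
  · have h0 : 0 ≤ 2 * Λ := (norm_nonneg _).trans (hdiff x hx2)
    calc ‖f x - f y‖ ≤ 2 * Λ / ρ * ρ := by
          rw [div_mul_cancel₀ _ hρ.ne']; exact hdiff x hx2
      _ ≤ _ := by gcongr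

/-- A holomorphic field `(G, F)` with `G y t = B y + …` and `F y t = t ^ (k + 1) + …`, with the
estimates of the prepared form valid on a ball. -/
structure IsPrepared (k : ℕ) (B : E →L[ℂ] E) (G : E → ℂ → E) (F : E → ℂ → ℂ) (ρ C : ℝ) :
    Prop where
  one_le : 1 ≤ k
  pos : 0 < ρ
  nonneg : 0 ≤ C
  diff : DifferentiableOn ℂ (fun p : E × ℂ => (G p.1 p.2, F p.1 p.2)) (ball 0 ρ ×ˢ ball 0 ρ)
  norm_G_sub_le : ∀ y t, ‖y‖ < ρ → ‖t‖ < ρ →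
    ‖G y t - B y‖ ≤ C * (‖y‖ ^ 2 + ‖y‖ * ‖t‖ + ‖t‖ ^ (k + 1))
  norm_F_sub_le : ∀ y t, ‖y‖ < ρ → ‖t‖ < ρ → ‖F y t - t ^ (k + 1)‖ ≤ C * ‖y‖ ^ 2

variable {k : ℕ} {B : E →L[ℂ] E} {G : E → ℂ → E} {F : E → ℂ → ℂ} {ρ C : ℝ}

lemma IsPrepared.differentiableOn_comp_G (h : IsPrepared k B G F ρ C) {s : Set ℂ} {Y : ℂ → E}
    {τ : ℂ → ℂ} (hY : DifferentiableOn ℂ Y s) (hτ : DifferentiableOn ℂ τ s)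
    (hm : ∀ t ∈ s, ‖Y t‖ < ρ ∧ ‖τ t‖ < ρ) : DifferentiableOn ℂ (fun t => G (Y t) (τ t)) s :=
  (h.diff.comp (hY.prodMk hτ) fun t ht => by simpa using hm t ht).fst

lemma IsPrepared.differentiableOn_comp_F (h : IsPrepared k B G F ρ C) {s : Set ℂ} {Y : ℂ → E}
    {τ : ℂ → ℂ} (hY : DifferentiableOn ℂ Y s) (hτ : DifferentiableOn ℂ τ s)
    (hm : ∀ t ∈ s, ‖Y t‖ < ρ ∧ ‖τ t‖ < ρ) : DifferentiableOn ℂ (fun t => F (Y t) (τ t)) s :=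
  (h.diff.comp (hY.prodMk hτ) fun t ht => by simpa using hm t ht).snd

lemma IsPrepared.exists_lipschitz (h : IsPrepared k B G F ρ C) :
    ∃ r C₁ : ℝ, 0 < r ∧ r ≤ 1 ∧ 2 * r ≤ ρ ∧ 0 ≤ C₁ ∧ ∀ t : ℂ, t ≠ 0 → ‖t‖ < r → ∀ x y : E,
      ‖x‖ < ‖t‖ → ‖y‖ < ‖t‖ →
        ‖(G x t - B x) - (G y t - B y)‖ ≤ C₁ * ‖t‖ * ‖x - y‖ ∧
        ‖F x t - F y t‖ ≤ C₁ * ‖t‖ * ‖x - y‖ := by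
  have hC := h.nonneg
  have hρ := h.pos
  refine ⟨min 1 (ρ / 2), 14 * C, by positivity, min_le_left _ _, ?_, by positivity, ?_⟩
  · linarith [min_le_right 1 (ρ / 2)]
  intro t ht0 ht x y hx hy
  have ht1 : ‖t‖ < 1 := ht.trans_le (min_le_left _ _)
  have ht2 : 2 * ‖t‖ < ρ := by linarith [min_le_right 1 (ρ / 2)]
  have htpos : 0 < ‖t‖ := norm_pos_iff.2 ht0
  have htρ : ‖t‖ < ρ := by linarith
  have hpow : ‖t‖ ^ (k + 1) ≤ ‖t‖ ^ 2 :=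
    pow_le_pow_of_le_one htpos.le ht1.le (by linarith [h.one_le])
  have hmem : ∀ z ∈ ball (0 : E) (2 * ‖t‖), ‖z‖ < ρ := fun z hz => by
    rw [mem_ball_zero_iff] at hz; linarith
  have hd : DifferentiableOn ℂ (fun z : E => (G z t, F z t)) (ball 0 (2 * ‖t‖)) :=
    h.diff.comp (f := fun z : E => (z, t)) (by fun_prop) fun z hz => by
      simpa [htρ] using hmem z hz
  have hx' : x ∈ ball (0 : E) ‖t‖ := by simpa using hx
  have hy' : y ∈ ball (0 : E) ‖t‖ := by simpa using hy
  constructor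
  · have := norm_sub_le_of_bounded_on_ball (f := fun z => G z t - B z) (Λ := 7 * C * ‖t‖ ^ 2) htpos
      (hd.fst.sub B.differentiable.differentiableOn) (fun z hz => by
        refine (h.norm_G_sub_le z t (hmem z hz) htρ).trans ?_
        rw [mem_ball_zero_iff] at hz
        have h1 : ‖z‖ ^ 2 ≤ (2 * ‖t‖) ^ 2 := by gcongr
        have h2 : ‖z‖ * ‖t‖ ≤ 2 * ‖t‖ * ‖t‖ := by gcongr
        nlinarith) hx' hy'
    refine this.trans (le_of_eq ?_)
    field_simp
    ring
  · have := norm_sub_le_of_bounded_on_ball (f := fun z => F z t - t ^ (k + 1))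
      (Λ := 7 * C * ‖t‖ ^ 2) htpos
      (hd.snd.sub (differentiableOn_const _)) (fun z hz => by
        refine (h.norm_F_sub_le z t (hmem z hz) htρ).trans ?_
        rw [mem_ball_zero_iff] at hz
        have h1 : ‖z‖ ^ 2 ≤ (2 * ‖t‖) ^ 2 := by gcongr
        nlinarith [mul_nonneg hC (sq_nonneg ‖t‖)]) hx' hy'
    rw [sub_sub_sub_cancel_right] at this
    refine this.trans (le_of_eq ?_)
    field_simp
    ring

/-- The nonlinear part of the equation `t ^ (k + 1) y' = B y + …` equivalent to
`F y t • y' = G y t`. -/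
def nonlinearPart (k : ℕ) (B : E →L[ℂ] E) (G : E → ℂ → E) (F : E → ℂ → ℂ) (y : E) (t : ℂ) : E :=
  (t ^ (k + 1) / F y t) • G y t - B y

lemma IsPrepared.exists_nonlinearPart_lipschitz (h : IsPrepared k B G F ρ C) {L : ℝ}
    (hL : 0 < L) : ∃ r Λ : ℝ, 0 < r ∧ r ≤ 1 ∧ r ≤ ρ ∧ 0 ≤ Λ ∧ ∀ t : ℂ, t ≠ 0 → ‖t‖ < r →
      (∀ y : E, ‖y‖ ≤ L * ‖t‖ ^ (k + 1) → ‖y‖ < ρ ∧ F y t ≠ 0 ∧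
        ‖t ^ (k + 1) / F y t‖ ≤ 2 ∧ ‖G y t‖ ≤ Λ * ‖t‖ ^ (k + 1)) ∧
      ∀ x y : E, ‖x‖ ≤ L * ‖t‖ ^ (k + 1) → ‖y‖ ≤ L * ‖t‖ ^ (k + 1) →
        ‖nonlinearPart k B G F x t - nonlinearPart k B G F y t‖ ≤ Λ * ‖t‖ * ‖x - y‖ := by
  have hC := h.nonneg
  have hρ := h.pos
  obtain ⟨r₁, C₁, hr₁, hr₁1, hr₁ρ, hC₁, hlip⟩ := h.exists_lipschitz
  set Γ : ℝ := ‖B‖ * L + C * (L ^ 2 + L + 1) with hΓ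
  have hΓ0 : 0 ≤ Γ := by positivity
  refine ⟨min r₁ (min (1 / (2 * L)) (1 / (2 * (C * L ^ 2 + 1)))),
    2 * C * L ^ 2 * (‖B‖ + C₁) + C₁ + 4 * C₁ * Γ + Γ, by positivity,
    (min_le_left _ _).trans hr₁1, (min_le_left _ _).trans (by linarith), by positivity, ?_⟩
  intro t ht0 ht
  obtain ⟨ht1, ht23⟩ := lt_min_iff.1 ht
  obtain ⟨ht2, ht3⟩ := lt_min_iff.1 ht23
  have htpos : 0 < ‖t‖ := norm_pos_iff.2 ht0
  have ht1' : ‖t‖ < 1 := by linarith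
  have hLt : L * ‖t‖ < 1 := by
    rw [lt_div_iff₀ (by positivity)] at ht2; linarith
  have hCt : C * L ^ 2 * ‖t‖ ≤ 1 / 2 := by
    rw [lt_div_iff₀ (by positivity)] at ht3; linarith
  set T : ℝ := ‖t‖ ^ (k + 1) with hT
  have hTpos : 0 < T := by positivity
  have hTt2 : T ≤ ‖t‖ ^ 2 := pow_le_pow_of_le_one htpos.le ht1'.le (by linarith [h.one_le])
  have hTt : T ≤ ‖t‖ := by nlinarith
  have hnt : ‖t ^ (k + 1)‖ = T := norm_pow _ _
  have hs0 : t ^ (k + 1) ≠ 0 := pow_ne_zero _ ht0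
  have hsmall : ∀ y : E, ‖y‖ ≤ L * T → ‖y‖ < ‖t‖ := fun y hy => by
    have : L * T ≤ L * ‖t‖ ^ 2 := by gcongr
    nlinarith
  have hsq : ∀ y : E, ‖y‖ ≤ L * T → C * ‖y‖ ^ 2 ≤ C * L ^ 2 * ‖t‖ * T := fun y hy => by
    have h1 : ‖y‖ ^ 2 ≤ (L * T) ^ 2 := by gcongr
    have h2 : (L * T) ^ 2 ≤ L ^ 2 * ‖t‖ * T := by
      rw [mul_pow, sq T, ← mul_assoc]
      gcongr
    calc C * ‖y‖ ^ 2 ≤ C * (L ^ 2 * ‖t‖ * T) := by gcongr; exact h1.trans h2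
      _ = _ := by ring
  have hFlow : ∀ y : E, ‖y‖ ≤ L * T → T / 2 ≤ ‖F y t‖ := fun y hy => by
    have h1 := h.norm_F_sub_le y t ((hsmall y hy).trans (by linarith)) (by linarith)
    have h2 := hsq y hy
    have h3 := norm_sub_norm_le (t ^ (k + 1)) (F y t)
    rw [norm_sub_rev, hnt] at h3
    nlinarith
  have hF0 : ∀ y : E, ‖y‖ ≤ L * T → F y t ≠ 0 := fun y hy h0 => by
    have := hFlow y hy
    rw [h0, norm_zero] at this
    linarith
  have hquot : ∀ y : E, ‖y‖ ≤ L * T → ‖t ^ (k + 1) / F y t‖ ≤ 2 := fun y hy => by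
    rw [norm_div, hnt, div_le_iff₀ (norm_pos_iff.2 (hF0 y hy))]
    linarith [hFlow y hy]
  have hG : ∀ y : E, ‖y‖ ≤ L * T → ‖G y t‖ ≤ Γ * T := fun y hy => by
    have h1 := h.norm_G_sub_le y t ((hsmall y hy).trans (by linarith)) (by linarith)
    have h2 := hsq y hy
    have h3 := norm_le_norm_add_norm_sub' (G y t) (B y)
    have h4 : ‖B y‖ ≤ ‖B‖ * (L * T) := B.le_opNorm_of_le hy
    have h5 : C * (‖y‖ * ‖t‖) ≤ C * (L * T * 1) := by gcongr
    have h6 : C * L ^ 2 * ‖t‖ * T ≤ C * L ^ 2 * 1 * T := by gcongr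
    rw [hΓ]
    linarith
  refine ⟨fun y hy => ⟨(hsmall y hy).trans (by linarith), hF0 y hy, hquot y hy,
    (hG y hy).trans ?_⟩, fun x y hx hy => ?_⟩
  · gcongr
    have : 0 ≤ 2 * C * L ^ 2 * (‖B‖ + C₁) + C₁ + 4 * C₁ * Γ := by positivity
    linarith
  obtain ⟨hRlip, hFlip⟩ := hlip t ht0 ht1 x y (hsmall x hx) (hsmall y hy)
  set s := t ^ (k + 1) with hs
  have hid : nonlinearPart k B G F x t - nonlinearPart k B G F y t =
      (s / F x t - 1) • (G x t - G y t) + ((G x t - B x) - (G y t - B y))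
        + (s / F x t - s / F y t) • G y t := by
    simp only [nonlinearPart, sub_smul, smul_sub, one_smul]
    abel
  have h1 : ‖s / F x t - 1‖ ≤ 2 * C * L ^ 2 * ‖t‖ := by
    have e1 : s / F x t - 1 = -((F x t - s) / F x t) := by
      field_simp [hF0 x hx]; ring
    rw [e1, norm_neg, norm_div, div_le_iff₀ (norm_pos_iff.2 (hF0 x hx))]
    have h2 := h.norm_F_sub_le x t ((hsmall x hx).trans (by linarith)) (by linarith)
    have h3 := hsq x hx
    have h4 := hFlow x hx
    have h5 : 2 * C * L ^ 2 * ‖t‖ * (T / 2) ≤ 2 * C * L ^ 2 * ‖t‖ * ‖F x t‖ := by gcongr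
    linarith
  have h2 : ‖G x t - G y t‖ ≤ (‖B‖ + C₁) * ‖x - y‖ := by
    have e1 : G x t - G y t = B (x - y) + ((G x t - B x) - (G y t - B y)) := by
      rw [map_sub]; abel
    rw [e1, add_mul]
    refine (norm_add_le _ _).trans (add_le_add (B.le_opNorm _) (hRlip.trans ?_))
    gcongr
    nlinarith
  have h3 : ‖s / F x t - s / F y t‖ * T ≤ 4 * C₁ * ‖t‖ * ‖x - y‖ := by
    have e1 : s / F x t - s / F y t = (s / F x t) * (s / F y t) * (F y t - F x t) / s := by
      field_simp [hF0 x hx, hF0 y hy]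
    rw [e1, norm_div, hnt, div_mul_cancel₀ _ hTpos.ne', norm_mul, norm_mul, norm_sub_rev]
    calc ‖s / F x t‖ * ‖s / F y t‖ * ‖F x t - F y t‖ ≤ 2 * 2 * (C₁ * ‖t‖ * ‖x - y‖) := by
          gcongr
          · exact hquot x hx
          · exact hquot y hy
      _ = _ := by ring
  rw [hid]
  calc _ ≤ ‖s / F x t - 1‖ * ‖G x t - G y t‖ + ‖(G x t - B x) - (G y t - B y)‖
        + ‖s / F x t - s / F y t‖ * ‖G y t‖ := by
        refine (norm_add_le _ _).trans (add_le_add ((norm_add_le _ _).trans ?_) ?_)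
        · rw [norm_smul]
        · rw [norm_smul]
    _ ≤ 2 * C * L ^ 2 * ‖t‖ * ((‖B‖ + C₁) * ‖x - y‖) + C₁ * ‖t‖ * ‖x - y‖
        + ‖s / F x t - s / F y t‖ * (Γ * T) := by
        gcongr
        exact hG y hy
    _ ≤ 2 * C * L ^ 2 * ‖t‖ * ((‖B‖ + C₁) * ‖x - y‖) + C₁ * ‖t‖ * ‖x - y‖
        + Γ * (4 * C₁ * ‖t‖ * ‖x - y‖) := by
        have := mul_le_mul_of_nonneg_left h3 hΓ0
        linarith
    _ ≤ _ := by
        have : 0 ≤ Γ * ‖t‖ * ‖x - y‖ := by positivity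
        linarith

end LocalEstimates

section FormalSolution

variable {E : Type*} [NormedAddCommGroup E] [NormedSpace ℂ E]

lemma isBigO_pow_of_le {m n : ℕ} (h : m ≤ n) :
    (fun t : ℂ => t ^ n) =O[nhdsWithin 0 {0}ᶜ] fun t : ℂ => t ^ m :=
  (Asymptotics.IsBigO.of_bound 1 (by
    filter_upwards [ball_mem_nhds (0 : ℂ) one_pos] with t ht
    rw [one_mul, norm_pow, norm_pow]
    exact pow_le_pow_of_le_one (norm_nonneg _) (mem_ball_zero_iff.1 ht).le h)).mono
      nhdsWithin_le_nhds

lemma AnalyticAt.exists_eventuallyEq_pow_smul_of_isBigO (n : ℕ) {f : ℂ → E}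
    (hf : AnalyticAt ℂ f 0) (h : f =O[nhdsWithin 0 {0}ᶜ] fun t : ℂ => t ^ n) :
    ∃ g : ℂ → E, AnalyticAt ℂ g 0 ∧ f =ᶠ[nhdsWithin 0 {0}ᶜ] fun t => t ^ n • g t := by
  induction n with
  | zero => exact ⟨f, hf, by simp⟩
  | succ n ih =>
    obtain ⟨g, hg, hfg⟩ := ih (h.trans (isBigO_pow_of_le n.le_succ))
    have hg1 : g =O[nhdsWithin 0 {0}ᶜ] fun t : ℂ => t := by
      obtain ⟨c, hc⟩ := h.bound
      refine IsBigO.of_bound c ?_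
      filter_upwards [hc, hfg, self_mem_nhdsWithin] with t h1 h2 h3
      have h4 : 0 < ‖t‖ ^ n := pow_pos (norm_pos_iff.2 h3) n
      rw [h2, norm_smul, norm_pow, norm_pow, pow_succ] at h1
      refine le_of_mul_le_mul_left (h1.trans_eq ?_) h4
      ring
    have hg0 : g 0 = 0 := by
      refine tendsto_nhds_unique (f := g) (l := nhdsWithin 0 {0}ᶜ)
        (hg.continuousAt.tendsto.mono_left nhdsWithin_le_nhds) ?_
      exact hg1.trans_tendsto (tendsto_id.mono_left nhdsWithin_le_nhds)
    obtain ⟨p, hp⟩ := hg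
    refine ⟨dslope g 0, hp.has_fpower_series_dslope_fslope.analyticAt, ?_⟩
    filter_upwards [hfg] with t h1
    have := sub_smul_dslope g 0 t
    rw [hg0, sub_zero, sub_zero] at this
    rw [h1, ← this, pow_succ, mul_smul, this]

lemma AnalyticAt.exists_isBigO_sub_pow_smul {n : ℕ} {f : ℂ → E} (hf : AnalyticAt ℂ f 0)
    (h : f =O[nhdsWithin 0 {0}ᶜ] fun t : ℂ => t ^ n) :
    ∃ d : E, (fun t => f t - t ^ n • d) =O[nhdsWithin 0 {0}ᶜ] fun t : ℂ => t ^ (n + 1) := by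
  obtain ⟨g, hg, hfg⟩ := hf.exists_eventuallyEq_pow_smul_of_isBigO n h
  refine ⟨g 0, ?_⟩
  have h1 : (fun t => g t - g 0) =O[nhdsWithin 0 {0}ᶜ] fun t : ℂ => t := by
    simpa using hg.differentiableAt.isBigO_sub.mono nhdsWithin_le_nhds
  have h2 := (isBigO_refl (fun t : ℂ => t ^ n) (nhdsWithin 0 {0}ᶜ)).smul h1
  simp only [smul_eq_mul, ← pow_succ] at h2
  refine h2.congr' ?_ EventuallyEq.rfl
  filter_upwards [hfg] with t ht
  rw [ht, smul_sub]

variable {k M : ℕ} {B : E →L[ℂ] E} {G : E → ℂ → E} {F : E → ℂ → ℂ} {ρ C : ℝ} {P : ℂ → E}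

/-- An entire curve which solves `F y t • y' = G y t` up to an error of order `M + 1`. -/
structure IsApproxSolution (k : ℕ) (G : E → ℂ → E) (F : E → ℂ → ℂ) (M : ℕ) (P : ℂ → E) :
    Prop where
  diff : Differentiable ℂ P
  isBigO : P =O[nhdsWithin 0 {0}ᶜ] fun t : ℂ => t ^ (k + 1)
  isBigO_defect : (fun t => F (P t) t • deriv P t - G (P t) t) =O[nhdsWithin 0 {0}ᶜ]
    fun t : ℂ => t ^ (M + 1)

lemma IsApproxSolution.map_zero (hP : IsApproxSolution k G F M P) : P 0 = 0 := by
  refine tendsto_nhds_unique (f := P) (l := nhdsWithin 0 {0}ᶜ)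
    (hP.diff.continuous.continuousAt.tendsto.mono_left nhdsWithin_le_nhds) ?_
  refine hP.isBigO.trans_tendsto (Tendsto.mono_left ?_ nhdsWithin_le_nhds)
  have : Continuous fun t : ℂ => t ^ (k + 1) := by fun_prop
  simpa using this.tendsto 0

lemma eventually_norm_lt_of_isBigO {V : Type*} [NormedAddCommGroup V] {P : ℂ → V} (hk : 1 ≤ k)
    (hP : P =O[nhdsWithin 0 {0}ᶜ] fun t : ℂ => t ^ (k + 1)) :
    ∀ᶠ t : ℂ in nhdsWithin 0 {0}ᶜ, ‖P t‖ < ‖t‖ := by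
  have h1 : (fun t : ℂ => t ^ (k + 1)) =o[nhds 0] fun t : ℂ => t := by
    simpa using isLittleO_pow_pow (𝕜 := ℂ) (m := 1) (n := k + 1) (by omega)
  filter_upwards [(hP.trans_isLittleO (h1.mono nhdsWithin_le_nhds)).bound
    (show (0 : ℝ) < 1 / 2 by norm_num), self_mem_nhdsWithin] with t ht ht0
  have : 0 < ‖t‖ := norm_pos_iff.2 ht0
  linarith

lemma isApproxSolution_zero (h : IsPrepared k B G F ρ C) :
    IsApproxSolution k G F k (fun _ => 0) where
  diff := by fun_prop
  isBigO := isBigO_zero _ _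
  isBigO_defect := by
    refine IsBigO.of_bound C ?_
    filter_upwards [nhdsWithin_le_nhds (ball_mem_nhds (0 : ℂ) h.pos)] with t ht
    have := h.norm_G_sub_le 0 t (by simpa using h.pos) (mem_ball_zero_iff.1 ht)
    simpa using this

lemma IsApproxSolution.exists_next [CompleteSpace E] (h : IsPrepared k B G F ρ C)
    (hB : Function.Surjective B) (hP : IsApproxSolution k G F M P) (hkM : k ≤ M) :
    ∃ e : E, IsApproxSolution k G F (M + 1) (fun t => P t + t ^ (M + 1) • e) := by
  have hk := h.one_le
  have hP0 := hP.map_zero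
  have hP' : Differentiable ℂ (deriv P) := by
    rw [← differentiableOn_univ]
    exact hP.diff.differentiableOn.deriv isOpen_univ
  have han : AnalyticAt ℂ (fun t => F (P t) t • deriv P t - G (P t) t) 0 := by
    set U : Set ℂ := {t | ‖P t‖ < ρ ∧ ‖t‖ < ρ} with hU
    have hUo : IsOpen U := (isOpen_lt hP.diff.continuous.norm continuous_const).inter
      (isOpen_lt continuous_norm continuous_const)
    have hU0 : (0 : ℂ) ∈ U := by
      rw [hU, mem_ofPred_eq, hP0]
      simpa using h.pos
    refine DifferentiableOn.analyticAt (s := U) ?_ (hUo.mem_nhds hU0)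
    exact ((h.differentiableOn_comp_F hP.diff.differentiableOn differentiableOn_id
      fun t ht => ht).smul hP'.differentiableOn).sub
      (h.differentiableOn_comp_G hP.diff.differentiableOn differentiableOn_id fun t ht => ht)
  obtain ⟨d, hd⟩ := han.exists_isBigO_sub_pow_smul hP.isBigO_defect
  obtain ⟨e, rfl⟩ := hB d
  set Q : ℂ → E := fun t => P t + t ^ (M + 1) • e with hQ
  have hpe : (fun t : ℂ => t ^ (M + 1) • e) =O[nhdsWithin 0 {0}ᶜ] fun t : ℂ => t ^ (M + 1) := by
    refine IsBigO.of_bound ‖e‖ (Eventually.of_forall fun t => ?_)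
    rw [norm_smul, mul_comm]
  have hQO : Q =O[nhdsWithin 0 {0}ᶜ] fun t : ℂ => t ^ (k + 1) :=
    hP.isBigO.add (hpe.trans (isBigO_pow_of_le (by omega)))
  have hQd : ∀ t, HasDerivAt Q (deriv P t + ((M + 1 : ℕ) * t ^ M) • e) t := fun t => by
    exact (hP.diff t).hasDerivAt.add (by simpa using (hasDerivAt_pow (M + 1) t).smul_const e)
  refine ⟨e, fun t => (hQd t).differentiableAt, hQO, ?_⟩
  obtain ⟨r, C₁, hr, -, -, hC₁, hlip⟩ := h.exists_lipschitz
  have hlip' : ∀ᶠ t : ℂ in nhdsWithin 0 {0}ᶜ,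
      ‖(G (Q t) t - B (Q t)) - (G (P t) t - B (P t))‖ ≤ C₁ * ‖e‖ * ‖t ^ (M + 2)‖ ∧
      ‖F (Q t) t - F (P t) t‖ ≤ C₁ * ‖e‖ * ‖t ^ (M + 2)‖ := by
    filter_upwards [eventually_norm_lt_of_isBigO hk hP.isBigO, eventually_norm_lt_of_isBigO hk hQO,
      self_mem_nhdsWithin, nhdsWithin_le_nhds (ball_mem_nhds (0 : ℂ) hr)] with t h1 h2 h3 h4
    have h5 : C₁ * ‖t‖ * ‖Q t - P t‖ = C₁ * ‖e‖ * ‖t ^ (M + 2)‖ := by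
      rw [hQ, add_sub_cancel_left, norm_smul, norm_pow, norm_pow]
      ring
    rw [← h5]
    exact hlip t h3 (mem_ball_zero_iff.1 h4) _ _ h2 h1
  have hGO : (fun t => (G (Q t) t - B (Q t)) - (G (P t) t - B (P t))) =O[nhdsWithin 0 {0}ᶜ]
      fun t : ℂ => t ^ (M + 2) := IsBigO.of_bound _ (hlip'.mono fun t ht => ht.1)
  have hFO : (fun t => F (Q t) t - F (P t) t) =O[nhdsWithin 0 {0}ᶜ]
      fun t : ℂ => t ^ (M + 2) := IsBigO.of_bound _ (hlip'.mono fun t ht => ht.2)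
  have hdO : deriv P =O[nhdsWithin 0 {0}ᶜ] fun _ : ℂ => (1 : ℂ) :=
    (hP'.continuous.continuousAt.tendsto.mono_left nhdsWithin_le_nhds).isBigO_one ℂ
  have hFQ : (fun t => F (Q t) t) =O[nhdsWithin 0 {0}ᶜ] fun t : ℂ => t ^ 2 := by
    refine IsBigO.trans ?_ (isBigO_pow_of_le (show 2 ≤ k + 1 by omega))
    have h1 : (fun t => F (Q t) t - t ^ (k + 1)) =O[nhdsWithin 0 {0}ᶜ]
        fun t : ℂ => t ^ (k + 1) := by
      have h2 : (fun t => F (Q t) t - t ^ (k + 1)) =O[nhdsWithin 0 {0}ᶜ]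
          fun t : ℂ => ‖Q t‖ * ‖Q t‖ := by
        refine IsBigO.of_bound C ?_
        filter_upwards [eventually_norm_lt_of_isBigO hk hQO,
          nhdsWithin_le_nhds (ball_mem_nhds (0 : ℂ) h.pos)] with t h1 h2
        rw [mem_ball_zero_iff] at h2
        have := h.norm_F_sub_le (Q t) t (h1.trans h2) h2
        simpa [sq] using this
      refine h2.trans ((hQO.norm_left.mul hQO.norm_left).trans ?_)
      simp only [← pow_add]
      exact isBigO_pow_of_le (by omega)
    simpa using h1.add (isBigO_refl (fun t : ℂ => t ^ (k + 1)) _)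
  have hpM : (fun t : ℂ => ((M + 1 : ℕ) * t ^ M) • e) =O[nhdsWithin 0 {0}ᶜ]
      fun t : ℂ => t ^ M := by
    refine IsBigO.of_bound ((M + 1 : ℕ) * ‖e‖) (Eventually.of_forall fun t => ?_)
    rw [norm_smul, norm_mul, Complex.norm_natCast]
    exact le_of_eq (by ring)
  have h1 := hFO.smul hdO
  have h2 := hFQ.smul hpM
  simp only [smul_eq_mul, mul_one, ← pow_add, add_comm 2 M] at h1 h2
  refine (((hd.add h1).add h2).sub hGO).congr_left fun t => ?_
  have h3 : B (Q t) = B (P t) + t ^ (M + 1) • B e := by simp [hQ]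
  rw [(hQd t).deriv, h3, smul_add, sub_smul]
  abel

/-- The coefficients of the formal solution: each partial sum is an approximate solution. -/
lemma IsPrepared.exists_coeff [CompleteSpace E] (h : IsPrepared k B G F ρ C)
    (hB : Function.Surjective B) :
    ∃ c : ℕ → E, ∀ M, k ≤ M →
      IsApproxSolution k G F M fun t => ∑ m ∈ Finset.Icc 2 M, t ^ m • c m := by
  classical
  have hstep : ∀ (M : ℕ) (P : ℂ → E), ∃ e : E, k ≤ M → IsApproxSolution k G F M P →
      IsApproxSolution k G F (M + 1) (fun t => P t + t ^ (M + 1) • e) := by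
    intro M P
    by_cases hc : k ≤ M ∧ IsApproxSolution k G F M P
    · obtain ⟨e, he⟩ := hc.2.exists_next h hB hc.1
      exact ⟨e, fun _ _ => he⟩
    · exact ⟨0, fun h1 h2 => absurd ⟨h1, h2⟩ hc⟩
  choose next hnext using hstep
  let S : ℕ → ℂ → E := fun j =>
    Nat.rec (fun _ => 0) (fun j P t => P t + t ^ (k + j + 1) • next (k + j) P) j
  let c : ℕ → E := fun m => if m ≤ k then 0 else next (m - 1) (S (m - 1 - k))
  have hS : ∀ j, IsApproxSolution k G F (k + j) (S j) ∧
      S j = fun t => ∑ m ∈ Finset.Icc 2 (k + j), t ^ m • c m := by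
    intro j
    induction j with
    | zero =>
      refine ⟨isApproxSolution_zero h, ?_⟩
      funext t
      refine (Finset.sum_eq_zero fun m hm => ?_).symm
      have : m ≤ k := (Finset.mem_Icc.1 hm).2
      simp [c, this]
    | succ j ih =>
      refine ⟨hnext (k + j) (S j) (by omega) ih.1, ?_⟩
      have h2 : 2 ≤ k + j + 1 := by have := h.one_le; omega
      have hc : c (k + j + 1) = next (k + j) (S j) := by
        have h3 : ¬ k + j + 1 ≤ k := by omega
        have h4 : k + j + 1 - 1 - k = j := by omega
        simp [c, h3]
      funext t
      rw [← add_assoc, Finset.sum_Icc_succ_top h2, hc, ← congrFun ih.2 t]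
  refine ⟨c, fun M hM => ?_⟩
  obtain ⟨j, rfl⟩ := Nat.exists_eq_add_of_le hM
  rw [← (hS j).2]
  exact (hS j).1

end FormalSolution

section SectorialSolution

variable {E : Type*} [NormedAddCommGroup E] [NormedSpace ℂ E]
variable {k M : ℕ} {B : E →L[ℂ] E} {G : E → ℂ → E} {F : E → ℂ → ℂ} {ρ C : ℝ} {P : ℂ → E}

lemma exists_radius_of_eventually {p : ℂ → Prop} (h : ∀ᶠ t in nhdsWithin (0 : ℂ) {0}ᶜ, p t) :
    ∃ r : ℝ, 0 < r ∧ ∀ t : ℂ, t ≠ 0 → ‖t‖ < r → p t := by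
  rw [eventually_nhdsWithin_iff, Metric.eventually_nhds_iff_ball] at h
  obtain ⟨r, hr, h⟩ := h
  exact ⟨r, hr, fun t h0 ht => h t (mem_ball_zero_iff.2 ht) h0⟩

/-- The perturbation in the equation `z' = -α B z - …` satisfied by `z` when `P t + t ^ M z`
solves `F y t • y' = G y t` and `t = chart ζ`. -/
def perturbation (k M : ℕ) (α : ℂ) (B : E →L[ℂ] E) (G : E → ℂ → E) (F : E → ℂ → ℂ) (P : ℂ → E)
    (z : E) (t : ℂ) : E :=
  α • ((t ^ M)⁻¹ • (B (P t) + nonlinearPart k B G F (P t + t ^ M • z) t - t ^ (k + 1) • deriv P t)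
    - (M * t ^ k) • z)

lemma IsApproxSolution.exists_perturbation_bound (h : IsPrepared k B G F ρ C)
    (hP : IsApproxSolution k G F M P) (hM : k + 1 ≤ M) (α : ℂ) :
    ∃ r X : ℝ, 0 < r ∧ r ≤ ρ ∧ 0 ≤ X ∧ ∀ t : ℂ, t ≠ 0 → ‖t‖ < r →
      (∀ z : E, ‖z‖ ≤ 1 → ‖P t + t ^ M • z‖ < ρ ∧ F (P t + t ^ M • z) t ≠ 0) ∧
      ‖perturbation k M α B G F P 0 t‖ ≤ X * ‖t‖ ∧
      ∀ x y : E, ‖x‖ ≤ 1 → ‖y‖ ≤ 1 →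
        ‖perturbation k M α B G F P x t - perturbation k M α B G F P y t‖
          ≤ X * ‖t‖ * ‖x - y‖ := by
  obtain ⟨L, hL, hLb⟩ := hP.isBigO.exists_pos
  obtain ⟨D, hD, hDb⟩ := hP.isBigO_defect.exists_pos
  obtain ⟨r₁, hr₁, hr₁b⟩ := exists_radius_of_eventually (hLb.bound.and hDb.bound)
  obtain ⟨r₂, Λ, hr₂, hr₂1, hr₂ρ, hΛ, hr₂b⟩ :=
    h.exists_nonlinearPart_lipschitz (L := L + 1) (by positivity)
  refine ⟨min r₁ r₂, ‖α‖ * (2 * D + Λ + M), by positivity, (min_le_right _ _).trans hr₂ρ,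
    by positivity, fun t ht0 ht => ?_⟩
  obtain ⟨ht1, ht2⟩ := lt_min_iff.1 ht
  obtain ⟨hPt, hDt⟩ := hr₁b t ht0 ht1
  obtain ⟨hbd, hlip⟩ := hr₂b t ht0 ht2
  have htpos : 0 < ‖t‖ := norm_pos_iff.2 ht0
  have htle : ‖t‖ ≤ 1 := by linarith
  have hmem : ∀ z : E, ‖z‖ ≤ 1 → ‖P t + t ^ M • z‖ ≤ (L + 1) * ‖t‖ ^ (k + 1) := fun z hz => by
    rw [add_mul, one_mul]
    refine (norm_add_le _ _).trans (add_le_add (by simpa using hPt) ?_)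
    rw [norm_smul, norm_pow]
    calc ‖t‖ ^ M * ‖z‖ ≤ ‖t‖ ^ (k + 1) * 1 := by
          gcongr ?_ * ?_
          exact pow_le_pow_of_le_one htpos.le htle hM
      _ = _ := mul_one _
  have htM : 0 < ‖t‖ ^ M := by positivity
  refine ⟨fun z hz => ⟨(hbd _ (hmem z hz)).1, (hbd _ (hmem z hz)).2.1⟩, ?_, fun x y hx hy => ?_⟩
  · obtain ⟨-, hF0, hq, -⟩ := hbd _ (hmem 0 (by simp))
    rw [smul_zero, add_zero] at hF0 hq
    have e1 : perturbation k M α B G F P 0 t = (-α * (t ^ M)⁻¹ * (t ^ (k + 1) / F (P t) t)) •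
        (F (P t) t • deriv P t - G (P t) t) := by
      simp only [perturbation, nonlinearPart, smul_zero, add_zero, sub_zero, smul_sub, smul_add,
        smul_smul]
      have e2 : -α * (t ^ M)⁻¹ * (t ^ (k + 1) / F (P t) t) * F (P t) t
          = -(α * ((t ^ M)⁻¹ * t ^ (k + 1))) := by field_simp
      have e3 : -α * (t ^ M)⁻¹ * (t ^ (k + 1) / F (P t) t)
          = -(α * ((t ^ M)⁻¹ * (t ^ (k + 1) / F (P t) t))) := by ring
      rw [e2, e3, neg_smul, neg_smul]
      abel
    rw [e1, norm_smul, norm_mul, norm_mul, norm_neg, norm_inv, norm_pow]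
    rw [norm_pow] at hDt
    calc ‖α‖ * (‖t‖ ^ M)⁻¹ * ‖t ^ (k + 1) / F (P t) t‖ * ‖F (P t) t • deriv P t - G (P t) t‖
        ≤ ‖α‖ * (‖t‖ ^ M)⁻¹ * 2 * (D * ‖t‖ ^ (M + 1)) := by gcongr
      _ = ‖α‖ * (2 * D) * ‖t‖ := by field_simp; ring
      _ ≤ ‖α‖ * (2 * D + Λ + M) * ‖t‖ := by
        gcongr
        have : (0 : ℝ) ≤ M := Nat.cast_nonneg M
        linarith
  · have e1 : perturbation k M α B G F P x t - perturbation k M α B G F P y t =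
        α • ((t ^ M)⁻¹ • (nonlinearPart k B G F (P t + t ^ M • x) t
          - nonlinearPart k B G F (P t + t ^ M • y) t) - (M * t ^ k) • (x - y)) := by
      simp only [perturbation, smul_sub, smul_add]
      abel
    have h1 := hlip _ _ (hmem x hx) (hmem y hy)
    rw [add_sub_add_left_eq_sub, ← smul_sub, norm_smul, norm_pow] at h1
    have h2 : ‖t‖ ^ k ≤ ‖t‖ := by
      simpa using pow_le_pow_of_le_one htpos.le htle h.one_le
    rw [e1, norm_smul]
    calc _ ≤ ‖α‖ * ((‖t‖ ^ M)⁻¹ * (Λ * ‖t‖ * (‖t‖ ^ M * ‖x - y‖)) + M * ‖t‖ * ‖x - y‖) := by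
          gcongr
          refine (norm_sub_le _ _).trans ?_
          rw [norm_smul, norm_smul, norm_inv, norm_pow, norm_mul, norm_pow, Complex.norm_natCast]
          gcongr
      _ = ‖α‖ * (Λ + M) * ‖t‖ * ‖x - y‖ := by field_simp
      _ ≤ _ := by
        gcongr
        linarith

lemma hasDerivAt_div_pow (hk : k ≠ 0) (ω : ℂ) {t : ℂ} (ht : t ≠ 0) :
    HasDerivAt (fun t : ℂ => (ω / t) ^ k) (-(k * ω ^ k) / t ^ (k + 1)) t := by
  obtain ⟨j, rfl⟩ : ∃ j, k = j + 1 := ⟨k - 1, by omega⟩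
  convert! ((hasDerivAt_inv ht).const_mul ω).pow (j + 1) using 1
  simp only [Nat.add_sub_cancel, mul_pow, inv_pow]
  field_simp
  ring

lemma smul_deriv_eq_of_perturbation (hM : M ≠ 0) {α t : ℂ} (hα : α ≠ 0) (ht : t ≠ 0)
    (p p' z z' v : E) :
    t ^ (k + 1) • (p' + (t ^ M • (-(α⁻¹ / t ^ (k + 1))) • (-(α • z')
      - α • ((t ^ M)⁻¹ • (p + v - t ^ (k + 1) • p') - (M * t ^ k) • z)) + (M * t ^ (M - 1)) • z))
      = p + t ^ M • z' + v := by
  obtain ⟨j, rfl⟩ : ∃ j, M = j + 1 := ⟨M - 1, by omega⟩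
  simp only [Nat.add_sub_cancel]
  match_scalars <;> field_simp <;> ring

variable {a b c₁ K : ℝ}

lemma IsPrepared.exists_sectorial_solution [CompleteSpace E] (h : IsPrepared k B G F ρ C)
    (hkab : k * (b - a) < 2 * Real.pi) (hc₁ : |c₁| < 1) (hcc : c₁ < opening k a b)
    (hA : IsBoundedlySolvable c₁ ((k * bisector a b ^ k)⁻¹ • B) K)
    (hP : IsApproxSolution k G F M P) (hM : k + 1 ≤ M) :
    ∃ r : ℝ, 0 < r ∧ ∃ q : ℂ → E, ∀ t ∈ SectorR a b r, DifferentiableAt ℂ q t ∧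
      F (q t) t • deriv q t = G (q t) t ∧ ‖q t - P t‖ ≤ ‖t‖ ^ M := by
  have hk := h.one_le
  have hk0 : k ≠ 0 := by omega
  set ω := bisector a b with hω'
  have hω : ‖ω‖ = 1 := norm_bisector a b
  have hω0 : ω ≠ 0 := by intro h0; simp [h0] at hω
  set α : ℂ := (k * ω ^ k)⁻¹ with hα
  have hα0 : α ≠ 0 := inv_ne_zero (mul_ne_zero (by exact_mod_cast hk0) (pow_ne_zero _ hω0))
  have hK := hA.nonneg
  obtain ⟨r₀, X, hr₀, hr₀ρ, hX, hb⟩ := hP.exists_perturbation_bound h hM α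
  set δ : ℝ := min r₀ (1 / (4 * (K * X + 1))) with hδ
  have hδ0 : 0 < δ := by positivity
  obtain ⟨R, hR, hRb⟩ := exists_norm_chart_lt hk0 hω hc₁ hδ0
  set τ := chart k ω R with hτ
  have hτ0 : ∀ ζ, τ ζ ≠ 0 := fun ζ => chart_ne_zero hω
  have hτr : ∀ ζ ∈ Cone c₁, ‖τ ζ‖ < r₀ := fun ζ hζ => (hRb ζ hζ).trans_le (min_le_left _ _)
  have hτd : DifferentiableOn ℂ τ (Cone c₁) := fun ζ hζ =>
    (hasDerivAt_chart hk0 hω (cone_subset_slitPlane (abs_lt.1 hc₁).1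
      (add_mem_cone hc₁.le hR.le hζ))).differentiableAt.differentiableWithinAt
  have hKε : K * (X * δ) ≤ 1 / 4 := by
    have h1 : δ * (4 * (K * X + 1)) ≤ 1 := by
      rw [← le_div_iff₀ (by positivity)]
      exact min_le_right _ _
    nlinarith
  have hP' : Differentiable ℂ (deriv P) := by
    rw [← differentiableOn_univ]
    exact hP.diff.differentiableOn.deriv isOpen_univ
  obtain ⟨z, hz1, hzd⟩ := hA.exists_semilinear (ε := X * δ) (by positivity) hKε
    (N := fun x ζ => perturbation k M α B G F P x (τ ζ))
    (by
      intro z hz hz1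
      have hPτ : DifferentiableOn ℂ (fun ζ => P (τ ζ)) (Cone c₁) := hP.diff.comp_differentiableOn hτd
      have hPτ' : DifferentiableOn ℂ (fun ζ => deriv P (τ ζ)) (Cone c₁) :=
        hP'.comp_differentiableOn hτd
      have hY : DifferentiableOn ℂ (fun ζ => P (τ ζ) + τ ζ ^ M • z ζ) (Cone c₁) :=
        hPτ.add ((hτd.pow M).smul hz)
      have hm : ∀ ζ ∈ Cone c₁, ‖P (τ ζ) + τ ζ ^ M • z ζ‖ < ρ ∧ ‖τ ζ‖ < ρ := fun ζ hζ =>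
        ⟨((hb _ (hτ0 ζ) (hτr ζ hζ)).1 _ (hz1 ζ hζ)).1, (hτr ζ hζ).trans_le hr₀ρ⟩
      have hnl : DifferentiableOn ℂ
          (fun ζ => nonlinearPart k B G F (P (τ ζ) + τ ζ ^ M • z ζ) (τ ζ)) (Cone c₁) :=
        (((hτd.pow (k + 1)).div (h.differentiableOn_comp_F hY hτd hm) fun ζ hζ =>
          ((hb _ (hτ0 ζ) (hτr ζ hζ)).1 _ (hz1 ζ hζ)).2).smul
            (h.differentiableOn_comp_G hY hτd hm)).sub (B.differentiable.comp_differentiableOn hY)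
      exact (((((hτd.pow M).inv fun ζ _ => pow_ne_zero _ (hτ0 ζ)).smul
        (((B.differentiable.comp_differentiableOn hPτ).add hnl).sub
          ((hτd.pow (k + 1)).smul hPτ'))).sub (((hτd.pow k).const_mul _).smul hz)).const_smul α))
    (fun ζ hζ => ((hb _ (hτ0 ζ) (hτr ζ hζ)).2.1).trans (by gcongr; exact (hRb ζ hζ).le))
    (fun ζ hζ x y hx hy => ((hb _ (hτ0 ζ) (hτr ζ hζ)).2.2 x y hx hy).trans
      (by gcongr; exact (hRb ζ hζ).le))
  set d : ℝ := opening k a b - c₁ with hd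
  have hd0 : 0 < d := by linarith
  refine ⟨min r₀ (min 1 (d / (2 * R))), by positivity,
    fun t => P t + t ^ M • z ((ω / t) ^ k - R), fun t ht => ?_⟩
  obtain ⟨htS, htr⟩ := ht
  obtain ⟨htr₀, htr'⟩ := lt_min_iff.1 (mem_ball_zero_iff.1 htr)
  obtain ⟨ht1, htd⟩ := lt_min_iff.1 htr'
  have ht0 : t ≠ 0 := ne_zero_of_mem_sector htS
  have htpos : 0 < ‖t‖ := norm_pos_iff.2 ht0
  set ζ : ℂ := (ω / t) ^ k - R with hζ'
  have hζ : ζ ∈ Cone c₁ := by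
    refine sub_mem_cone hc₁.le hR.le (div_pow_mem_cone hk hkab htS) ?_
    rw [norm_pow, norm_div, hω, ← hd, one_div, inv_pow]
    have h1 : ‖t‖ ^ k ≤ ‖t‖ := by simpa using pow_le_pow_of_le_one htpos.le ht1.le hk
    rw [lt_div_iff₀ (by positivity)] at htd
    rw [le_inv_mul_iff₀ (by positivity)]
    nlinarith
  have hτζ : τ ζ = t := chart_div_pow hk hkab htS R
  have hζd : HasDerivAt (fun t : ℂ => (ω / t) ^ k - R) (-(k * ω ^ k) / t ^ (k + 1)) t := by
    exact (hasDerivAt_div_pow (by omega) ω ht0).sub_const (R : ℂ)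
  have hzζ := hzd ζ hζ
  simp only [hτζ] at hzζ
  have hqd := (hP.diff t).hasDerivAt.add ((hasDerivAt_pow M t).smul (hzζ.scomp t hζd))
  obtain ⟨-, hF0⟩ := (hb t ht0 htr₀).1 _ (hz1 ζ hζ)
  refine ⟨hqd.differentiableAt, ?_, ?_⟩
  · have hs0 : t ^ (k + 1) ≠ 0 := pow_ne_zero _ ht0
    have key : t ^ (k + 1) • deriv (fun t => P t + t ^ M • z ((ω / t) ^ k - R)) t
        = (t ^ (k + 1) / F (P t + t ^ M • z ζ) t) • G (P t + t ^ M • z ζ) t := by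
      have e0 : (t ^ (k + 1) / F (P t + t ^ M • z ζ) t) • G (P t + t ^ M • z ζ) t =
          B (P t + t ^ M • z ζ) + nonlinearPart k B G F (P t + t ^ M • z ζ) t := by
        simp [nonlinearPart]
      have e1 : -(k * ω ^ k) / t ^ (k + 1) = -(α⁻¹ / t ^ (k + 1)) := by
        rw [hα, inv_inv, neg_div]
      rw [e0, map_add, map_smul]
      refine Eq.trans (congrArg _ hqd.deriv) ?_
      rw [e1]
      exact smul_deriv_eq_of_perturbation (by omega) hα0 ht0 _ _ _ _ _
    refine smul_right_injective E hs0 ?_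
    change t ^ (k + 1) • F (P t + t ^ M • z ζ) t • _ = t ^ (k + 1) • G (P t + t ^ M • z ζ) t
    rw [smul_comm, key, smul_smul, mul_div_cancel₀ _ hF0]
  · simp only [add_sub_cancel_left, norm_smul, norm_pow]
    exact mul_le_of_le_one_right (by positivity) (hz1 ζ hζ)

end SectorialSolution

section Uniqueness

variable {E : Type*} [NormedAddCommGroup E] [NormedSpace ℂ E]
variable {k : ℕ} {B : E →L[ℂ] E} {G : E → ℂ → E} {F : E → ℂ → ℂ} {ρ C a b r r₁ r₂ L K : ℝ}
  {q q₁ q₂ : ℂ → E}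

lemma isOpen_sectorR (hk : 1 ≤ k) (hab : a < b) (hkab : k * (b - a) < 2 * Real.pi) (r : ℝ) :
    IsOpen (SectorR a b r) :=
  (isOpen_sector hk hab hkab).inter isOpen_ball

lemma sectorR_subset_sectorR (h : r₁ ≤ r₂) : SectorR a b r₁ ⊆ SectorR a b r₂ :=
  inter_subset_inter_right _ (ball_subset_ball h)

/-- A solution of `F y t • y' = G y t` on a sector, of order `k + 1` at `0`. -/
structure IsSectorialSolution (k : ℕ) (G : E → ℂ → E) (F : E → ℂ → ℂ) (a b r L : ℝ)
    (q : ℂ → E) : Prop where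
  diff : DifferentiableOn ℂ q (SectorR a b r)
  eq : ∀ t ∈ SectorR a b r, F (q t) t • deriv q t = G (q t) t
  norm_le : ∀ t ∈ SectorR a b r, ‖q t‖ ≤ L * ‖t‖ ^ (k + 1)

lemma IsSectorialSolution.mono {L' : ℝ} (hq : IsSectorialSolution k G F a b r L q) (hr : r₁ ≤ r)
    (hL : L ≤ L') : IsSectorialSolution k G F a b r₁ L' q where
  diff := hq.diff.mono (sectorR_subset_sectorR hr)
  eq t ht := hq.eq t (sectorR_subset_sectorR hr ht)
  norm_le t ht := (hq.norm_le t (sectorR_subset_sectorR hr ht)).trans (by gcongr)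

/-- Two sectorial solutions of order `k + 1` coincide. -/
lemma IsPrepared.eqOn_of_isSectorialSolution [CompleteSpace E] (h : IsPrepared k B G F ρ C)
    (hab : a < b) (hkab : k * (b - a) < 2 * Real.pi)
    (hA : IsBoundedlySolvable (opening k a b) ((k * bisector a b ^ k)⁻¹ • B) K)
    (hL : 0 < L) (hr : 0 < r) (hr₁ : r ≤ r₁) (hr₂ : r ≤ r₂)
    (hd₁ : DifferentiableOn ℂ q₁ (SectorR a b r₁)) (hd₂ : DifferentiableOn ℂ q₂ (SectorR a b r₂))
    (hq₁ : IsSectorialSolution k G F a b r L q₁) (hq₂ : IsSectorialSolution k G F a b r L q₂) :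
    EqOn q₁ q₂ (SectorR a b (min r₁ r₂)) := by
  have hk := h.one_le
  have hk0 : k ≠ 0 := by omega
  have hc := abs_opening_lt_one hk hab hkab
  set c := opening k a b with hcdef
  set ω := bisector a b with hω'
  have hω : ‖ω‖ = 1 := norm_bisector a b
  have hω0 : ω ≠ 0 := by intro h0; simp [h0] at hω
  set α : ℂ := (k * ω ^ k)⁻¹ with hα
  have hK := hA.nonneg
  obtain ⟨r₀, Λ, hr₀, hr₀1, hr₀ρ, hΛ, hb⟩ := h.exists_nonlinearPart_lipschitz hL
  set X : ℝ := ‖α‖ * Λ with hX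
  have hX0 : 0 ≤ X := by positivity
  set δ : ℝ := min (min r r₀) (1 / (2 * (K * X + 1))) with hδ
  have hδ0 : 0 < δ := by positivity
  obtain ⟨R, hR, hRb⟩ := exists_norm_chart_lt hk0 hω hc hδ0
  set τ := chart k ω R with hτ
  have hτ0 : ∀ ζ, τ ζ ≠ 0 := fun ζ => chart_ne_zero hω
  have hτr₀ : ∀ ζ ∈ Cone c, ‖τ ζ‖ < r₀ := fun ζ hζ =>
    (hRb ζ hζ).trans_le ((min_le_left _ _).trans (min_le_right _ _))
  have hτm : ∀ ζ ∈ Cone c, τ ζ ∈ SectorR a b r := fun ζ hζ =>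
    ⟨chart_mem_sector hk hab hkab hR.le hζ, mem_ball_zero_iff.2
      ((hRb ζ hζ).trans_le ((min_le_left _ _).trans (min_le_left _ _)))⟩
  have hτd : ∀ ζ ∈ Cone c, HasDerivAt τ (-α * τ ζ ^ (k + 1)) ζ := fun ζ hζ =>
    hasDerivAt_chart hk0 hω (cone_subset_slitPlane (abs_lt.1 hc).1
      (add_mem_cone hc.le hR.le hζ))
  have hτD : DifferentiableOn ℂ τ (Cone c) := fun ζ hζ =>
    (hτd ζ hζ).differentiableAt.differentiableWithinAt
  have hKε : K * (X * δ) ≤ 1 / 2 := by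
    have h1 : δ * (2 * (K * X + 1)) ≤ 1 := by
      rw [← le_div_iff₀ (by positivity)]
      exact min_le_right _ _
    nlinarith
  have hopen := isOpen_sectorR (r := r) hk hab hkab
  have hsol : ∀ q, IsSectorialSolution k G F a b r L q →
      ContinuousOn (fun ζ => nonlinearPart k B G F (q (τ ζ)) (τ ζ)) (Cone c) ∧
      ∀ ζ ∈ Cone c, HasDerivAt (fun ζ => q (τ ζ))
        (-(α • (B (q (τ ζ)) + nonlinearPart k B G F (q (τ ζ)) (τ ζ)))) ζ := by
    intro q hq
    have hY : DifferentiableOn ℂ (fun ζ => q (τ ζ)) (Cone c) := hq.diff.comp hτD hτm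
    have hbd := fun ζ (hζ : ζ ∈ Cone c) =>
      (hb _ (hτ0 ζ) (hτr₀ ζ hζ)).1 _ (hq.norm_le _ (hτm ζ hζ))
    have hm : ∀ ζ ∈ Cone c, ‖q (τ ζ)‖ < ρ ∧ ‖τ ζ‖ < ρ := fun ζ hζ =>
      ⟨(hbd ζ hζ).1, (hτr₀ ζ hζ).trans_le hr₀ρ⟩
    refine ⟨DifferentiableOn.continuousOn (𝕜 := ℂ)
      ((((hτD.pow (k + 1)).div (h.differentiableOn_comp_F hY hτD hm) fun ζ hζ =>
        (hbd ζ hζ).2.1).smul (h.differentiableOn_comp_G hY hτD hm)).sub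
          (B.differentiable.comp_differentiableOn hY)), fun ζ hζ => ?_⟩
    have hqd := (hq.diff.differentiableAt (hopen.mem_nhds (hτm ζ hζ))).hasDerivAt
    convert! hqd.scomp ζ (hτd ζ hζ) using 1
    rw [nonlinearPart, add_sub_cancel, ← hq.eq _ (hτm ζ hζ), smul_smul,
      smul_smul, mul_assoc, div_mul_cancel₀ _ (hbd ζ hζ).2.1, neg_mul, neg_smul]
  obtain ⟨hc₁, hs₁⟩ := hsol q₁ hq₁
  obtain ⟨hc₂, hs₂⟩ := hsol q₂ hq₂
  set w : ℂ → E := fun ζ => q₁ (τ ζ) - q₂ (τ ζ) with hw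
  set f : ℂ → E := fun ζ => α • (nonlinearPart k B G F (q₁ (τ ζ)) (τ ζ)
    - nonlinearPart k B G F (q₂ (τ ζ)) (τ ζ)) with hf
  have hfc : ContinuousOn f (Cone c) := (hc₁.sub hc₂).const_smul α
  have hwd : ∀ ζ ∈ Cone c, HasDerivAt w (-((α • B) (w ζ)) - f ζ) ζ := fun ζ hζ => by
    convert! (hs₁ ζ hζ).sub (hs₂ ζ hζ) using 1
    simp only [hw, hf, _root_.smul_apply, map_sub, smul_sub, smul_add]
    abel
  have hfw : ∀ ζ ∈ Cone c, ‖f ζ‖ ≤ X * δ * ‖w ζ‖ := fun ζ hζ => by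
    have h1 := (hb _ (hτ0 ζ) (hτr₀ ζ hζ)).2 _ _ (hq₁.norm_le _ (hτm ζ hζ))
      (hq₂.norm_le _ (hτm ζ hζ))
    rw [hf, norm_smul]
    calc _ ≤ ‖α‖ * (Λ * ‖τ ζ‖ * ‖q₁ (τ ζ) - q₂ (τ ζ)‖) := by gcongr
      _ ≤ ‖α‖ * (Λ * δ * ‖q₁ (τ ζ) - q₂ (τ ζ)‖) := by gcongr; exact (hRb ζ hζ).le
      _ = _ := by rw [hX, hw]; ring
  have hiter : ∀ n : ℕ, ∀ ζ ∈ Cone c, ‖w ζ‖ ≤ 2 * L * (1 / 2) ^ n := by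
    intro n
    induction n with
    | zero =>
      intro ζ hζ
      have h1 : ‖τ ζ‖ ^ (k + 1) ≤ 1 :=
        pow_le_one₀ (norm_nonneg _) ((hτr₀ ζ hζ).le.trans hr₀1)
      have h2 := hq₁.norm_le _ (hτm ζ hζ)
      have h3 := hq₂.norm_le _ (hτm ζ hζ)
      have h4 := norm_sub_le (q₁ (τ ζ)) (q₂ (τ ζ))
      simp only [hw, pow_zero, mul_one]
      nlinarith
    | succ n ih =>
      intro ζ hζ
      have h1 := hA.norm_le w f (X * δ * (2 * L * (1 / 2) ^ n)) _ (by positivity) hfc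
        (fun ζ hζ => (hfw ζ hζ).trans (by gcongr; exact ih ζ hζ)) ih hwd ζ hζ
      refine h1.trans ?_
      rw [← mul_assoc, pow_succ]
      calc K * (X * δ) * (2 * L * (1 / 2) ^ n) ≤ 1 / 2 * (2 * L * (1 / 2) ^ n) := by gcongr
        _ = _ := by ring
  have hw0 : ∀ ζ ∈ Cone c, q₁ (τ ζ) = q₂ (τ ζ) := fun ζ hζ => by
    have h1 : Tendsto (fun n : ℕ => 2 * L * (1 / 2 : ℝ) ^ n) atTop (nhds (2 * L * 0)) :=
      (tendsto_pow_atTop_nhds_zero_of_lt_one (by norm_num) (by norm_num)).const_mul _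
    rw [mul_zero] at h1
    have h2 : ‖w ζ‖ ≤ 0 := ge_of_tendsto' h1 fun n => hiter n ζ hζ
    exact sub_eq_zero.1 (norm_le_zero_iff.1 h2)
  have h1 : (1 : ℂ) ∈ Cone c := by
    simpa [Cone] using (abs_lt.1 hc).2
  have hmin : r ≤ min r₁ r₂ := le_min hr₁ hr₂
  have ho := isOpen_sectorR (r := min r₁ r₂) hk hab hkab
  refine AnalyticOnNhd.eqOn_of_preconnected_of_eventuallyEq
    ((hd₁.mono (sectorR_subset_sectorR (min_le_left _ _))).analyticOnNhd ho)
    ((hd₂.mono (sectorR_subset_sectorR (min_le_right _ _))).analyticOnNhd ho)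
    (isPreconnected_sectorR a b _) (sectorR_subset_sectorR hmin (hτm 1 h1)) ?_
  have hcont : ContinuousAt (fun t : ℂ => (ω / t) ^ k - R) (τ 1) :=
    ((continuousAt_const.div continuousAt_id (hτ0 1)).pow k).sub continuousAt_const
  have hval : (ω / τ 1) ^ k - R = 1 := by
    have h0 : (R : ℂ) + 1 ≠ 0 := Complex.slitPlane_ne_zero
      (cone_subset_slitPlane (abs_lt.1 hc).1 (add_mem_cone hc.le hR.le h1))
    rw [div_pow, hτ, chart_pow hk0 h0]
    field_simp
    ring
  filter_upwards [hcont.eventually ((isOpen_cone c).mem_nhds (by beta_reduce; rwa [hval])),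
    hopen.mem_nhds (hτm 1 h1)] with t ht hts
  have := hw0 _ ht
  rwa [hτ, chart_div_pow hk hkab hts.1 R] at this

end Uniqueness

section Apriori

variable {E : Type*} [NormedAddCommGroup E] [NormedSpace ℂ E]
variable {k : ℕ} {B : E →L[ℂ] E} {G : E → ℂ → E} {F : E → ℂ → ℂ} {ρ C a b r M β : ℝ} {q : ℂ → E}

lemma smul_mem_sectorR {t : ℂ} (ht : t ∈ SectorR a b r) {s : ℝ} (hs : 0 < s) (hs1 : s ≤ 1) :
    s • t ∈ SectorR a b r := by
  rw [Complex.real_smul]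
  refine ⟨smul_mem_sector ht.1 hs, ?_⟩
  have h1 := mem_ball_zero_iff.1 ht.2
  rw [mem_ball_zero_iff, norm_mul, Complex.norm_real, Real.norm_of_nonneg hs.le]
  exact (mul_le_of_le_one_left (norm_nonneg _) hs1).trans_lt h1

lemma norm_le_of_norm_deriv_le_on_sectorR (hd : ∀ t ∈ SectorR a b r, DifferentiableAt ℂ q t)
    (h0 : Tendsto q (nhdsWithin 0 (SectorR a b r)) (nhds 0))
    (hM : ∀ t ∈ SectorR a b r, ‖deriv q t‖ ≤ M) {t : ℂ} (ht : t ∈ SectorR a b r) :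
    ‖q t‖ ≤ M * ‖t‖ := by
  have hconv : Convex ℝ ((fun s : ℝ => s • t) '' Set.Ioc 0 1) :=
    (convex_Ioc (0 : ℝ) 1).linear_image (LinearMap.toSpanSingleton ℝ ℂ t)
  have hsub : ∀ x ∈ (fun s : ℝ => s • t) '' Set.Ioc 0 1, x ∈ SectorR a b r := by
    rintro x ⟨s, hs, rfl⟩
    exact smul_mem_sectorR ht hs.1 hs.2
  have hbound : ∀ s ∈ Set.Ioc (0 : ℝ) 1, ‖q t - q (s • t)‖ ≤ M * ‖t - s • t‖ := fun s hs =>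
    hconv.norm_image_sub_le_of_norm_deriv_le (𝕜 := ℂ) (fun x hx => hd x (hsub x hx))
      (fun x hx => hM x (hsub x hx)) ⟨s, hs, rfl⟩ ⟨1, by simp, one_smul _ _⟩
  have hcont : Tendsto (fun s : ℝ => s • t) (nhdsWithin 0 (Set.Ioc 0 1)) (nhds 0) := by
    have h1 : Continuous fun s : ℝ => s • t := by fun_prop
    simpa using (h1.tendsto 0).mono_left nhdsWithin_le_nhds
  have hq0 : Tendsto (fun s : ℝ => q (s • t)) (nhdsWithin 0 (Set.Ioc 0 1)) (nhds 0) := by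
    refine h0.comp (tendsto_nhdsWithin_iff.2 ⟨hcont, ?_⟩)
    filter_upwards [self_mem_nhdsWithin] with s hs
    exact smul_mem_sectorR ht hs.1 hs.2
  have hne : (nhdsWithin (0 : ℝ) (Set.Ioc 0 1)).NeBot := by
    rw [nhdsWithin_Ioc_eq_nhdsGT one_pos]
    infer_instance
  have h1 := (tendsto_const_nhds (x := q t)).sub hq0 |>.norm
  have h2 := ((tendsto_const_nhds (x := t)).sub hcont).norm.const_mul M
  rw [sub_zero] at h1 h2
  refine le_of_tendsto_of_tendsto h1 h2 ?_
  filter_upwards [self_mem_nhdsWithin] with s hs using hbound s hs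

lemma IsPrepared.exists_isSectorialSolution_of_bounded_deriv (h : IsPrepared k B G F ρ C)
    (ho : IsOpen (SectorR a b r)) (hr : 0 < r) (hβ : 0 < β) (hB : ∀ y, β * ‖y‖ ≤ ‖B y‖)
    (hd : DifferentiableOn ℂ q (SectorR a b r))
    (h0 : Tendsto q (nhdsWithin 0 (SectorR a b r)) (nhds 0))
    (hM : ∃ M, ∀ t ∈ SectorR a b r, ‖deriv q t‖ ≤ M)
    (heq : ∀ t ∈ SectorR a b r, F (q t) t • deriv q t = G (q t) t) :
    ∃ r' L : ℝ, 0 < r' ∧ r' ≤ r ∧ 0 < L ∧ IsSectorialSolution k G F a b r' L q := by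
  obtain ⟨M, hM0, hM⟩ : ∃ M, 0 ≤ M ∧ ∀ t ∈ SectorR a b r, ‖deriv q t‖ ≤ M := by
    obtain ⟨M, hM⟩ := hM
    exact ⟨|M|, abs_nonneg M, fun t ht => (hM t ht).trans (le_abs_self M)⟩
  have hC := h.nonneg
  have hρ := h.pos
  set X : ℝ := C * (M * (1 + M) + 1) with hX
  have hX0 : 0 ≤ X := by positivity
  set r' : ℝ := min (min r ρ) (min (ρ / (M + 1)) (β / (2 * (X + 1)))) with hr'
  have hle : r' ≤ r := (min_le_left _ _).trans (min_le_left _ _)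
  have hsub := sectorR_subset_sectorR (a := a) (b := b) hle
  refine ⟨r', 2 * (C + M) / β + 1, by positivity, hle, by positivity, hd.mono hsub,
    fun t ht => heq t (hsub ht), fun t ht => ?_⟩
  have h1 := norm_le_of_norm_deriv_le_on_sectorR
    (fun t ht => hd.differentiableAt (ho.mem_nhds ht)) h0 hM (hsub ht)
  have htr := mem_ball_zero_iff.1 ht.2
  rw [hr', lt_min_iff, lt_min_iff, lt_min_iff, lt_div_iff₀ (by positivity),
    lt_div_iff₀ (by positivity)] at htr
  obtain ⟨⟨-, htρ⟩, htM, htX⟩ := htr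
  have hqρ : ‖q t‖ < ρ := by nlinarith [norm_nonneg t]
  have hG := h.norm_G_sub_le _ _ hqρ htρ
  have hF := h.norm_F_sub_le _ _ hqρ htρ
  have hFn : ‖F (q t) t‖ ≤ ‖t‖ ^ (k + 1) + C * ‖q t‖ ^ 2 := by
    have := norm_le_norm_add_norm_sub' (F (q t) t) (t ^ (k + 1))
    rw [norm_pow] at this
    linarith
  have hGn : ‖G (q t) t‖ ≤ (‖t‖ ^ (k + 1) + C * ‖q t‖ ^ 2) * M := by
    rw [← heq t (hsub ht), norm_smul]
    gcongr
    exact hM t (hsub ht)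
  have hBn : ‖B (q t)‖ ≤ ‖G (q t) t‖ + ‖G (q t) t - B (q t)‖ := norm_le_norm_add_norm_sub _ _
  have hq2 : ‖q t‖ ^ 2 ≤ M * ‖t‖ * ‖q t‖ := by
    rw [sq]
    gcongr
  have hsmall : X * ‖t‖ * ‖q t‖ ≤ β / 2 * ‖q t‖ := by
    gcongr
    nlinarith [norm_nonneg t]
  have hfin : β * ‖q t‖ ≤ 2 * (C + M) * ‖t‖ ^ (k + 1) := by
    have h2 : C * (1 + M) * ‖q t‖ ^ 2 ≤ C * (1 + M) * (M * ‖t‖ * ‖q t‖) := by gcongr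
    have h3 := hB (q t)
    have h4 : X * ‖t‖ * ‖q t‖ = C * (1 + M) * (M * ‖t‖ * ‖q t‖) + C * (‖q t‖ * ‖t‖) := by
      rw [hX]; ring
    linarith
  have h5 : ‖q t‖ ≤ 2 * (C + M) / β * ‖t‖ ^ (k + 1) := by
    rw [div_mul_eq_mul_div, le_div_iff₀ hβ]
    linarith
  have h6 : 0 ≤ ‖t‖ ^ (k + 1) := by positivity
  linarith

end Apriori

section CentralManifold

variable {E : Type*} [NormedAddCommGroup E] [NormedSpace ℂ E]
variable {k M : ℕ} {B : E →L[ℂ] E} {G : E → ℂ → E} {F : E → ℂ → ℂ} {ρ ρ₀ C a b r c₁ K K₁ L β : ℝ}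
  {P q : ℂ → E}

lemma nhdsWithin_sectorR_le : nhdsWithin 0 (SectorR a b r) ≤ nhdsWithin 0 {0}ᶜ :=
  nhdsWithin_mono _ fun _ ht => ne_zero_of_mem_sector ht.1

lemma eventually_norm_lt_nhdsWithin_sectorR (hε : 0 < ρ) :
    ∀ᶠ t in nhdsWithin 0 (SectorR a b r), ‖t‖ < ρ := by
  filter_upwards [nhdsWithin_le_nhds (ball_mem_nhds (0 : ℂ) hε)] with t ht
  exact mem_ball_zero_iff.1 ht

lemma sum_Icc_pow_smul_sub_isBigO (c : ℕ → E) (hM : 2 ≤ M) (j : ℕ) :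
    (fun t : ℂ => ∑ m ∈ Finset.Icc 2 (M + j), t ^ m • c m - ∑ m ∈ Finset.Icc 2 M, t ^ m • c m)
      =O[nhdsWithin 0 {0}ᶜ] fun t : ℂ => t ^ (M + 1) := by
  induction j with
  | zero => simpa using isBigO_zero _ _
  | succ j ih =>
    have h1 : (fun t : ℂ => t ^ (M + j + 1) • c (M + j + 1)) =O[nhdsWithin 0 {0}ᶜ]
        fun t : ℂ => t ^ (M + 1) := by
      refine IsBigO.trans (IsBigO.of_bound ‖c (M + j + 1)‖ (Eventually.of_forall fun t => ?_))
        (isBigO_pow_of_le (show M + 1 ≤ M + j + 1 by omega))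
      rw [norm_smul, mul_comm]
    refine (ih.add h1).congr_left fun t => ?_
    rw [← add_assoc, Finset.sum_Icc_succ_top (by omega)]
    abel

lemma IsSectorialSolution.tendsto (hq : IsSectorialSolution k G F a b r L q) :
    Tendsto q (nhdsWithin 0 (SectorR a b r)) (nhds 0) := by
  have h1 : Continuous fun t : ℂ => L * ‖t‖ ^ (k + 1) := by fun_prop
  refine squeeze_zero_norm' ?_ (by simpa using (h1.tendsto 0).mono_left nhdsWithin_le_nhds)
  filter_upwards [self_mem_nhdsWithin] with t ht using hq.norm_le t ht

lemma IsPrepared.exists_isSectorialSolution_near [CompleteSpace E] (h : IsPrepared k B G F ρ C)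
    (hkab : k * (b - a) < 2 * Real.pi) (hc₁ : |c₁| < 1) (hcc : c₁ < opening k a b)
    (hA : IsBoundedlySolvable c₁ ((k * bisector a b ^ k)⁻¹ • B) K)
    (hP : IsApproxSolution k G F M P) (hM : k + 1 ≤ M) :
    ∃ r L : ℝ, 0 < r ∧ 0 < L ∧ ∃ q : ℂ → E, IsSectorialSolution k G F a b r L q ∧
      ∀ t ∈ SectorR a b r, ‖q t - P t‖ ≤ ‖t‖ ^ M := by
  obtain ⟨r₁, hr₁, q, hq⟩ := h.exists_sectorial_solution hkab hc₁ hcc hA hP hM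
  obtain ⟨L, hL, hLb⟩ := hP.isBigO.exists_pos
  obtain ⟨r₂, hr₂, hr₂b⟩ := exists_radius_of_eventually hLb.bound
  have hsub : SectorR a b (min r₁ (min r₂ 1)) ⊆ SectorR a b r₁ :=
    sectorR_subset_sectorR (min_le_left _ _)
  refine ⟨min r₁ (min r₂ 1), L + 1, by positivity, by positivity, q,
    ⟨fun t ht => (hq t (hsub ht)).1.differentiableWithinAt, fun t ht => (hq t (hsub ht)).2.1,
      fun t ht => ?_⟩, fun t ht => (hq t (hsub ht)).2.2⟩
  have h1 := (hq t (hsub ht)).2.2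
  have h2 := mem_ball_zero_iff.1 ht.2
  rw [lt_min_iff, lt_min_iff] at h2
  have h3 := hr₂b t (ne_zero_of_mem_sector ht.1) h2.2.1
  have h4 : ‖t‖ ^ M ≤ ‖t‖ ^ (k + 1) := pow_le_pow_of_le_one (norm_nonneg t) h2.2.2.le hM
  rw [norm_pow] at h3
  have h5 := norm_le_norm_add_norm_sub' (q t) (P t)
  linarith

/-- Existence, uniqueness and asymptotic expansion of the sectorial central manifold, given the
solvability of the linear equation on slightly enlarged sectors. -/
theorem IsPrepared.exists_centralManifold [CompleteSpace E] (h : IsPrepared k B G F ρ C)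
    (hρ₀ : 0 < ρ₀) (hab : a < b) (hkab : k * (b - a) < 2 * Real.pi)
    (hA : IsBoundedlySolvable (opening k a b) ((k * bisector a b ^ k)⁻¹ • B) K)
    (hc₁ : |c₁| < 1) (hcc : c₁ < opening k a b)
    (hA₁ : IsBoundedlySolvable c₁ ((k * bisector a b ^ k)⁻¹ • B) K₁)
    (hβ : 0 < β) (hB : ∀ y, β * ‖y‖ ≤ ‖B y‖) {c : ℕ → E}
    (hc : ∀ M, k ≤ M → IsApproxSolution k G F M fun t => ∑ m ∈ Finset.Icc 2 M, t ^ m • c m) :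
    ∃ r : ℝ, 0 < r ∧ r ≤ ρ₀ ∧ ∃ q : ℂ → E,
      DifferentiableOn ℂ q (SectorR a b r) ∧
      (∀ t ∈ SectorR a b r, ‖q t‖ < ρ₀) ∧
      Tendsto q (nhdsWithin 0 (SectorR a b r)) (nhds 0) ∧
      (∃ M : ℝ, ∀ t ∈ SectorR a b r, ‖deriv q t‖ ≤ M) ∧
      (∀ t ∈ SectorR a b r, F (q t) t • deriv q t = G (q t) t) ∧
      (∀ r' : ℝ, 0 < r' → ∀ q' : ℂ → E,
        DifferentiableOn ℂ q' (SectorR a b r') →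
        Tendsto q' (nhdsWithin 0 (SectorR a b r')) (nhds 0) →
        (∃ M : ℝ, ∀ t ∈ SectorR a b r', ‖deriv q' t‖ ≤ M) →
        (∀ t ∈ SectorR a b r', F (q' t) t • deriv q' t = G (q' t) t) →
        ∀ t ∈ SectorR a b (min r r'), q' t = q t) ∧
      (∀ M : ℕ, 2 ≤ M →
        (fun t : ℂ => q t - ∑ m ∈ Finset.Icc 2 M, t ^ m • c m)
          =o[nhdsWithin 0 (SectorR a b r)] fun t : ℂ => t ^ M) := by
  have hk := h.one_le
  obtain ⟨r₀, L, hr₀, hL, q, hq₀, -⟩ :=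
    h.exists_isSectorialSolution_near hkab hc₁ hcc hA₁ (hc (k + 1) k.le_succ) le_rfl
  obtain ⟨r₁, Λ, hr₁, hr₁1, hr₁ρ, hΛ, hb⟩ := h.exists_nonlinearPart_lipschitz hL
  set r : ℝ := min (min r₀ r₁) (min ρ₀ (ρ₀ / L)) with hrdef
  have hr : 0 < r := by positivity
  have hrr₀ : r ≤ r₀ := (min_le_left _ _).trans (min_le_left _ _)
  have hrr₁ : r ≤ r₁ := (min_le_left _ _).trans (min_le_right _ _)
  have hq : IsSectorialSolution k G F a b r L q := hq₀.mono hrr₀ le_rfl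
  refine ⟨r, hr, (min_le_right _ _).trans (min_le_left _ _), q, hq.diff, fun t ht => ?_,
    hq.tendsto, ⟨2 * Λ, fun t ht => ?_⟩, hq.eq, fun r' hr' q' hd' h0' hM' heq' => ?_,
    fun M hM => ?_⟩
  · have htr := mem_ball_zero_iff.1 ht.2
    have h1 : ‖t‖ < ρ₀ / L := htr.trans_le ((min_le_right _ _).trans (min_le_right _ _))
    rw [lt_div_iff₀ hL] at h1
    have h2 : ‖t‖ ^ (k + 1) ≤ ‖t‖ :=
      pow_le_of_le_one (norm_nonneg t) ((htr.trans_le hrr₁).le.trans hr₁1) (by omega)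
    have h3 := hq.norm_le t ht
    nlinarith
  · have ht0 := ne_zero_of_mem_sector ht.1
    have htr := mem_ball_zero_iff.1 ht.2
    obtain ⟨-, hF0, h2, hG⟩ := (hb t ht0 (htr.trans_le hrr₁)).1 _ (hq.norm_le t ht)
    have h3 : t ^ (k + 1) • deriv q t = (t ^ (k + 1) / F (q t) t) • G (q t) t := by
      rw [← hq.eq t ht, smul_smul, div_mul_cancel₀ _ hF0]
    have h4 : ‖t‖ ^ (k + 1) * ‖deriv q t‖ ≤ 2 * (Λ * ‖t‖ ^ (k + 1)) := by
      rw [← norm_pow, ← norm_smul, h3, norm_smul, norm_pow]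
      gcongr
    have h5 : 0 < ‖t‖ ^ (k + 1) := pow_pos (norm_pos_iff.2 ht0) _
    exact le_of_mul_le_mul_left (by linarith) h5
  · obtain ⟨r'', L', hr'', hr''r', hL', hq'⟩ := h.exists_isSectorialSolution_of_bounded_deriv
      (isOpen_sectorR hk hab hkab r') hr' hβ hB hd' h0' hM' heq'
    have := h.eqOn_of_isSectorialSolution hab hkab hA (L := max L L') (r := min r r'')
      (by positivity) (by positivity) (min_le_left _ _) ((min_le_right _ _).trans hr''r')
      hq.diff hd' (hq.mono (min_le_left _ _) (le_max_left _ _))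
      (hq'.mono (min_le_right _ _) (le_max_right _ _))
    exact fun t ht => (this ht).symm
  · obtain ⟨j, hj, hjk⟩ : ∃ j, 1 ≤ j ∧ k + 1 ≤ M + j := ⟨k + 1, by omega, by omega⟩
    obtain ⟨r', L', hr', hL', y, hy, hyP⟩ :=
      h.exists_isSectorialSolution_near hkab hc₁ hcc hA₁ (hc (M + j) (by omega)) hjk
    have hqy : EqOn q y (SectorR a b (min r r')) :=
      h.eqOn_of_isSectorialSolution hab hkab hA (L := max L L') (r := min r r')
        (by positivity) (by positivity) (min_le_left _ _) (min_le_right _ _)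
        hq.diff hy.diff (hq.mono (min_le_left _ _) (le_max_left _ _))
        (hy.mono (min_le_right _ _) (le_max_right _ _))
    have h1 : (fun t => q t - ∑ m ∈ Finset.Icc 2 (M + j), t ^ m • c m)
        =O[nhdsWithin 0 (SectorR a b r)] fun t : ℂ => t ^ (M + 1) := by
      refine IsBigO.trans (IsBigO.of_bound 1 ?_)
        ((isBigO_pow_of_le (show M + 1 ≤ M + j by omega)).mono nhdsWithin_sectorR_le)
      filter_upwards [self_mem_nhdsWithin, eventually_norm_lt_nhdsWithin_sectorR hr'] with t ht htr
      have h2 : t ∈ SectorR a b (min r r') :=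
        ⟨ht.1, mem_ball_zero_iff.2 (lt_min (mem_ball_zero_iff.1 ht.2) htr)⟩
      rw [hqy h2, one_mul, norm_pow]
      exact hyP t (sectorR_subset_sectorR (min_le_right _ _) h2)
    have h2 := (sum_Icc_pow_smul_sub_isBigO c hM j).mono (nhdsWithin_sectorR_le (a := a) (b := b)
      (r := r))
    have h3 : (fun t : ℂ => t ^ (M + 1)) =o[nhdsWithin 0 (SectorR a b r)] fun t : ℂ => t ^ M :=
      (isLittleO_pow_pow M.lt_succ_self).mono nhdsWithin_le_nhds
    refine ((h1.add h2).congr_left fun t => ?_).trans_isLittleO h3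
    abel

end CentralManifold

section GoodSector

variable {m k : ℕ} {a b : ℝ} {B : Matrix (Fin m) (Fin m) ℂ}

lemma exists_pos_mul_norm_le_norm_matrixCLM (hB : IsUnit B) :
    ∃ β : ℝ, 0 < β ∧ ∀ y, β * ‖y‖ ≤ ‖matrixCLM B y‖ := by
  obtain ⟨u, rfl⟩ := hB
  set A := matrixCLM (↑u⁻¹ : Matrix (Fin m) (Fin m) ℂ) with hA
  refine ⟨1 / (‖A‖ + 1), by positivity, fun y => ?_⟩
  have h1 : A (matrixCLM (u : Matrix (Fin m) (Fin m) ℂ) y) = y := by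
    rw [hA, ← mul_apply_eq_comp, ← map_mul, Units.inv_mul, map_one,
      one_apply_eq_self]
  have h2 := A.le_opNorm (matrixCLM (u : Matrix (Fin m) (Fin m) ℂ) y)
  rw [h1] at h2
  rw [div_mul_eq_mul_div, one_mul, div_le_iff₀ (by positivity)]
  nlinarith [norm_nonneg (matrixCLM (u : Matrix (Fin m) (Fin m) ℂ) y)]

lemma matrixCLM_surjective (hB : IsUnit B) : Function.Surjective (matrixCLM B) := by
  obtain ⟨u, rfl⟩ := hB
  refine fun y => ⟨matrixCLM (↑u⁻¹ : Matrix (Fin m) (Fin m) ℂ) y, ?_⟩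
  rw [← mul_apply_eq_comp, ← map_mul, Units.mul_inv, map_one,
    one_apply_eq_self]

lemma IsGoodSectorFor.mul_sub_lt [Nonempty (Fin m)] (hS : IsGoodSectorFor k B a b) (hk : 1 ≤ k)
    (hB : IsUnit B) : k * (b - a) < 2 * Real.pi := by
  obtain ⟨z, hz⟩ := spectrum.nonempty_of_isAlgClosed_of_finiteDimensional ℂ B
  obtain ⟨h1, h2⟩ := hS.2.2 z hz
  exact (hasDecayDirection_of_unique_ray hk (spectrum.ne_zero_of_mem_of_unit (a := hB.unit) hz)
    h1 h2).1

lemma IsGoodSectorFor.hasDecayDirection (hS : IsGoodSectorFor k B a b) (hk : 1 ≤ k)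
    (hB : IsUnit B) :
    ∀ z ∈ spectrum ℂ ((k * bisector a b ^ k)⁻¹ • B), HasDecayDirection (opening k a b) z := by
  have hγ : ((k * bisector a b ^ k)⁻¹ : ℂ) ≠ 0 :=
    inv_ne_zero (mul_ne_zero (by exact_mod_cast (by omega : k ≠ 0))
      (pow_ne_zero _ (Complex.exp_ne_zero _)))
  intro z hz
  change z ∈ spectrum ℂ (Units.mk0 _ hγ • B) at hz
  rw [spectrum.unit_smul_eq_smul] at hz
  obtain ⟨w, hw, rfl⟩ := Set.mem_smul_set.1 hz
  obtain ⟨h1, h2⟩ := hS.2.2 w hw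
  exact (hasDecayDirection_of_unique_ray hk (spectrum.ne_zero_of_mem_of_unit (a := hB.unit) hw)
    h1 h2).2

end GoodSector

theorem stmt0 (n k : ℕ) (hn : 2 ≤ n) (hk : 1 ≤ k)
    (B : Matrix (Fin (n - 1)) (Fin (n - 1)) ℂ) (hB : IsUnit B)
    (G : (Fin (n - 1) → ℂ) → ℂ → (Fin (n - 1) → ℂ)) (F : (Fin (n - 1) → ℂ) → ℂ → ℂ)
    (ρ₀ : ℝ) (hρ₀ : 0 < ρ₀)
    (hGF : DifferentiableOn ℂ (fun p : (Fin (n - 1) → ℂ) × ℂ => (G p.1 p.2, F p.1 p.2))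
      (Metric.ball 0 ρ₀ ×ˢ Metric.ball 0 ρ₀))
    (C : ℝ)
    (hest : ∃ ρ₁ : ℝ, 0 < ρ₁ ∧ ρ₁ ≤ ρ₀ ∧ ∀ (y : Fin (n - 1) → ℂ) (t : ℂ),
      ‖y‖ < ρ₁ → ‖t‖ < ρ₁ →
        ‖G y t - B.mulVec y‖ ≤ C * (‖y‖ ^ 2 + ‖y‖ * ‖t‖ + ‖t‖ ^ (k + 1)) ∧
        ‖F y t - t ^ (k + 1)‖ ≤ C * ‖y‖ ^ 2) :
    ∃ c : ℕ → (Fin (n - 1) → ℂ),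
      ∀ a b : ℝ, IsGoodSectorFor k B a b →
        ∃ r : ℝ, 0 < r ∧ r ≤ ρ₀ ∧ ∃ q : ℂ → (Fin (n - 1) → ℂ),
          DifferentiableOn ℂ q (SectorR a b r) ∧
          (∀ t ∈ SectorR a b r, ‖q t‖ < ρ₀) ∧
          Filter.Tendsto q (nhdsWithin 0 (SectorR a b r)) (nhds 0) ∧
          (∃ M : ℝ, ∀ t ∈ SectorR a b r, ‖deriv q t‖ ≤ M) ∧
          (∀ t ∈ SectorR a b r, F (q t) t • deriv q t = G (q t) t) ∧
          (∀ r' : ℝ, 0 < r' → ∀ q' : ℂ → (Fin (n - 1) → ℂ),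
            DifferentiableOn ℂ q' (SectorR a b r') →
            (∀ t ∈ SectorR a b r', ‖q' t‖ < ρ₀) →
            Filter.Tendsto q' (nhdsWithin 0 (SectorR a b r')) (nhds 0) →
            (∃ M : ℝ, ∀ t ∈ SectorR a b r', ‖deriv q' t‖ ≤ M) →
            (∀ t ∈ SectorR a b r', F (q' t) t • deriv q' t = G (q' t) t) →
            ∀ t ∈ SectorR a b (min r r'), q' t = q t) ∧
          (∀ M : ℕ, 2 ≤ M →
            (fun t : ℂ => q t - ∑ m ∈ Finset.Icc 2 M, t ^ m • c m)
              =o[nhdsWithin 0 (SectorR a b r)] fun t : ℂ => t ^ M) := by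
  obtain ⟨ρ₁, hρ₁, hρ₁₀, hest⟩ := hest
  have : Nonempty (Fin (n - 1)) := ⟨⟨0, by omega⟩⟩
  have h : IsPrepared k (matrixCLM B) G F ρ₁ |C| := by
    refine ⟨hk, hρ₁, abs_nonneg C, hGF.mono (prod_mono (ball_subset_ball hρ₁₀)
      (ball_subset_ball hρ₁₀)), fun y t hy ht => (hest y t hy ht).1.trans ?_,
      fun y t hy ht => (hest y t hy ht).2.trans ?_⟩
    · gcongr
      exact le_abs_self C
    · gcongr
      exact le_abs_self C
  obtain ⟨c, hc⟩ := h.exists_coeff (matrixCLM_surjective hB)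
  obtain ⟨β, hβ, hBβ⟩ := exists_pos_mul_norm_le_norm_matrixCLM hB
  refine ⟨c, fun a b hS => ?_⟩
  have hab := hS.1
  have hkab := hS.mul_sub_lt hk hB
  have hdir := hS.hasDecayDirection hk hB
  have hopen := abs_opening_lt_one hk hab hkab
  obtain ⟨K, hA⟩ := exists_isBoundedlySolvable_matrix _ hdir
  have hev := (eventually_forall_spectrum_hasDecayDirection _ hdir).and
    ((continuous_abs.tendsto _).eventually (gt_mem_nhds hopen))
  obtain ⟨c₁, ⟨hdir₁, hc₁⟩, hcc⟩ := ((hev.filter_mono nhdsWithin_le_nhds).and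
    (self_mem_nhdsWithin : Set.Iio (opening k a b) ∈ nhdsWithin _ _)).exists
  obtain ⟨K₁, hA₁⟩ := exists_isBoundedlySolvable_matrix _ hdir₁
  rw [map_smul] at hA hA₁
  obtain ⟨r, hr, hrρ, q, h1, h2, h3, h4, h5, h6, h7⟩ :=
    h.exists_centralManifold hρ₀ hab hkab hA hc₁ hcc hA₁ hβ hBβ hc
  exact ⟨r, hr, hrρ, q, h1, h2, h3, h4, h5,
    fun r' hr' q' hd hb h0 hM heq => h6 r' hr' q' hd h0 hM heq, h7⟩
end
end

section
/- Let v be a holomorphic vector field on a neighborhood of 0 in ℂ² with v(0) = 0, and let A = Dv(0) be its linearization at 0, with eigenvalues λ and μ such that λ ≠ 0, μ ≠ 0 and λ/μ ∉ ℝ (the characteristic number is finite and nonreal). Then the singular point is linearizable: there exist an open neighborhood V of 0, a holomorphic map Φ : V → ℂ² with Φ(0) = 0 and DΦ(0) invertible (so Φ is a biholomorphism onto its image near 0), and a nonvanishing holomorphic function u : V → ℂ, such that DΦ(x)(v(x)) = u(x)·A(Φ(x)) for all x ∈ V; i.e. v is orbitally analytically equivalent to its linear part. -/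
noncomputable section

open Complex Set

open Metric MeasureTheory Filter Topology

variable {E : Type*} [NormedAddCommGroup E] [NormedSpace ℂ E]

theorem norm_fderiv_le_of_norm_le_sq {g : E → E} {K R θ : ℝ}
    (hg : DifferentiableOn ℂ g (ball 0 R)) (hK : ∀ y ∈ ball (0 : E) R, ‖g y‖ ≤ K * ‖y‖ ^ 2)
    (hK0 : 0 ≤ K) (hθ : 0 < θ) (hθ1 : θ ≤ 1) {y : E} (hy : (1 + θ) * ‖y‖ < R) :
    ‖fderiv ℂ g y‖ ≤ 5 * K / θ * ‖y‖ := by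
  rcases eq_or_ne y 0 with rfl | hy0
  · have hR : 0 < R := by simpa using hy
    have : HasFDerivAt g (0 : E →L[ℂ] E) 0 := by
      apply Asymptotics.IsBigO.hasFDerivAt (n := 2) _ one_lt_two
      apply Asymptotics.IsBigO.of_bound K
      filter_upwards [ball_mem_nhds (0 : E) hR] with x hx
      simpa using hK x hx
    simp [this.fderiv]
  · have hy' : 0 < ‖y‖ := norm_pos_iff.2 hy0
    have hsub : ∀ z ∈ ball y (θ * ‖y‖), ‖z‖ ≤ (1 + θ) * ‖y‖ := fun z hz ↦ by
      rw [mem_ball_iff_norm] at hz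
      have := norm_le_norm_add_norm_sub' z y
      linarith
    have h := Complex.norm_fderiv_le_div_of_mapsTo_ball (f := g) (c := y) (R₁ := θ * ‖y‖)
      (R₂ := 5 * K * ‖y‖ ^ 2)
      (hg.mono fun z hz ↦ by simpa using (hsub z hz).trans_lt hy) ?_ (by positivity)
    · refine h.trans_eq ?_
      field_simp
    · intro z hz
      rw [mem_closedBall_iff_norm]
      have h1 := hsub z hz
      have h2 := hK z (by simpa using h1.trans_lt hy)
      have h3 := hK y (by rw [mem_ball_zero_iff]; nlinarith)
      have h4 : ‖z‖ ≤ 2 * ‖y‖ := by nlinarith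
      have h5 : ‖z‖ ^ 2 ≤ (2 * ‖y‖) ^ 2 := by gcongr
      have := norm_sub_le (g z) (g y)
      nlinarith

/-- `B` is the flow of the linear vector field `A`, and contracts the norm exponentially at
unit rate. -/
structure IsContractingLinearFlow (A : E →L[ℂ] E) (B : ℂ → E →L[ℂ] E) : Prop where
  map_zero : B 0 = 1
  comm : ∀ z y, A (B z y) = B z (A y)
  deriv : ∀ z, HasDerivAt B (A * B z) z
  norm_le : ∀ (t : ℝ) y, ‖B t y‖ ≤ Real.exp (-t) * ‖y‖

/-- The solution `h` of the homological equation `Dh(y) (A y) - A (h y) = g y`, where `B` is the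
flow of `A`. -/
def homologicalSolution (B : ℂ → E →L[ℂ] E) (g : E → E) (y : E) : E :=
  -∫ t in Ioi (0 : ℝ), B (-t) (g (B t y))

namespace IsContractingLinearFlow

variable {A : E →L[ℂ] E} {B : ℂ → E →L[ℂ] E} (hB : IsContractingLinearFlow A B)
  {g : E → E} {K R : ℝ}

include hB

theorem norm_map_le {t : ℝ} (ht : 0 ≤ t) (y : E) : ‖B t y‖ ≤ ‖y‖ := by
  refine (hB.norm_le t y).trans (mul_le_of_le_one_left (norm_nonneg _) ?_)
  simpa using ht

theorem map_mem_ball {t : ℝ} (ht : 0 ≤ t) {y : E} (hy : y ∈ ball (0 : E) R) :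
    B t y ∈ ball (0 : E) R := by
  rw [mem_ball_zero_iff] at *
  exact (hB.norm_map_le ht y).trans_lt hy

theorem norm_neg_le (t : ℝ) (y : E) : ‖B (-t) y‖ ≤ Real.exp t * ‖y‖ := by
  simpa using hB.norm_le (-t) y

theorem opNorm_le (t : ℝ) : ‖B t‖ ≤ Real.exp (-t) :=
  (B t).opNorm_le_bound (Real.exp_nonneg _) (hB.norm_le t)

theorem opNorm_neg_le (t : ℝ) : ‖B (-t)‖ ≤ Real.exp t := by
  simpa using hB.opNorm_le (-t)

theorem continuous : Continuous B :=
  continuous_iff_continuousAt.2 fun z ↦ (hB.deriv z).continuousAt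

theorem norm_integrand_le (hK0 : 0 ≤ K) (hK : ∀ y ∈ ball (0 : E) R, ‖g y‖ ≤ K * ‖y‖ ^ 2)
    {y : E} (hy : y ∈ ball (0 : E) R) {t : ℝ} (ht : 0 ≤ t) :
    ‖B (-t) (g (B t y))‖ ≤ K * ‖y‖ ^ 2 * Real.exp (-t) := by
  have h1 := hB.norm_le t y
  calc _ ≤ Real.exp t * (K * (Real.exp (-t) * ‖y‖) ^ 2) := by
        grw [hB.norm_neg_le, hK _ (hB.map_mem_ball ht hy), h1]
    _ = (Real.exp t * Real.exp (-t)) * (K * ‖y‖ ^ 2 * Real.exp (-t)) := by ring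
    _ = _ := by rw [← Real.exp_add]; simp

theorem norm_homologicalSolution_le (hK0 : 0 ≤ K)
    (hK : ∀ y ∈ ball (0 : E) R, ‖g y‖ ≤ K * ‖y‖ ^ 2) {y : E} (hy : y ∈ ball (0 : E) R) :
    ‖homologicalSolution B g y‖ ≤ K * ‖y‖ ^ 2 := by
  rw [homologicalSolution, norm_neg]
  refine (norm_integral_le_of_norm_le ((integrableOn_exp_neg_Ioi 0).const_mul (K * ‖y‖ ^ 2))
    ?_).trans_eq ?_
  · exact (ae_restrict_mem measurableSet_Ioi).mono fun t ht ↦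
      hB.norm_integrand_le hK0 hK hy (mem_Ioi.1 ht).le
  · rw [integral_const_mul, integral_exp_neg_Ioi_zero, mul_one]

theorem continuousOn_integrand (hg : ContinuousOn g (ball 0 R)) {y : E}
    (hy : y ∈ ball (0 : E) R) : ContinuousOn (fun t : ℝ ↦ B (-t) (g (B t y))) (Ici 0) := by
  have hc := hB.continuous
  refine ContinuousOn.clm_apply (by fun_prop) (hg.comp ?_ fun t ht ↦ hB.map_mem_ball ht hy)
  exact ((hc.comp continuous_ofReal).clm_apply continuous_const).continuousOn

theorem integrableOn_integrand (hg : ContinuousOn g (ball 0 R)) (hK0 : 0 ≤ K)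
    (hK : ∀ y ∈ ball (0 : E) R, ‖g y‖ ≤ K * ‖y‖ ^ 2) {y : E} (hy : y ∈ ball (0 : E) R) :
    IntegrableOn (fun t : ℝ ↦ B (-t) (g (B t y))) (Ioi 0) := by
  refine ((integrableOn_exp_neg_Ioi 0).const_mul (K * ‖y‖ ^ 2)).mono' ?_ ?_
  · exact ((hB.continuousOn_integrand hg hy).mono Ioi_subset_Ici_self).aestronglyMeasurable
      measurableSet_Ioi
  · exact (ae_restrict_mem measurableSet_Ioi).mono fun t ht ↦
      hB.norm_integrand_le hK0 hK hy (mem_Ioi.1 ht).le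

variable [FiniteDimensional ℂ E]

theorem hasFDerivAt_homologicalSolution (hg : DifferentiableOn ℂ g (ball 0 R)) (hK0 : 0 ≤ K)
    (hK : ∀ y ∈ ball (0 : E) R, ‖g y‖ ≤ K * ‖y‖ ^ 2) {y : E} (hy : y ∈ ball (0 : E) R) :
    IntegrableOn (fun t : ℝ ↦ B (-t) ∘L fderiv ℂ g (B t y) ∘L B t) (Ioi 0) ∧
    HasFDerivAt (homologicalSolution B g)
      (-∫ t in Ioi (0 : ℝ), B (-t) ∘L fderiv ℂ g (B t y) ∘L B t) y := by
  have := FiniteDimensional.complete ℂ E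
  have := FiniteDimensional.proper ℂ E
  borelize E
  have hc := hB.continuous
  obtain ⟨r, hyr, hrR⟩ := exists_between (mem_ball_zero_iff.1 hy)
  have hr0 : 0 < r := (norm_nonneg _).trans_lt hyr
  obtain ⟨θ, hθ0, hθ⟩ : ∃ θ > 0, θ < min 1 (R / r - 1) :=
    exists_between (lt_min one_pos (by rw [sub_pos, one_lt_div hr0]; exact hrR))
  have hθ1 : θ ≤ 1 := hθ.le.trans (min_le_left _ _)
  have hθr : (1 + θ) * r < R := by
    have := hθ.trans_le (min_le_right _ _)
    rw [lt_sub_iff_add_lt, lt_div_iff₀ hr0] at this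
    linarith
  have hbound : ∀ t ∈ Ioi (0 : ℝ), ∀ x ∈ ball (0 : E) r,
      ‖B (-t) ∘L fderiv ℂ g (B t x) ∘L B t‖ ≤ 5 * K / θ * r * Real.exp (-t) := by
    intro t ht x hx
    rw [mem_ball_zero_iff] at hx
    have h1 := hB.norm_map_le (mem_Ioi.1 ht).le x
    have h2 := norm_fderiv_le_of_norm_le_sq hg hK hK0 hθ0 hθ1 (y := B t x) (by nlinarith)
    calc _ ≤ ‖B (-t)‖ * (‖fderiv ℂ g (B t x)‖ * ‖B t‖) := by
          grw [ContinuousLinearMap.opNorm_comp_le, ContinuousLinearMap.opNorm_comp_le]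
      _ ≤ Real.exp t * (5 * K / θ * (Real.exp (-t) * r) * Real.exp (-t)) := by
          grw [hB.opNorm_neg_le, h2, hB.opNorm_le, hB.norm_le, hx]
      _ = (Real.exp t * Real.exp (-t)) * (5 * K / θ * r * Real.exp (-t)) := by ring
      _ = _ := by rw [← Real.exp_add]; simp
  have hmeas : AEStronglyMeasurable (fun t : ℝ ↦ B (-t) ∘L fderiv ℂ g (B t y) ∘L B t)
      (volume.restrict (Ioi 0)) := by
    have h1 : Measurable fun t : ℝ ↦ fderiv ℂ g (B t y) :=
      (measurable_fderiv ℂ g).comp (by fun_prop : Continuous fun t : ℝ ↦ B t y).measurable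
    have h2 : StronglyMeasurable fun t : ℝ ↦ fderiv ℂ g (B t y) := h1.stronglyMeasurable
    have h3 : StronglyMeasurable fun t : ℝ ↦ B t :=
      (by fun_prop : Continuous fun t : ℝ ↦ B t).stronglyMeasurable
    have h4 : StronglyMeasurable fun t : ℝ ↦ B (-t) :=
      (by fun_prop : Continuous fun t : ℝ ↦ B (-t)).stronglyMeasurable
    exact (h4.mul (h2.mul h3)).aestronglyMeasurable
  have hyr' : y ∈ ball (0 : E) r := by simpa using hyr
  refine ⟨?_, ?_⟩
  · refine ((integrableOn_exp_neg_Ioi 0).const_mul (5 * K / θ * r)).mono' hmeas ?_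
    exact (ae_restrict_mem measurableSet_Ioi).mono fun t ht ↦ hbound t ht y hyr'
  · refine HasFDerivAt.neg ?_
    refine hasFDerivAt_integral_of_dominated_of_fderiv_le
      (bound := fun t ↦ 5 * K / θ * r * Real.exp (-t))
      (F' := fun x (t : ℝ) ↦ B (-t) ∘L fderiv ℂ g (B t x) ∘L B t)
      (isOpen_ball.mem_nhds hyr') ?_ (hB.integrableOn_integrand hg.continuousOn hK0 hK hy)
      hmeas ?_ ((integrableOn_exp_neg_Ioi 0).const_mul _) ?_
    · filter_upwards [isOpen_ball.mem_nhds hy] with x hx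
      exact (hB.integrableOn_integrand hg.continuousOn hK0 hK hx).1
    · exact (ae_restrict_mem measurableSet_Ioi).mono hbound
    · refine (ae_restrict_mem measurableSet_Ioi).mono fun t ht x hx ↦ ?_
      have hx' : B t x ∈ ball (0 : E) R :=
        hB.map_mem_ball (mem_Ioi.1 ht).le (ball_subset_ball hrR.le hx)
      exact (B (-t)).hasFDerivAt.comp x (((hg.differentiableAt
        (isOpen_ball.mem_nhds hx')).hasFDerivAt).comp x (B t).hasFDerivAt)

theorem fderiv_homologicalSolution_apply (hg : DifferentiableOn ℂ g (ball 0 R)) (hK0 : 0 ≤ K)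
    (hK : ∀ y ∈ ball (0 : E) R, ‖g y‖ ≤ K * ‖y‖ ^ 2) {y : E} (hy : y ∈ ball (0 : E) R) :
    fderiv ℂ (homologicalSolution B g) y (A y) = A (homologicalSolution B g y) + g y := by
  have := FiniteDimensional.complete ℂ E
  obtain ⟨hint, hd⟩ := hB.hasFDerivAt_homologicalSolution hg hK0 hK hy
  have hint0 := hB.integrableOn_integrand hg.continuousOn hK0 hK hy
  have hderiv : ∀ t ∈ Ici (0 : ℝ), HasDerivAt (fun t : ℝ ↦ B (-t) (g (B t y)))
      ((B (-t) ∘L fderiv ℂ g (B t y) ∘L B t) (A y) - A (B (-t) (g (B t y)))) t := by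
    intro t ht
    have h1 : HasDerivAt (fun z : ℂ ↦ B z y) (A (B t y)) t := by
      simpa using (hB.deriv t).clm_apply (hasDerivAt_const (t : ℂ) y)
    have h2 := ((hg.differentiableAt (isOpen_ball.mem_nhds
      (hB.map_mem_ball ht hy))).hasFDerivAt).comp_hasDerivAt (t : ℂ) h1
    have h3 : HasDerivAt (fun z : ℂ ↦ B (-z)) (-(A * B (-t))) (t : ℂ) := by
      have := (hB.deriv (-t)).scomp (t : ℂ) (hasDerivAt_neg (t : ℂ))
      rw [neg_one_smul] at this
      exact this
    have h4 := (h3.clm_apply h2).scomp t ofRealCLM.hasDerivAt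
    refine h4.congr_deriv ?_
    rw [ofRealCLM_apply, ofReal_one, one_smul, hB.comm]
    change -(A (B (-t) (g (B t y)))) + B (-t) (fderiv ℂ g (B t y) (B t (A y))) =
      B (-t) (fderiv ℂ g (B t y) (B t (A y))) - A (B (-t) (g (B t y)))
    abel
  have hlim : Tendsto (fun t : ℝ ↦ B (-t) (g (B t y))) atTop (𝓝 0) := by
    refine squeeze_zero_norm' ?_ (a := fun t : ℝ ↦ K * ‖y‖ ^ 2 * Real.exp (-t)) ?_
    · filter_upwards [eventually_ge_atTop 0] with t ht
      exact hB.norm_integrand_le hK0 hK hy ht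
    · simpa using Real.tendsto_exp_neg_atTop_nhds_zero.const_mul (K * ‖y‖ ^ 2)
  have hint1 := hint.apply_continuousLinearMap (A y)
  have key := integral_Ioi_of_hasDerivAt_of_tendsto' hderiv
    (hint1.sub (A.integrable_comp hint0)) hlim
  rw [integral_sub hint1 (A.integrable_comp hint0), A.integral_comp_comm hint0,
    ← ContinuousLinearMap.integral_apply hint] at key
  rw [hd.fderiv, homologicalSolution]
  simp only [neg_apply, map_neg]
  simp [hB.map_zero] at key ⊢
  rw [eq_comm, ← sub_eq_zero] at key ⊢
  rw [← neg_eq_zero, ← key]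
  abel


omit [NormedSpace ℂ E] hB [FiniteDimensional ℂ E] in
theorem norm_add_le_two_mul {h : E → E} (hKR : K * R ≤ 1)
    (hK0 : 0 ≤ K) (hK : ∀ y ∈ ball (0 : E) R, ‖h y‖ ≤ K * ‖y‖ ^ 2)
    {y : E} (hy : y ∈ ball (0 : E) R) : ‖y + h y‖ ≤ 2 * ‖y‖ := by
  have h1 := hK y hy
  have h2 := norm_add_le y (h y)
  rw [mem_ball_zero_iff] at hy
  have h3 : K * ‖y‖ ≤ 1 := (mul_le_mul_of_nonneg_left hy.le hK0).trans hKR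
  nlinarith [norm_nonneg y]

/-- The iteration scheme for the equation `Dh(y) (A y) - A (h y) = f (y + h y)`. -/
def conjugacyIterate (B : ℂ → E →L[ℂ] E) (f : E → E) : ℕ → E → E
  | 0 => 0
  | n + 1 => homologicalSolution B fun y ↦ f (y + conjugacyIterate B f n y)

section

variable {f h : E → E} (hf : DifferentiableOn ℂ f (ball 0 (2 * R)))
  (hK0 : 0 ≤ K) (hK : ∀ y ∈ ball (0 : E) (2 * R), ‖f y‖ ≤ K * ‖y‖ ^ 2)
  (hL : ∀ x ∈ ball (0 : E) (2 * R), ∀ y ∈ ball (0 : E) (2 * R), ‖f x - f y‖ ≤ 1 / 2 * ‖x - y‖)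
  (hKR : 4 * K * R ≤ 1)

include hf hK0 hK hKR

omit hB [FiniteDimensional ℂ E] in
theorem perturbation_bounds (hh : DifferentiableOn ℂ h (ball 0 R))
    (hhK : ∀ y ∈ ball (0 : E) R, ‖h y‖ ≤ 4 * K * ‖y‖ ^ 2) :
    DifferentiableOn ℂ (fun y ↦ f (y + h y)) (ball 0 R) ∧
    ∀ y ∈ ball (0 : E) R, y + h y ∈ ball (0 : E) (2 * R) ∧ ‖f (y + h y)‖ ≤ 4 * K * ‖y‖ ^ 2 := by
  have hmem : ∀ y ∈ ball (0 : E) R, y + h y ∈ ball (0 : E) (2 * R) := fun y hy ↦ by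
    have := norm_add_le_two_mul hKR (by positivity) hhK hy
    rw [mem_ball_zero_iff] at *
    linarith
  refine ⟨hf.comp (differentiableOn_id.add hh) hmem, fun y hy ↦ ⟨hmem y hy, ?_⟩⟩
  grw [hK _ (hmem y hy), norm_add_le_two_mul hKR (by positivity) hhK hy]
  apply le_of_eq
  ring

theorem conjugacyIterate_bounds (n : ℕ) :
    DifferentiableOn ℂ (conjugacyIterate B f n) (ball 0 R) ∧
    ∀ y ∈ ball (0 : E) R, ‖conjugacyIterate B f n y‖ ≤ 4 * K * ‖y‖ ^ 2 := by
  induction n with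
  | zero =>
    refine ⟨differentiableOn_const 0, fun y _ ↦ ?_⟩
    simp only [conjugacyIterate, Pi.zero_apply, norm_zero]
    positivity
  | succ n ih =>
    obtain ⟨h1, h2⟩ := perturbation_bounds hf hK0 hK hKR ih.1 ih.2
    refine ⟨fun y hy ↦ ?_, fun y hy ↦ ?_⟩
    · exact (hB.hasFDerivAt_homologicalSolution h1 (by positivity) (fun y hy ↦ (h2 y hy).2)
        hy).2.differentiableAt.differentiableWithinAt
    · exact hB.norm_homologicalSolution_le (by positivity) (fun y hy ↦ (h2 y hy).2) hy

include hL

omit [FiniteDimensional ℂ E] in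
theorem norm_homologicalSolution_sub_le {h' : E → E} {C : ℝ} (hC : 0 ≤ C)
    (hh : DifferentiableOn ℂ h (ball 0 R))
    (hhK : ∀ y ∈ ball (0 : E) R, ‖h y‖ ≤ 4 * K * ‖y‖ ^ 2)
    (hh' : DifferentiableOn ℂ h' (ball 0 R))
    (hhK' : ∀ y ∈ ball (0 : E) R, ‖h' y‖ ≤ 4 * K * ‖y‖ ^ 2)
    (hC' : ∀ y ∈ ball (0 : E) R, ‖h y - h' y‖ ≤ C * ‖y‖ ^ 2)
    {y : E} (hy : y ∈ ball (0 : E) R) :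
    ‖homologicalSolution B (fun y ↦ f (y + h y)) y -
      homologicalSolution B (fun y ↦ f (y + h' y)) y‖ ≤ C / 2 * ‖y‖ ^ 2 := by
  obtain ⟨h1, h2⟩ := perturbation_bounds hf hK0 hK hKR hh hhK
  obtain ⟨h1', h2'⟩ := perturbation_bounds hf hK0 hK hKR hh' hhK'
  have i1 := hB.integrableOn_integrand h1.continuousOn (by positivity)
    (fun y hy ↦ (h2 y hy).2) hy
  have i2 := hB.integrableOn_integrand h1'.continuousOn (by positivity)
    (fun y hy ↦ (h2' y hy).2) hy
  have heq : homologicalSolution B (fun y ↦ f (y + h y)) y -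
      homologicalSolution B (fun y ↦ f (y + h' y)) y =
      homologicalSolution B (fun y ↦ f (y + h y) - f (y + h' y)) y := by
    simp only [homologicalSolution, map_sub]
    rw [integral_sub i1 i2]
    abel
  rw [heq]
  refine hB.norm_homologicalSolution_le (by positivity) (fun z hz ↦ ?_) hy
  have := hL _ (h2 z hz).1 _ (h2' z hz).1
  rw [add_sub_add_left_eq_sub] at this
  linarith [hC' z hz]

theorem norm_conjugacyIterate_succ_sub_le (n : ℕ) {y : E} (hy : y ∈ ball (0 : E) R) :
    ‖conjugacyIterate B f (n + 1) y - conjugacyIterate B f n y‖ ≤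
      4 * K * (1 / 2) ^ n * ‖y‖ ^ 2 := by
  induction n generalizing y with
  | zero => simpa [conjugacyIterate] using (hB.conjugacyIterate_bounds hf hK0 hK hKR 1).2 y hy
  | succ n ih =>
    have h1 := hB.conjugacyIterate_bounds hf hK0 hK hKR (n + 1)
    have h2 := hB.conjugacyIterate_bounds hf hK0 hK hKR n
    refine (hB.norm_homologicalSolution_sub_le hf hK0 hK hL hKR (by positivity) h1.1 h1.2 h2.1
      h2.2 (fun y hy ↦ ih hy) hy).trans_eq ?_
    ring

theorem exists_eq_homologicalSolution (hR : 0 < R) : ∃ h : E → E,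
    DifferentiableOn ℂ h (ball 0 (R / 2)) ∧
    (∀ y ∈ ball (0 : E) (R / 2), ‖h y‖ ≤ 4 * K * ‖y‖ ^ 2) ∧
    ∀ y ∈ ball (0 : E) (R / 2), h y = homologicalSolution B (fun y ↦ f (y + h y)) y := by
  have := FiniteDimensional.complete ℂ E
  set a := conjugacyIterate B f with ha
  have hab := hB.conjugacyIterate_bounds hf hK0 hK hKR
  have had := hB.norm_conjugacyIterate_succ_sub_le hf hK0 hK hL hKR
  have hsub : ball (0 : E) (R / 2) ⊆ ball 0 R := ball_subset_ball (by linarith)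
  have hcauchy : ∀ y ∈ ball (0 : E) R, ∃ l, Tendsto (fun n ↦ a n y) atTop (𝓝 l) ∧
      ∀ n, ‖a n y - l‖ ≤ 8 * K * (1 / 2) ^ n * ‖y‖ ^ 2 := by
    intro y hy
    have hd : ∀ n, dist (a n y) (a (n + 1) y) ≤ 4 * K * ‖y‖ ^ 2 * (1 / 2) ^ n := fun n ↦ by
      rw [dist_comm, dist_eq_norm]
      linarith [had n hy]
    obtain ⟨l, hl⟩ := cauchySeq_tendsto_of_complete
      (cauchySeq_of_le_geometric (1 / 2) _ (by norm_num) hd)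
    refine ⟨l, hl, fun n ↦ ?_⟩
    have := dist_le_of_le_geometric_of_tendsto (1 / 2) _ (by norm_num) hd hl n
    rw [dist_eq_norm] at this
    refine this.trans_eq ?_
    ring
  choose! h hlim hrate using hcauchy
  have hhK : ∀ y ∈ ball (0 : E) R, ‖h y‖ ≤ 4 * K * ‖y‖ ^ 2 := fun y hy ↦
    le_of_tendsto (hlim y hy).norm (Eventually.of_forall fun n ↦ (hab n).2 y hy)
  have hdiff : DifferentiableOn ℂ h (ball 0 (R / 2)) := by
    have hder : ∀ n, ∀ y ∈ ball (0 : E) (R / 2),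
        ‖fderiv ℂ (a (n + 1)) y - fderiv ℂ (a n) y‖ ≤ 20 * K * R * (1 / 2) ^ n := by
      intro n y hy
      have hda : ∀ m, DifferentiableAt ℂ (a m) y := fun m ↦
        (hab m).1.differentiableAt (isOpen_ball.mem_nhds (hsub hy))
      rw [← fderiv_sub (hda _) (hda _)]
      rw [mem_ball_zero_iff] at hy
      have := norm_fderiv_le_of_norm_le_sq (θ := 1) ((hab (n + 1)).1.sub (hab n).1)
        (fun y hy ↦ had n hy) (by positivity) one_pos le_rfl (y := y) (by linarith)
      refine this.trans ?_
      have h1 : ‖y‖ ≤ R := by linarith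
      grw [h1]
      apply le_of_eq
      ring
    have hcd : ∀ y ∈ ball (0 : E) (R / 2), ∃ l, ∀ n,
        dist (fderiv ℂ (a n) y) l ≤ 20 * K * R / (1 - 1 / 2) * (1 / 2) ^ n := by
      intro y hy
      have hd : ∀ n, dist (fderiv ℂ (a n) y) (fderiv ℂ (a (n + 1)) y) ≤
          20 * K * R * (1 / 2) ^ n := fun n ↦ by
        rw [dist_comm, dist_eq_norm]
        exact hder n y hy
      obtain ⟨l, hl⟩ := cauchySeq_tendsto_of_complete
        (cauchySeq_of_le_geometric (1 / 2) _ (by norm_num) hd)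
      refine ⟨l, fun n ↦ ?_⟩
      refine (dist_le_of_le_geometric_of_tendsto (1 / 2) _ (by norm_num) hd hl n).trans_eq ?_
      ring
    choose! D hD using hcd
    have hunif : TendstoUniformlyOn (fun n y ↦ fderiv ℂ (a n) y) D atTop (ball 0 (R / 2)) := by
      rw [Metric.tendstoUniformlyOn_iff]
      intro ε hε
      have : Tendsto (fun n : ℕ ↦ 20 * K * R / (1 - 1 / 2) * (1 / 2 : ℝ) ^ n) atTop (𝓝 0) := by
        simpa using (tendsto_pow_atTop_nhds_zero_of_lt_one (r := (1 / 2 : ℝ)) (by norm_num)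
          (by norm_num)).const_mul (20 * K * R / (1 - 1 / 2))
      filter_upwards [this.eventually_lt_const hε] with n hn y hy
      rw [dist_comm]
      exact (hD y hy n).trans_lt hn
    intro y hy
    refine (hasFDerivAt_of_tendstoUniformlyOn isOpen_ball hunif (fun n y hy ↦ ?_)
      (fun y hy ↦ hlim y (hsub hy)) hy).differentiableAt.differentiableWithinAt
    exact ((hab n).1.differentiableAt (isOpen_ball.mem_nhds (hsub hy))).hasFDerivAt
  refine ⟨h, hdiff, fun y hy ↦ hhK y (hsub hy), fun y hy ↦ ?_⟩
  have hsub2 : ball (0 : E) (2 * (R / 2)) ⊆ ball 0 (2 * R) := ball_subset_ball (by linarith)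
  have hle : ∀ n, ‖a (n + 1) y - homologicalSolution B (fun y ↦ f (y + h y)) y‖ ≤
      8 * K * (1 / 2) ^ n / 2 * ‖y‖ ^ 2 := fun n ↦
    hB.norm_homologicalSolution_sub_le (R := R / 2) (hf.mono hsub2) hK0
      (fun y hy ↦ hK y (hsub2 hy)) (fun x hx y hy ↦ hL x (hsub2 hx) y (hsub2 hy))
      (by nlinarith) (by positivity) ((hab n).1.mono hsub) (fun y hy ↦ (hab n).2 y (hsub hy))
      hdiff (fun y hy ↦ hhK y (hsub hy)) (fun y hy ↦ hrate y (hsub hy) n) hy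
  refine tendsto_nhds_unique ((hlim y (hsub hy)).comp (tendsto_add_atTop_nat 1)) ?_
  rw [tendsto_iff_norm_sub_tendsto_zero]
  refine squeeze_zero (fun _ ↦ norm_nonneg _) hle ?_
  simpa using (((tendsto_pow_atTop_nhds_zero_of_lt_one (r := (1 / 2 : ℝ)) (by norm_num)
    (by norm_num)).const_mul (8 * K)).div_const 2).mul_const (‖y‖ ^ 2)

end

end IsContractingLinearFlow

theorem norm_sub_le_of_norm_fderiv_le {g : E → E} {r C : ℝ}
    (hg : DifferentiableOn ℂ g (ball 0 r)) (hC : ∀ y ∈ ball (0 : E) r, ‖fderiv ℂ g y‖ ≤ C) :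
    ∀ x ∈ ball (0 : E) r, ∀ y ∈ ball (0 : E) r, ‖g x - g y‖ ≤ C * ‖x - y‖ := fun _ hx _ hy ↦
  (convex_ball (0 : E) r).norm_image_sub_le_of_norm_fderiv_le
    (fun _ hz ↦ hg.differentiableAt (isOpen_ball.mem_nhds hz)) hC hy hx

/-- A nonlinear perturbation of size `O(‖x‖ ^ 2)` is small near the origin in the `C¹` sense. -/
theorem exists_quadratic_bound {f : E → E} {U : Set E} (hU : U ∈ 𝓝 0)
    (hf : DifferentiableOn ℂ f U) (hf0 : f 0 = 0) (hf' : HasFDerivAt f (0 : E →L[ℂ] E) 0) :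
    ∃ ρ > 0, ball 0 ρ ⊆ U ∧ ∀ y ∈ ball (0 : E) ρ, ‖f y‖ ≤ 1 / ρ * ‖y‖ ^ 2 := by
  have ho : (fun y ↦ f y - f 0) =o[𝓝 0] fun y ↦ y - 0 := by
    simpa using hf'.isLittleO
  have hle : ∀ᶠ y in 𝓝 (0 : E), ‖f y‖ ≤ ‖y‖ := by
    simpa [hf0] using ho.bound one_pos
  obtain ⟨ρ, hρ, hsub⟩ := Metric.mem_nhds_iff.1 (inter_mem hU hle)
  refine ⟨ρ, hρ, fun y hy ↦ (hsub hy).1, fun y hy ↦ ?_⟩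
  have := Complex.dist_le_mul_div_pow_of_mapsTo_ball_of_isLittleO (n := 1) (f := f) (R₂ := ρ)
    (hf.mono fun y hy ↦ (hsub hy).1) ?_ ?_ hy
  · simp only [hf0, dist_zero_right] at this
    refine this.trans_eq ?_
    rw [div_pow]
    field_simp
  · intro z hz
    have h1 : ‖f z‖ ≤ ‖z‖ := (hsub hz).2
    rw [mem_ball_zero_iff] at hz
    rw [hf0, mem_closedBall_zero_iff]
    exact h1.trans hz.le
  · simpa using ho.norm_right

/-- **Poincaré linearization** for a holomorphic vector field whose linear part has a flow that
contracts conformally. -/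
theorem IsContractingLinearFlow.exists_linearization [FiniteDimensional ℂ E]
    {A : E →L[ℂ] E} {B : ℂ → E →L[ℂ] E} (hB : IsContractingLinearFlow A B)
    {v : E → E} {U : Set E} (hU : U ∈ 𝓝 0) (hv : DifferentiableOn ℂ v U) (hv0 : v 0 = 0)
    (hA : HasFDerivAt v A 0) :
    ∃ V : Set E, IsOpen V ∧ (0 : E) ∈ V ∧ ∃ Φ : E → E, Φ 0 = 0 ∧ InjOn Φ V ∧
      (∀ x ∈ V, ∃ D : E ≃L[ℂ] E, HasFDerivAt Φ (D : E →L[ℂ] E) x) ∧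
      ∀ x ∈ V, fderiv ℂ Φ x (v x) = A (Φ x) := by
  have := FiniteDimensional.complete ℂ E
  set f : E → E := fun x ↦ v x - A x with hf_def
  have hfd : DifferentiableOn ℂ f U := hv.sub A.differentiableOn
  have hf0 : f 0 = 0 := by simp [f, hv0]
  have hf' : HasFDerivAt f (0 : E →L[ℂ] E) 0 := by
    have := hA.sub A.hasFDerivAt
    rwa [sub_self] at this
  obtain ⟨ρ, hρ, hρU, hfρ⟩ := exists_quadratic_bound hU hfd hf0 hf'
  have hfρd := hfd.mono hρU
  have hsub1 : ball (0 : E) (2 * (ρ / 40)) ⊆ ball 0 ρ := ball_subset_ball (by linarith)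
  have hL : ∀ x ∈ ball (0 : E) (2 * (ρ / 40)), ∀ y ∈ ball (0 : E) (2 * (ρ / 40)),
      ‖f x - f y‖ ≤ 1 / 2 * ‖x - y‖ := by
    refine norm_sub_le_of_norm_fderiv_le (hfρd.mono hsub1) fun y hy ↦ ?_
    rw [mem_ball_zero_iff] at hy
    refine (norm_fderiv_le_of_norm_le_sq hfρd hfρ (by positivity) one_pos le_rfl
      (by linarith)).trans ?_
    grw [hy]
    apply le_of_eq_of_le (b := 1 / 4) (by field_simp; norm_num) (by norm_num)
  obtain ⟨h, hhd, hhK, hheq⟩ := hB.exists_eq_homologicalSolution (hfρd.mono hsub1)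
    (K := 1 / ρ) (by positivity) (fun y hy ↦ hfρ y (hsub1 hy)) hL (by field_simp; norm_num)
    (by positivity)
  have hhPDE : ∀ y ∈ ball (0 : E) (ρ / 40 / 2), fderiv ℂ h y (A y) = A (h y) + f (y + h y) := by
    intro y hy
    have hsub2 : ball (0 : E) (2 * (ρ / 40 / 2)) ⊆ ball 0 ρ := ball_subset_ball (by linarith)
    obtain ⟨h1, h2⟩ := perturbation_bounds (R := ρ / 40 / 2) (hfρd.mono hsub2)
      (K := 1 / ρ) (by positivity) (fun y hy ↦ hfρ y (hsub2 hy)) (by field_simp; norm_num)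
      hhd hhK
    have := hB.fderiv_homologicalSolution_apply h1 (by positivity) (fun y hy ↦ (h2 y hy).2) hy
    rw [← hheq y hy] at this
    rw [← this]
    congr 1
    exact (eventuallyEq_of_mem (isOpen_ball.mem_nhds hy) hheq).fderiv_eq
  set r : ℝ := ρ / 200 with hr
  have hr0 : 0 < r := by positivity
  have hsubr : ball (0 : E) r ⊆ ball 0 (ρ / 40 / 2) := ball_subset_ball (by rw [hr]; linarith)
  have hhfd : ∀ y ∈ ball (0 : E) r, ‖fderiv ℂ h y‖ ≤ 1 / 2 := fun y hy ↦ by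
    rw [mem_ball_zero_iff] at hy
    refine (norm_fderiv_le_of_norm_le_sq hhd hhK (by positivity) one_pos le_rfl
      (by rw [hr] at hy; linarith)).trans ?_
    grw [hy]
    apply le_of_eq_of_le (b := 1 / 10) (by rw [hr]; field_simp; norm_num) (by norm_num)
  have happ : ApproximatesLinearOn (fun y ↦ y + h y) (ContinuousLinearEquiv.refl ℂ E : E →L[ℂ] E)
      (ball 0 r) (1 / 2) := by
    intro x hx y hy
    have heq : x + h x - (y + h y) - (ContinuousLinearEquiv.refl ℂ E : E →L[ℂ] E) (x - y) =
        h x - h y := by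
      change x + h x - (y + h y) - (x - y) = _
      abel
    rw [heq]
    exact norm_sub_le_of_norm_fderiv_le (hhd.mono hsubr) hhfd x hx y hy
  have hc : Subsingleton E ∨ (1 / 2 : NNReal) <
      ‖((ContinuousLinearEquiv.refl ℂ E).symm : E →L[ℂ] E)‖₊⁻¹ := by
    rcases subsingleton_or_nontrivial E with hE | hE
    · exact .inl hE
    · right
      have : ‖((ContinuousLinearEquiv.refl ℂ E).symm : E →L[ℂ] E)‖₊ = 1 :=
        ContinuousLinearMap.nnnorm_id
      rw [this, inv_one]
      norm_num
  let e := happ.toOpenPartialHomeomorph _ _ hc isOpen_ball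
  have hemap : ∀ y, e y = y + h y := fun _ ↦ rfl
  have hsource : e.source = ball 0 r := rfl
  have h0 : h 0 = 0 := by simpa using hhK 0 (mem_ball_self (by positivity))
  have hes0 : e.symm 0 = 0 := by
    have h00 : (0 : E) ∈ e.source := mem_ball_self hr0
    have := e.left_inv h00
    rwa [hemap, h0, add_zero] at this
  have hsymm : ∀ x ∈ e.target, ∃ D : E ≃L[ℂ] E,
      (D : E →L[ℂ] E) = 1 + fderiv ℂ h (e.symm x) ∧
      HasFDerivAt e.symm (D.symm : E →L[ℂ] E) x := by
    intro x hx
    have hy : e.symm x ∈ ball (0 : E) r := e.map_target hx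
    let u : (E →L[ℂ] E)ˣ := Units.oneSub (-fderiv ℂ h (e.symm x)) (by
      rw [norm_neg]
      exact (hhfd _ hy).trans_lt (by norm_num))
    have hu : ((ContinuousLinearEquiv.ofUnit u : E ≃L[ℂ] E) : E →L[ℂ] E) =
        1 + fderiv ℂ h (e.symm x) := by
      change (1 : E →L[ℂ] E) - (-fderiv ℂ h (e.symm x)) = _
      rw [sub_neg_eq_add]
    refine ⟨ContinuousLinearEquiv.ofUnit u, hu, e.hasFDerivAt_symm hx ?_⟩
    rw [hu]
    exact (hasFDerivAt_id _).add
      (hhd.differentiableAt (isOpen_ball.mem_nhds (hsubr hy))).hasFDerivAt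
  refine ⟨e.target, e.open_target, ?_, e.symm, hes0, e.symm.injOn, fun x hx ↦ ?_, fun x hx ↦ ?_⟩
  · have := e.map_source (x := 0) (mem_ball_self hr0)
    rwa [hemap, h0, add_zero] at this
  · obtain ⟨D, -, hD⟩ := hsymm x hx
    exact ⟨D.symm, hD⟩
  · obtain ⟨D, hD1, hD⟩ := hsymm x hx
    have hy : e.symm x ∈ ball (0 : E) r := e.map_target hx
    have hx' : e.symm x + h (e.symm x) = x := e.right_inv hx
    rw [hD.fderiv]
    change D.symm (v x) = _
    rw [ContinuousLinearEquiv.symm_apply_eq]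
    change _ = (D : E →L[ℂ] E) (A (e.symm x))
    rw [hD1, add_apply, hhPDE _ (hsubr hy), hx', one_apply_eq_self, ← add_assoc, ← map_add, hx']
    simp [f]

theorem exists_mul_re_eq_neg_one {a b : ℂ} (hb : b ≠ 0) (hab : ∀ c : ℝ, a ≠ (c : ℂ) * b) :
    ∃ c : ℂ, (c * a).re = -1 ∧ (c * b).re = -1 := by
  have hd : a.im * b.re - a.re * b.im ≠ 0 := by
    intro hd
    have hn : b.re ^ 2 + b.im ^ 2 ≠ 0 := by
      have := (Complex.normSq_pos.2 hb).ne'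
      rwa [Complex.normSq_apply, ← sq, ← sq] at this
    refine hab ((a.re * b.re + a.im * b.im) / (b.re ^ 2 + b.im ^ 2)) (Complex.ext ?_ ?_)
    · rw [Complex.re_ofReal_mul]
      field_simp
      linear_combination (-b.im) * hd
    · rw [Complex.im_ofReal_mul]
      field_simp
      linear_combination b.re * hd
  refine ⟨⟨(b.im - a.im) / (a.im * b.re - a.re * b.im), (b.re - a.re) /
    (a.im * b.re - a.re * b.im)⟩, ?_, ?_⟩
  · simp only [Complex.mul_re]
    rw [div_mul_eq_mul_div, div_mul_eq_mul_div, ← sub_div, div_eq_iff hd]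
    ring
  · simp only [Complex.mul_re]
    rw [div_mul_eq_mul_div, div_mul_eq_mul_div, ← sub_div, div_eq_iff hd]
    ring

/-- The diagonal operator on `ℂ × ℂ` with the given diagonal entries. -/
def diagCLM (a b : ℂ) : (ℂ × ℂ) →L[ℂ] (ℂ × ℂ) :=
  a • (ContinuousLinearMap.inl ℂ ℂ ℂ ∘L ContinuousLinearMap.fst ℂ ℂ ℂ) +
    b • (ContinuousLinearMap.inr ℂ ℂ ℂ ∘L ContinuousLinearMap.snd ℂ ℂ ℂ)

@[simp]
theorem diagCLM_apply (a b : ℂ) (z : ℂ × ℂ) : diagCLM a b z = (a * z.1, b * z.2) := by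
  simp [diagCLM]

theorem isContractingLinearFlow_diagCLM {a b : ℂ} (ha : a.re = -1) (hb : b.re = -1) :
    IsContractingLinearFlow (diagCLM a b) fun z ↦ diagCLM (exp (z * a)) (exp (z * b)) where
  map_zero := by ext <;> simp
  comm z y := by ext <;> simp <;> ring
  deriv z := by
    have h : ∀ a : ℂ, HasDerivAt (fun z ↦ exp (z * a)) (exp (z * a) * a) z := fun a ↦ by
      simpa using ((hasDerivAt_id z).mul_const a).cexp
    refine (((h a).smul_const _).add ((h b).smul_const _)).congr_deriv ?_
    ext <;> simp [mul_comm]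
  norm_le t y := by
    rw [diagCLM_apply, Prod.norm_def, Prod.norm_def, mul_max_of_nonneg _ _ (Real.exp_nonneg _)]
    simp [Complex.norm_exp, ha, hb]

/-- The linear coordinates given by two eigenvectors with distinct eigenvalues. -/
theorem exists_equiv_of_eigenvectors {A : (ℂ × ℂ) →L[ℂ] (ℂ × ℂ)} {a b : ℂ} {e₁ e₂ : ℂ × ℂ}
    (he₁ : e₁ ≠ 0) (he₂ : e₂ ≠ 0) (hAe₁ : A e₁ = a • e₁) (hAe₂ : A e₂ = b • e₂) (hab : a ≠ b) :
    ∃ P : (ℂ × ℂ) ≃L[ℂ] (ℂ × ℂ), ∀ z, A (P z) = P (diagCLM a b z) := by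
  let p : (ℂ × ℂ) →ₗ[ℂ] (ℂ × ℂ) :=
    (LinearMap.fst ℂ ℂ ℂ).smulRight e₁ + (LinearMap.snd ℂ ℂ ℂ).smulRight e₂
  have hp : ∀ z, p z = z.1 • e₁ + z.2 • e₂ := fun _ ↦ rfl
  have hinj : Function.Injective p := by
    rw [injective_iff_map_eq_zero]
    intro z hz
    rw [hp] at hz
    have h1 : z.1 • a • e₁ + z.2 • b • e₂ = 0 := by
      rw [← hAe₁, ← hAe₂, ← map_smul, ← map_smul, ← map_add, hz, map_zero]
    have h2 : ((b - a) * z.2) • e₂ = 0 := by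
      have : ((b - a) * z.2) • e₂ =
          (z.1 • a • e₁ + z.2 • b • e₂) - a • (z.1 • e₁ + z.2 • e₂) := by module
      rw [this, h1, hz, smul_zero, sub_zero]
    have h3 : z.2 = 0 := by simpa [he₂, sub_eq_zero, hab.symm] using h2
    have h4 : z.1 = 0 := by simpa [h3, he₁] using hz
    exact Prod.ext h4 h3
  refine ⟨(LinearEquiv.ofInjectiveEndo p hinj).toContinuousLinearEquiv, fun z ↦ ?_⟩
  change A (p z) = p (diagCLM a b z)
  rw [hp, hp, map_add, map_smul, map_smul, hAe₁, hAe₂, diagCLM_apply]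
  module

theorem stmt5 (v : ℂ × ℂ → ℂ × ℂ) (U : Set (ℂ × ℂ)) (hU : U ∈ nhds (0 : ℂ × ℂ))
    (hv : DifferentiableOn ℂ v U) (hv0 : v 0 = 0)
    (A : (ℂ × ℂ) →L[ℂ] (ℂ × ℂ)) (hA : HasFDerivAt v A 0)
    (lam mu : ℂ) (e₁ e₂ : ℂ × ℂ) (he₁ : e₁ ≠ 0) (he₂ : e₂ ≠ 0)
    (hAe₁ : A e₁ = lam • e₁) (hAe₂ : A e₂ = mu • e₂)
    (hlam : lam ≠ 0) (hmu : mu ≠ 0)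
    (hratio : ∀ c : ℝ, lam ≠ (c : ℂ) * mu) :
    ∃ V : Set (ℂ × ℂ), IsOpen V ∧ (0 : ℂ × ℂ) ∈ V ∧
      ∃ Φ : ℂ × ℂ → ℂ × ℂ, ∃ u : ℂ × ℂ → ℂ,
        DifferentiableOn ℂ Φ V ∧ Φ 0 = 0 ∧
        (∃ D : (ℂ × ℂ) →L[ℂ] (ℂ × ℂ), HasFDerivAt Φ D 0 ∧ ∀ w, D w = 0 → w = 0) ∧
        Set.InjOn Φ V ∧
        DifferentiableOn ℂ u V ∧ (∀ x ∈ V, u x ≠ 0) ∧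
        ∀ x ∈ V, fderiv ℂ Φ x (v x) = u x • A (Φ x) := by
  obtain ⟨c, hc1, hc2⟩ := exists_mul_re_eq_neg_one hmu hratio
  have hc0 : c ≠ 0 := by
    rintro rfl
    simp at hc1
  obtain ⟨P, hP⟩ := exists_equiv_of_eigenvectors he₁ he₂ hAe₁ hAe₂
    (by simpa using hratio 1)
  have hB := isContractingLinearFlow_diagCLM hc1 hc2
  have hP0 : P 0 = 0 := map_zero P
  have hdiag : diagCLM (c * lam) (c * mu) = c • ((P.symm : (ℂ × ℂ) →L[ℂ] (ℂ × ℂ)) ∘L A ∘L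
      (P : (ℂ × ℂ) →L[ℂ] (ℂ × ℂ))) := by
    refine ContinuousLinearMap.ext fun z ↦ ?_
    change _ = c • P.symm (A (P z))
    rw [hP, P.symm_apply_apply]
    simp [mul_assoc]
  have hw : HasFDerivAt (fun z ↦ c • P.symm (v (P z))) (diagCLM (c * lam) (c * mu)) 0 := by
    rw [hdiag]
    rw [← hP0] at hA
    exact (P.symm.hasFDerivAt.comp (0 : ℂ × ℂ) (hA.comp (0 : ℂ × ℂ) P.hasFDerivAt)).const_smul c
  have hwd : DifferentiableOn ℂ (fun z ↦ c • P.symm (v (P z))) (P ⁻¹' U) :=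
    (P.symm.differentiable.comp_differentiableOn
      (hv.comp P.differentiable.differentiableOn fun _ hz ↦ hz)).const_smul c
  have hPU : P ⁻¹' U ∈ 𝓝 (0 : ℂ × ℂ) := P.continuous.continuousAt.preimage_mem_nhds (by rwa [hP0])
  obtain ⟨W, hW, h0W, Ψ, hΨ0, hΨi, hΨd, hΨ⟩ := hB.exists_linearization hPU hwd
    (by simp [hv0]) hw
  have hΦ : ∀ x ∈ P.symm ⁻¹' W, ∃ D : (ℂ × ℂ) ≃L[ℂ] (ℂ × ℂ),
      HasFDerivAt Ψ (D : (ℂ × ℂ) →L[ℂ] (ℂ × ℂ)) (P.symm x) ∧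
      HasFDerivAt (fun x ↦ P (Ψ (P.symm x)))
        (((P.symm.trans D).trans P : (ℂ × ℂ) ≃L[ℂ] (ℂ × ℂ)) : (ℂ × ℂ) →L[ℂ] (ℂ × ℂ)) x := by
    intro x hx
    obtain ⟨D, hD⟩ := hΨd _ hx
    exact ⟨D, hD, P.hasFDerivAt.comp x (hD.comp x P.symm.hasFDerivAt)⟩
  have h0V : (0 : ℂ × ℂ) ∈ P.symm ⁻¹' W := by simpa using h0W
  refine ⟨P.symm ⁻¹' W, hW.preimage P.symm.continuous, h0V, fun x ↦ P (Ψ (P.symm x)), fun _ ↦ 1,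
    fun x hx ↦ ?_, by simp [hΨ0], ?_, fun x hx y hy hxy ↦ ?_, differentiableOn_const 1,
    fun _ _ ↦ one_ne_zero, fun x hx ↦ ?_⟩
  · obtain ⟨D, -, hD⟩ := hΦ x hx
    exact hD.differentiableAt.differentiableWithinAt
  · obtain ⟨D, -, hD⟩ := hΦ 0 h0V
    exact ⟨_, hD, fun w hw ↦ (ContinuousLinearEquiv.map_eq_zero_iff _).1 hw⟩
  · exact P.symm.injective (hΨi hx hy (P.injective hxy))
  · obtain ⟨D, hD1, hD⟩ := hΦ x hx
    have key := hΨ _ hx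
    rw [hD1.fderiv, P.apply_symm_apply, map_smul, hdiag] at key
    have key' : D (P.symm (v x)) = P.symm (A (P (Ψ (P.symm x)))) :=
      smul_right_injective _ hc0 key
    rw [hD.fderiv, one_smul]
    change P (D (P.symm (v x))) = _
    rw [key', P.apply_symm_apply]
end
end

section
/- Let f be a holomorphic map on a neighborhood of 0 in ℂ with f(0) = 0, and let μ = f′(0) satisfy μ ≠ 0 and |μ| ≠ 1. Then f is conjugated to its linear part by a conformal diffeomorphism near 0: there exist a neighborhood V of 0 and an injective holomorphic map h : V → ℂ with h(0) = 0 and h′(0) ≠ 0 such that h(f(t)) = μ·h(t) for all t in a neighborhood of 0. Moreover the conjugating diffeomorphism is unique up to left composition with a linear map: if h̃ is another injective holomorphic map near 0 with h̃(0) = 0 and h̃(f(t)) = μ·h̃(t) near 0, then there exists c ∈ ℂ∖{0} with h̃ = c·h near 0. -/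
noncomputable section

open Complex Set

open Filter Topology in
/-- Koenigs' linearization of an attracting fixed point with nonzero multiplier. -/
theorem exists_linearization_of_norm_lt_one {f : ℂ → ℂ} {μ : ℂ} (hf : AnalyticAt ℂ f 0)
    (hf0 : f 0 = 0) (hμ : HasDerivAt f μ 0) (hμ0 : μ ≠ 0) (hμ1 : ‖μ‖ < 1) :
    ∃ h : ℂ → ℂ, AnalyticAt ℂ h 0 ∧ h 0 = 0 ∧ deriv h 0 = 1 ∧
      ∀ᶠ t in 𝓝 0, h (f t) = μ * h t := by
  have hμpos : 0 < ‖μ‖ := norm_pos_iff.2 hμ0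
  obtain ⟨ρ, hρ1, hρ2⟩ : ∃ ρ, ‖μ‖ < ρ ∧ ρ < √‖μ‖ :=
    exists_between (Real.lt_sqrt_of_sq_lt (by nlinarith))
  have hρ0 : 0 < ρ := hμpos.trans hρ1
  have hρsq : ρ ^ 2 < ‖μ‖ := (Real.lt_sqrt hρ0.le).1 hρ2
  have hρlt : ρ < 1 := by nlinarith
  have hslope (z : ℂ) : f z = z * dslope f 0 z := by
    simpa [hf0] using (sub_smul_dslope f 0 z).symm
  obtain ⟨s, hs, hfs⟩ : ∃ s ∈ 𝓝 (0 : ℂ), DifferentiableOn ℂ f s :=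
    ⟨_, hf.eventually_analyticAt, fun z hz ↦ hz.differentiableAt.differentiableWithinAt⟩
  have hd : DifferentiableAt ℂ (dslope f 0) 0 :=
    ((Complex.differentiableOn_dslope hs).2 hfs).differentiableAt hs
  have hd0 : dslope f 0 0 = μ := by rw [dslope_same, hμ.deriv]
  obtain ⟨C, hC⟩ := hd.isBigO_sub.bound
  have hlt : ∀ᶠ z in 𝓝 (0 : ℂ), ‖dslope f 0 z‖ < ρ :=
    hd.continuousAt.norm.eventually_lt continuousAt_const (by rwa [hd0])
  obtain ⟨r, hr, hball⟩ := Metric.eventually_nhds_iff_ball.1 ((hC.and hlt).and hs)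
  set B := Metric.ball (0 : ℂ) r with hB
  have hfB : DifferentiableOn ℂ f B := hfs.mono fun z hz ↦ (hball z hz).2
  have hbd (z) (hz : z ∈ B) : ‖f z‖ ≤ ρ * ‖z‖ := by
    rw [hslope z, norm_mul, mul_comm]
    gcongr
    exact (hball z hz).1.2.le
  have hquad (z) (hz : z ∈ B) : ‖f z - μ * z‖ ≤ C * ‖z‖ ^ 2 := by
    have h := (hball z hz).1.1
    rw [hd0, sub_zero] at h
    rw [hslope z, show z * dslope f 0 z - μ * z = z * (dslope f 0 z - μ) by ring, norm_mul]
    nlinarith [mul_le_mul_of_nonneg_left h (norm_nonneg z)]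
  have hmaps : MapsTo f B B := fun z hz ↦ by
    have := hbd z hz
    rw [hB, mem_ball_zero_iff] at hz ⊢
    nlinarith [norm_nonneg z]
  have hiter (n : ℕ) (z) (hz : z ∈ B) : ‖f^[n] z‖ ≤ ρ ^ n * r := by
    induction n with
    | zero => simpa using (mem_ball_zero_iff.1 hz).le
    | succ n ih =>
      rw [Function.iterate_succ_apply', pow_succ', mul_assoc]
      exact (hbd _ (hmaps.iterate n hz)).trans (by gcongr)
  have hC0 : 0 ≤ C := by
    have hmem : ((r / 2 : ℝ) : ℂ) ∈ B := by
      rw [hB, mem_ball_zero_iff, norm_real, Real.norm_of_nonneg (by positivity)]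
      linarith
    have hpos : 0 < ‖((r / 2 : ℝ) : ℂ)‖ ^ 2 := by
      rw [norm_real, Real.norm_of_nonneg (by positivity)]
      positivity
    exact nonneg_of_mul_nonneg_left ((norm_nonneg _).trans (hquad _ hmem)) hpos
  let F (n : ℕ) (z : ℂ) : ℂ := (f (f^[n] z) - μ * f^[n] z) / μ ^ (n + 1)
  let u (n : ℕ) : ℝ := C * r ^ 2 / ‖μ‖ * (ρ ^ 2 / ‖μ‖) ^ n
  have hu : Summable u :=
    (summable_geometric_of_lt_one (by positivity) ((div_lt_one hμpos).2 hρsq)).mul_left _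
  have hFu (n : ℕ) (z) (hz : z ∈ B) : ‖F n z‖ ≤ u n := by
    simp only [F, u, norm_div, norm_pow]
    calc ‖f (f^[n] z) - μ * f^[n] z‖ / ‖μ‖ ^ (n + 1)
        ≤ C * (ρ ^ n * r) ^ 2 / ‖μ‖ ^ (n + 1) := by
          gcongr
          refine (hquad _ (hmaps.iterate n hz)).trans ?_
          gcongr
          exact hiter n z hz
      _ = C * r ^ 2 / ‖μ‖ * (ρ ^ 2 / ‖μ‖) ^ n := by
          rw [div_pow, ← pow_mul, mul_pow, ← pow_mul, mul_comm 2 n]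
          field_simp
          ring
  have hFd (n : ℕ) : DifferentiableOn ℂ (F n) B := by
    have hi := hfB.iterate hmaps n
    exact ((hfB.comp hi (hmaps.iterate n)).sub (hi.const_mul μ)).div_const _
  have hB0 : (0 : ℂ) ∈ B := Metric.mem_ball_self hr
  have hBn : B ∈ 𝓝 (0 : ℂ) := Metric.ball_mem_nhds 0 hr
  have hit0 (n : ℕ) : f^[n] 0 = 0 := Function.iterate_fixed hf0 n
  have hF0 (n : ℕ) : F n 0 = 0 := by simp [F, hit0, hf0]
  have hFderiv (n : ℕ) : deriv (F n) 0 = 0 := by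
    have hi : HasDerivAt f^[n] (μ ^ n) 0 := HasDerivAt.iterate 0 hμ hf0 n
    have hi' : HasDerivAt f^[n + 1] (μ ^ (n + 1)) 0 := HasDerivAt.iterate 0 hμ hf0 (n + 1)
    have h := ((hi'.sub (hi.const_mul μ)).div_const (μ ^ (n + 1))).deriv
    rw [show μ ^ (n + 1) - μ * μ ^ n = 0 by ring, zero_div] at h
    rw [← h]
    congr 1
    funext z
    simp only [F, Pi.sub_apply, Function.iterate_succ_apply']
  have hSd := differentiableOn_tsum_of_summable_norm hu hFd Metric.isOpen_ball hFu
  have hS' : deriv (fun w ↦ ∑' n, F n w) 0 = 0 := by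
    have h := hasSum_deriv_of_summable_norm hu hFd Metric.isOpen_ball hFu hB0
    simp only [hFderiv] at h
    exact h.unique hasSum_zero
  refine ⟨fun z ↦ z + ∑' n, F n z, ?_, by simp [hF0], ?_, ?_⟩
  · exact (differentiableOn_id.add hSd).analyticAt hBn
  · have h := (hasDerivAt_id (0 : ℂ)).add (hSd.differentiableAt hBn).hasDerivAt
    rw [hS', add_zero] at h
    exact h.deriv
  · filter_upwards [hBn] with z hz
    have hsum : Summable fun n ↦ F n z := .of_norm_bounded hu fun n ↦ hFu n z hz
    have hshift (n : ℕ) : F n (f z) = μ * F (n + 1) z := by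
      simp only [F, Function.iterate_succ_apply]
      field_simp
      ring
    simp only [hshift]
    rw [tsum_mul_left, hsum.tsum_eq_zero_add]
    simp only [F, Function.iterate_zero_apply]
    field_simp
    ring

open Filter Topology in
/-- Koenigs' linearization of a hyperbolic fixed point with nonzero multiplier. -/
theorem exists_linearization_of_norm_ne_one {f : ℂ → ℂ} {μ : ℂ} (hf : AnalyticAt ℂ f 0)
    (hf0 : f 0 = 0) (hμ : HasDerivAt f μ 0) (hμ0 : μ ≠ 0) (hμ1 : ‖μ‖ ≠ 1) :
    ∃ h : ℂ → ℂ, AnalyticAt ℂ h 0 ∧ h 0 = 0 ∧ deriv h 0 = 1 ∧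
      ∀ᶠ t in 𝓝 0, h (f t) = μ * h t := by
  rcases hμ1.lt_or_gt with hlt | hgt
  · exact exists_linearization_of_norm_lt_one hf hf0 hμ hμ0 hlt
  have hf' : deriv f 0 ≠ 0 := by rwa [hμ.deriv]
  have hg := hf.analyticAt_localInverse hf'
  have hg' := (hf.hasStrictDerivAt.to_localInverse hf').hasDerivAt
  have hgf := hf.hasStrictDerivAt.eventually_left_inverse hf'
  set g := hf.hasStrictDerivAt.localInverse _ _ _ hf'
  have hg0 : g 0 = 0 := by simpa [hf0] using hgf.self_of_nhds
  rw [hf0] at hg hg'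
  rw [hμ.deriv] at hg'
  obtain ⟨h, hh, hh0, hh', heq⟩ := exists_linearization_of_norm_lt_one hg hg0 hg'
    (inv_ne_zero hμ0) (by rw [norm_inv]; exact inv_lt_one_of_one_lt₀ hgt)
  have hft : Tendsto f (𝓝 0) (𝓝 0) := by simpa [hf0] using hf.continuousAt.tendsto
  refine ⟨h, hh, hh0, hh', ?_⟩
  filter_upwards [hft.eventually heq, hgf] with t ht hgt
  rw [hgt] at ht
  rw [ht, mul_inv_cancel_left₀ hμ0]

open Filter Topology in
/-- An analytic solution of `φ ∘ f = μ * φ` near a hyperbolic fixed point of `f` vanishes if its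
first order Taylor polynomial does. -/
theorem eventually_eq_zero_of_semiconj_mul {f φ : ℂ → ℂ} {μ : ℂ} (hf0 : f 0 = 0)
    (hμ : HasDerivAt f μ 0) (hμ0 : μ ≠ 0) (hμ1 : ‖μ‖ ≠ 1) (hφ : AnalyticAt ℂ φ 0)
    (hφ0 : φ 0 = 0) (hφ' : deriv φ 0 = 0) (heq : ∀ᶠ t in 𝓝 0, φ (f t) = μ * φ t) :
    ∀ᶠ t in 𝓝 0, φ t = 0 := by
  rw [← analyticOrderAt_eq_top]
  by_contra htop
  obtain ⟨u, hu, hu0, hφu⟩ := hφ.analyticOrderAt_ne_top.1 htop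
  generalize analyticOrderNatAt φ 0 = n at hφu
  simp only [sub_zero, smul_eq_mul] at hφu
  have hft : Tendsto f (𝓝 0) (𝓝 0) := by simpa [hf0] using hμ.continuousAt.tendsto
  have hslope (z : ℂ) : f z = z * dslope f 0 z := by
    simpa [hf0] using (sub_smul_dslope f 0 z).symm
  have hd : Tendsto (dslope f 0) (𝓝 0) (𝓝 μ) := by
    have h := (continuousAt_dslope_same.2 hμ.differentiableAt).tendsto
    rwa [dslope_same, hμ.deriv] at h
  have hl : Tendsto (fun z ↦ dslope f 0 z ^ n * u (f z)) (𝓝[≠] 0) (𝓝 (μ ^ n * u 0)) :=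
    ((hd.pow n).mul (hu.continuousAt.tendsto.comp hft)).mono_left nhdsWithin_le_nhds
  have hr : Tendsto (fun z ↦ μ * u z) (𝓝[≠] 0) (𝓝 (μ * u 0)) :=
    (hu.continuousAt.tendsto.const_mul μ).mono_left nhdsWithin_le_nhds
  have hμn : μ ^ n = μ := by
    refine mul_right_cancel₀ hu0 (tendsto_nhds_unique_of_eventuallyEq hl hr ?_)
    filter_upwards [self_mem_nhdsWithin, nhdsWithin_le_nhds heq, nhdsWithin_le_nhds hφu,
      nhdsWithin_le_nhds (hft.eventually hφu)] with z hz h1 h2 h3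
    rw [h2, h3] at h1
    refine mul_left_cancel₀ (pow_ne_zero n hz) ?_
    calc z ^ n * (dslope f 0 z ^ n * u (f z)) = (z * dslope f 0 z) ^ n * u (f z) := by ring
      _ = z ^ n * (μ * u z) := by rw [← hslope, h1]; ring
  match n with
  | 0 => exact hu0 (by simpa [hφ0] using hφu.self_of_nhds.symm)
  | 1 =>
    have h := (hasDerivAt_id (0 : ℂ)).mul hu.differentiableAt.hasDerivAt
    have h2 : deriv φ 0 = deriv (fun z ↦ z ^ 1 * u z) 0 := EventuallyEq.deriv_eq hφu
    have h3 : (fun z ↦ z ^ 1 * u z) = id * u := by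
      funext z
      simp
    rw [hφ', h3, h.deriv] at h2
    exact hu0 (by simpa using h2.symm)
  | n + 2 =>
    have h : μ ^ (n + 1) = 1 := mul_right_cancel₀ hμ0 (by rw [← pow_succ, hμn, one_mul])
    refine hμ1 ((pow_eq_one_iff_of_nonneg (norm_nonneg μ) n.succ_ne_zero).1 ?_)
    rw [← norm_pow, h, norm_one]

open Filter Topology in
/-- An injective linearization is a nonzero multiple of any normalized one. -/
theorem exists_ne_zero_eventually_eq_mul {f h k : ℂ → ℂ} {μ : ℂ} {V : Set ℂ} (hf0 : f 0 = 0)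
    (hμ : HasDerivAt f μ 0) (hμ0 : μ ≠ 0) (hμ1 : ‖μ‖ ≠ 1) (hh : AnalyticAt ℂ h 0)
    (hh0 : h 0 = 0) (hh' : deriv h 0 = 1) (hhf : ∀ᶠ t in 𝓝 0, h (f t) = μ * h t)
    (hV : V ∈ 𝓝 0) (hk : DifferentiableOn ℂ k V) (hinj : InjOn k V) (hk0 : k 0 = 0)
    (hkf : ∀ t ∈ V, k (f t) = μ * k t) :
    ∃ c : ℂ, c ≠ 0 ∧ ∀ᶠ t in 𝓝 0, k t = c * h t := by
  have hka : AnalyticAt ℂ k 0 := hk.analyticAt hV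
  have hev : ∀ᶠ t in 𝓝 0, k t = deriv k 0 * h t := by
    have hzero := eventually_eq_zero_of_semiconj_mul (φ := fun t ↦ k t - deriv k 0 * h t)
      hf0 hμ hμ0 hμ1 (hka.sub (analyticAt_const.mul hh)) (by simp [hk0, hh0])
      (by
        have h1 := hka.differentiableAt.hasDerivAt.sub
          (hh.differentiableAt.hasDerivAt.const_mul (deriv k 0))
        rw [hh', mul_one, sub_self] at h1
        exact h1.deriv)
      (by
        filter_upwards [hhf, hV] with t h1 h2
        rw [h1, hkf t h2]
        ring)
    filter_upwards [hzero] with t ht using sub_eq_zero.1 ht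
  refine ⟨deriv k 0, fun hc ↦ ?_, hev⟩
  have hmem : ∀ᶠ t in 𝓝[≠] (0 : ℂ), t ∈ V ∧ k t = deriv k 0 * h t :=
    nhdsWithin_le_nhds (inter_mem hV hev)
  obtain ⟨t, ⟨htV, hkt⟩, ht0⟩ := (hmem.and self_mem_nhdsWithin).exists
  refine ht0 (hinj htV (mem_of_mem_nhds hV) ?_)
  rw [hkt, hc, zero_mul, hk0]

theorem stmt6 (f : ℂ → ℂ) (U : Set ℂ) (hU : U ∈ nhds (0 : ℂ))
    (hf : DifferentiableOn ℂ f U) (hf0 : f 0 = 0)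
    (μ : ℂ) (hμ : HasDerivAt f μ 0) (hμ0 : μ ≠ 0) (hμ1 : ‖μ‖ ≠ 1) :
    (∃ V ∈ nhds (0 : ℂ), ∃ h : ℂ → ℂ,
        DifferentiableOn ℂ h V ∧ Set.InjOn h V ∧ h 0 = 0 ∧ deriv h 0 ≠ 0 ∧
        ∀ t ∈ V, h (f t) = μ * h t) ∧
    ∀ V₁ ∈ nhds (0 : ℂ), ∀ V₂ ∈ nhds (0 : ℂ), ∀ h₁ h₂ : ℂ → ℂ,
      DifferentiableOn ℂ h₁ V₁ → Set.InjOn h₁ V₁ → h₁ 0 = 0 →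
      (∀ t ∈ V₁, h₁ (f t) = μ * h₁ t) →
      DifferentiableOn ℂ h₂ V₂ → Set.InjOn h₂ V₂ → h₂ 0 = 0 →
      (∀ t ∈ V₂, h₂ (f t) = μ * h₂ t) →
      ∃ c : ℂ, c ≠ 0 ∧ ∀ᶠ t in nhds (0 : ℂ), h₂ t = c * h₁ t := by
  have hfa : AnalyticAt ℂ f 0 := hf.analyticAt hU
  obtain ⟨h, hh, hh0, hh', hhf⟩ := exists_linearization_of_norm_ne_one hfa hf0 hμ hμ0 hμ1
  constructor
  · have hderiv : deriv h 0 ≠ 0 := by simp [hh']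
    have hinv := hh.hasStrictDerivAt.eventually_left_inverse hderiv
    refine ⟨_, Filter.inter_mem hh.eventually_analyticAt (Filter.inter_mem hinv hhf), h,
      fun z hz ↦ hz.1.differentiableAt.differentiableWithinAt, fun x hx y hy hxy ↦ ?_,
      hh0, hderiv, fun t ht ↦ ht.2.2⟩
    rw [← hx.2.1, hxy, hy.2.1]
  · intro V₁ hV₁ V₂ hV₂ h₁ h₂ hd₁ hi₁ hz₁ he₁ hd₂ hi₂ hz₂ he₂
    obtain ⟨c₁, hc₁, hev₁⟩ := exists_ne_zero_eventually_eq_mul hf0 hμ hμ0 hμ1 hh hh0 hh' hhf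
      hV₁ hd₁ hi₁ hz₁ he₁
    obtain ⟨c₂, hc₂, hev₂⟩ := exists_ne_zero_eventually_eq_mul hf0 hμ hμ0 hμ1 hh hh0 hh' hhf
      hV₂ hd₂ hi₂ hz₂ he₂
    refine ⟨c₂ / c₁, div_ne_zero hc₂ hc₁, ?_⟩
    filter_upwards [hev₁, hev₂] with t ht₁ ht₂
    rw [ht₁, ht₂]
    field_simp
end
end
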